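/- Let R be a local Cohen–Macaulay ring with infinite residue field, and let I be an R-ideal of height g, analytic spread ℓ and minimal number of generators n, satisfying G_ℓ and universally weakly (ℓ−1)-residually S₂. Suppose that for every 𝔭 ∈ Q(I), R_𝔭 is Gorenstein and depth (R/I^j)_𝔭 ≥ ℓ − g − j + 1 whenever 1 ≤ j ≤ ℓ − g. If the reduction number of I is at most ℓ − g + 1, then core(I) = (J : I)·J = (J : I)·I for every minimal reduction J of I, and in that case γ(I) ≤ ℓ · C(n−g, ℓ−g+1) + 1, where C(·,·) denotes the binomial coefficient. -/

import Mathlib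

open IsLocalRing

universe u v

namespace CPU

section Defs

variable {R : Type u} [CommRing R]

/-- The minimal number of generators of a submodule, as an extended natural number. -/
noncomputable def muE {M : Type v} [AddCommGroup M] [Module R M] (N : Submodule R M) : ℕ∞ :=
  sInf {n : ℕ∞ | ∃ s : Finset M, (s.card : ℕ∞) = n ∧ Submodule.span R (s : Set M) = N}

/-- The Krull dimension of a ring, valued in `WithBot ℕ∞`. -/
noncomputable def rDim (S : Type v) [CommRing S] : WithBot ℕ∞ :=
  ringKrullDim S

/-- `J` is a reduction of `I`. -/
def IsReduction (J I : Ideal R) : Prop :=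
  J ≤ I ∧ ∃ r : ℕ, I ^ (r + 1) = J * I ^ r

/-- `J` is a minimal reduction of `I`. -/
def IsMinimalReduction (J I : Ideal R) : Prop :=
  IsReduction J I ∧ ∀ J' : Ideal R, IsReduction J' I → J' ≤ J → J' = J

/-- The core of an ideal: the intersection of all of its minimal reductions. -/
noncomputable def core (I : Ideal R) : Ideal R :=
  sInf {J : Ideal R | IsMinimalReduction J I}

/-- The reduction number of `I`. -/
noncomputable def reductionNumber (I : Ideal R) : ℕ∞ :=
  sInf {n : ℕ∞ | ∃ r : ℕ, (r : ℕ∞) = n ∧ ∃ J : Ideal R,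
    IsMinimalReduction J I ∧ I ^ (r + 1) = J * I ^ r}

/-- `γ(I)`: the least number of minimal reductions whose intersection is the core. -/
noncomputable def gamma (I : Ideal R) : ℕ∞ :=
  sInf {n : ℕ∞ | ∃ t : ℕ, (t : ℕ∞) = n ∧ ∃ Js : Fin t → Ideal R,
    (∀ i, IsMinimalReduction (Js i) I) ∧ core I = ⨅ i, Js i}

/-- The height of an ideal. -/
noncomputable def ht (I : Ideal R) : WithBot ℕ∞ :=
  ⨅ (p : PrimeSpectrum R) (_ : I ≤ p.asIdeal),
    rDim (Localization.AtPrime p.asIdeal)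

/-- The Krull dimension of the special fiber ring of `I`,
i.e. the analytic spread of `I`. -/
noncomputable def fiberDim [IsLocalRing R] (I : Ideal R) : WithBot ℕ∞ :=
  rDim (↥(reesAlgebra I) ⧸
    (Ideal.map (algebraMap R ↥(reesAlgebra I)) (maximalIdeal R)))

/-- The condition `G_s`. -/
def Gcond (I : Ideal R) (s : ℕ) : Prop :=
  ∀ p : PrimeSpectrum R, I ≤ p.asIdeal →
    rDim (Localization.AtPrime p.asIdeal) < (s : WithBot ℕ∞) →
    (muE (Ideal.map (algebraMap R (Localization.AtPrime p.asIdeal)) I) : WithBot ℕ∞) ≤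
      rDim (Localization.AtPrime p.asIdeal)

/-- Depth of a module over a local ring, via lengths of regular sequences in the
maximal ideal. -/
noncomputable def mDepth (R : Type u) [CommRing R] [IsLocalRing R]
    (M : Type v) [AddCommGroup M] [Module R M] : ℕ∞ :=
  sSup {n : ℕ∞ | ∃ rs : List R, (∀ x ∈ rs, x ∈ maximalIdeal R) ∧
    RingTheory.Sequence.IsRegular M rs ∧ (rs.length : ℕ∞) = n}

/-- Depth of the quotient `R/K` of a local ring `R`. -/
noncomputable def qDepth (R : Type u) [CommRing R] [IsLocalRing R] (K : Ideal R) : ℕ∞ :=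
  mDepth R (R ⧸ K)

/-- The socle of `R/K`, for `R` local. -/
noncomputable def socle (R : Type u) [CommRing R] [IsLocalRing R] (K : Ideal R) :
    Ideal (R ⧸ K) :=
  Submodule.colon (⊥ : Ideal (R ⧸ K)) (Ideal.map (Ideal.Quotient.mk K) (maximalIdeal R))

/-- The Cohen–Macaulay type of the quotient `R/K` of a local ring `R`. -/
noncomputable def qType (R : Type u) [CommRing R] [IsLocalRing R] (K : Ideal R) : ℕ∞ :=
  sInf {n : ℕ∞ | ∃ rs : List R, (∀ x ∈ rs, x ∈ maximalIdeal R) ∧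
    RingTheory.Sequence.IsRegular (R ⧸ K) rs ∧ (rs.length : ℕ∞) = qDepth R K ∧
    muE (socle R (K ⊔ Ideal.ofList rs)) = n}

/-- Cohen–Macaulayness for a quotient `R/K` of a local ring `R`. -/
def IsCMQuot (R : Type u) [CommRing R] [IsLocalRing R] (K : Ideal R) : Prop :=
  rDim (R ⧸ K) = (qDepth R K : WithBot ℕ∞)

/-- A Cohen–Macaulay local ring: depth equals Krull dimension. -/
def IsCMLocalRing (R : Type u) [CommRing R] [IsLocalRing R] : Prop :=
  rDim R = (qDepth R (⊥ : Ideal R) : WithBot ℕ∞)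

/-- A Gorenstein local ring: Cohen–Macaulay of type one. -/
def IsGorensteinLocalRing (R : Type u) [CommRing R] [IsLocalRing R] : Prop :=
  IsCMLocalRing R ∧ qType R (⊥ : Ideal R) = 1

/-- Gorensteinness of the quotient ring `R/K` of a local ring. -/
def IsGorQuot (R : Type u) [CommRing R] [IsLocalRing R] (K : Ideal R) : Prop :=
  IsCMQuot R K ∧ qType R K = 1

/-- A regular local ring: the maximal ideal is generated by `dim R` elements. -/
def IsRegularLocal (R : Type u) [CommRing R] [IsLocalRing R] : Prop :=
  IsNoetherianRing R ∧ (muE (maximalIdeal R) : WithBot ℕ∞) = rDim R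

/-- Serre's condition `S₂` for the quotient ring `R/K`. -/
def QuotS2 (K : Ideal R) : Prop :=
  ∀ (q : Ideal R) (hq : q.IsPrime), K ≤ q →
    letI := hq
    min 2 (rDim ((Localization.AtPrime q) ⧸
        (Ideal.map (algebraMap R (Localization.AtPrime q)) K)))
      ≤ (qDepth (Localization.AtPrime q)
          (Ideal.map (algebraMap R (Localization.AtPrime q)) K) : WithBot ℕ∞)

/-- `K` is an `s`-residual intersection of `I`. -/
def IsResidualIntersection (I K : Ideal R) (s : ℕ) : Prop :=
  K ≠ ⊤ ∧ ht I ≤ (s : WithBot ℕ∞) ∧ (s : WithBot ℕ∞) ≤ ht K ∧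
    ∃ a : Ideal R, a ≤ I ∧ (∃ f : Finset R, f.card ≤ s ∧ Ideal.span (f : Set R) = a) ∧
      K = Submodule.colon a I

/-- `K` is a geometric `s`-residual intersection of `I`. -/
def IsGeometricRI (I K : Ideal R) (s : ℕ) : Prop :=
  IsResidualIntersection I K s ∧ (s : WithBot ℕ∞) + 1 ≤ ht (I ⊔ K)

/-- `I` is weakly `s`-residually `S₂`. -/
def WeaklyResS2 (I : Ideal R) (s : ℕ) : Prop :=
  ∀ i ≤ s, ∀ K : Ideal R, IsGeometricRI I K i → QuotS2 K

/-- The condition `AN_s` for `I`. -/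
def ANcond [IsLocalRing R] (I : Ideal R) (s : ℕ) : Prop :=
  ∀ i ≤ s, ∀ K : Ideal R, IsResidualIntersection I K i → IsCMQuot R K

/-- The condition `AN_s⁻` for `I`. -/
def ANminus [IsLocalRing R] (I : Ideal R) (s : ℕ) : Prop :=
  ∀ i ≤ s, ∀ K : Ideal R, IsGeometricRI I K i → IsCMQuot R K

/-- `I` is universally weakly `s`-residually `S₂`: for every finite set of
variables, the extension of `I` to `R(x₁, …, x_n)` is weakly `s`-residually `S₂`. -/
def UnivWeaklyResS2 [IsLocalRing R] (I : Ideal R) (s : ℕ) : Prop :=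
  ∀ (n : ℕ)
    (hP : (Ideal.map (MvPolynomial.C (σ := Fin n)) (maximalIdeal R)).IsPrime),
    letI := hP
    WeaklyResS2 (Ideal.map
      ((algebraMap (MvPolynomial (Fin n) R)
        (Localization.AtPrime
          (Ideal.map (MvPolynomial.C (σ := Fin n)) (maximalIdeal R)))).comp
        (MvPolynomial.C)) I) s

/-- The `j`-th Fitting ideal of (the module) `I`. -/
noncomputable def fittingIdeal (I : Ideal R) (j : ℕ) : Ideal R :=
  ⨆ (n : ℕ) (π : (Fin n → R) →ₗ[R] R) (_ : LinearMap.range π = I),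
    Ideal.span {d : R | ∃ (v : Fin (n - j) → (Fin n → R)) (r : Fin (n - j) → Fin n),
      (∀ k, π (v k) = 0) ∧ d = Matrix.det (Matrix.of fun i k => v k (r i))}

/-- The set `Q(I)` of primes containing `Fitt_ℓ(I)` at which `R` has dimension `ℓ`
and `I` has analytic spread `ℓ`. -/
def QSet [IsLocalRing R] (I : Ideal R) (l : ℕ) : Set (PrimeSpectrum R) :=
  {p | fittingIdeal I l ≤ p.asIdeal ∧
    rDim (Localization.AtPrime p.asIdeal) = (l : WithBot ℕ∞) ∧
    fiberDim (Ideal.map (algebraMap R (Localization.AtPrime p.asIdeal)) I)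
      = (l : WithBot ℕ∞)}

/-- An ideal is integrally closed if it admits no larger ideal of which it is a
reduction. -/
def IsIntClosedIdeal (I : Ideal R) : Prop :=
  ∀ J : Ideal R, IsReduction I J → J = I

/-- A normal ideal: all powers are integrally closed. -/
def IsNormalIdeal (I : Ideal R) : Prop :=
  ∀ j : ℕ, IsIntClosedIdeal (I ^ j)

/-- `φ` is a presentation matrix of the ideal `I` (with `n = μ(I)` rows). -/
def Presents {n m : ℕ} (φ : Matrix (Fin n) (Fin m) R) (I : Ideal R) : Prop :=
  muE I = (n : ℕ∞) ∧ ∃ π : (Fin n → R) →ₗ[R] R, LinearMap.range π = I ∧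
    LinearMap.range (Matrix.toLin' φ) = LinearMap.ker π

/-- The ideal of `t × t` minors of a matrix. -/
noncomputable def minorsIdeal {n m : ℕ} (t : ℕ) (φ : Matrix (Fin n) (Fin m) R) : Ideal R :=
  Ideal.span {d : R | ∃ (r : Fin t → Fin n) (c : Fin t → Fin m),
    d = (φ.submatrix r c).det}

/-- The grade of an ideal: the supremum of lengths of regular sequences contained
in it. -/
noncomputable def grade (I : Ideal R) : ℕ∞ :=
  sSup {n : ℕ∞ | ∃ rs : List R, (∀ x ∈ rs, x ∈ I) ∧
    RingTheory.Sequence.IsRegular R rs ∧ (rs.length : ℕ∞) = n}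

end Defs

/-- `M` has projective dimension at most `n` over `R`. -/
def ProjDimLE (R : Type u) [CommRing R] :
    (n : ℕ) → (M : Type u) → [AddCommGroup M] → [Module R M] → Prop
  | 0, M, _, _ => Module.Projective R M
  | n + 1, M, _, _ => ∃ (k : ℕ) (f : (Fin k → R) →ₗ[R] M), Function.Surjective f ∧
      ProjDimLE R n ↥(LinearMap.ker f)

section Defs2

variable {R : Type u} [CommRing R]

/-- `M` has projective dimension exactly `n` over `R`. -/
def ProjDimEq (R : Type u) [CommRing R] (M : Type u) [AddCommGroup M] [Module R M]
    (n : ℕ) : Prop :=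
  ProjDimLE R n M ∧ ∀ m : ℕ, ProjDimLE R m M → n ≤ m

/-- A perfect ideal: the projective dimension of `R/I` equals the grade of `I`. -/
def IsPerfectIdeal (I : Ideal R) : Prop :=
  ∃ g : ℕ, grade I = (g : ℕ∞) ∧ ProjDimEq R (R ⧸ I) g

/-- The multiplicative set which is the complement of the union of the associated
primes of `R/H`. -/
def assComplement (H : Ideal R) : Submonoid R where
  carrier := {r : R | ∀ p ∈ associatedPrimes R (R ⧸ H), r ∉ p}
  one_mem' := fun p hp => (Ideal.ne_top_iff_one p).mp hp.1.ne_top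
  mul_mem' := fun {a b} ha hb p hp hab =>
    (hp.1.mem_or_mem hab).elim (ha p hp) (hb p hp)

/-- The `j`-th symbolic power of `H`. -/
noncomputable def symbolicPower (H : Ideal R) (j : ℕ) : Ideal R :=
  Ideal.comap (algebraMap R (Localization (assComplement H)))
    (Ideal.map (algebraMap R (Localization (assComplement H))) (H ^ j))

/-- Serre's condition `S₂` for a module. -/
def ModuleS2 (S : Type u) [CommRing S] (M : Type v) [AddCommGroup M] [Module S M] : Prop :=
  ∀ (q : Ideal S) (hq : q.IsPrime),
    letI := hq
    min 2 (rDim ((Localization.AtPrime q) ⧸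
        (Module.annihilator (Localization.AtPrime q) (LocalizedModule q.primeCompl M))))
      ≤ (mDepth (Localization.AtPrime q) (LocalizedModule q.primeCompl M) : WithBot ℕ∞)

/-- `M` is a maximal Cohen–Macaulay `S`-module. -/
def IsMCM (S : Type u) [CommRing S] (M : Type v) [AddCommGroup M] [Module S M] : Prop :=
  ∀ (q : Ideal S) (hq : q.IsMaximal),
    letI := hq.isPrime
    (mDepth (Localization.AtPrime q) (LocalizedModule q.primeCompl M) : WithBot ℕ∞) =
      rDim (Localization.AtPrime q)

end Defs2



section Part1
set_option linter.all false

section A1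
variable {R : Type u} [CommRing R]

/-- `y` is regular on the subquotient `A/B`. -/
def Reg (A B : Ideal R) (y : R) : Prop := ∀ u ∈ A, y * u ∈ B → u ∈ B

/-- `q` is an associated prime of the subquotient `A/B`. -/
def AssP (A B q : Ideal R) : Prop := q.IsPrime ∧ ∃ u ∈ A, ∀ r, r ∈ q ↔ r * u ∈ B

/-- the socle of `A/B` relative to `c` vanishes -/
def Soc0 (c A B : Ideal R) : Prop := ∀ u ∈ A, (∀ r ∈ c, r * u ∈ B) → u ∈ B

lemma AssP.mono {A A' B q : Ideal R} (h : AssP A B q) (hA : A ≤ A') : AssP A' B q :=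
  ⟨h.1, h.2.choose, hA h.2.choose_spec.1, h.2.choose_spec.2⟩

lemma AssP.le {A B q : Ideal R} (h : AssP A B q) : B ≤ q := by
  obtain ⟨_, u, _, hu⟩ := h
  exact fun b hb => (hu b).2 (B.mul_mem_right _ hb)

lemma exists_assP [IsNoetherianRing R] {A B : Ideal R} {u : R} (hu : u ∈ A) (huB : u ∉ B) :
    ∃ q, AssP A B q ∧ ∀ r, r * u ∈ B → r ∈ q := by
  let S : Set (Ideal R) := {c | ∃ w, w * u ∉ B ∧ c = B.colon {w * u}}
  have hS : S.Nonempty := ⟨_, 1, by simpa using huB, rfl⟩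
  obtain ⟨q, ⟨w, hw, rfl⟩, hmax⟩ := set_has_maximal_iff_noetherian.2 inferInstance S hS
  refine ⟨_, ⟨?_, w * u, A.mul_mem_left _ hu, fun r => Submodule.mem_colon_singleton⟩, ?_⟩
  · refine ⟨?_, ?_⟩
    · rw [Ideal.ne_top_iff_one]
      simpa [Submodule.mem_colon_singleton] using hw
    · intro x y hxy
      rw [or_iff_not_imp_right]
      intro hy
      simp only [Submodule.mem_colon_singleton, smul_eq_mul] at hxy hy ⊢
      by_contra hx
      refine hmax (B.colon {y * w * u}) ⟨y * w, by simpa [mul_assoc] using hy, rfl⟩ ?_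
      refine lt_of_le_of_ne ?_ ?_
      · intro r hr
        simp only [Submodule.mem_colon_singleton, smul_eq_mul] at hr ⊢
        convert B.mul_mem_left y hr using 1; ring
      · intro h
        apply hx
        have : x ∈ B.colon {y * w * u} := by
          simp only [Submodule.mem_colon_singleton, smul_eq_mul]
          convert hxy using 1; ring
        rw [← h] at this
        simpa [Submodule.mem_colon_singleton] using this
  · intro r hr
    simp only [Submodule.mem_colon_singleton, smul_eq_mul]
    convert B.mul_mem_left w hr using 1; ring

lemma assP_top_iff [IsNoetherianRing R] {B q : Ideal R} :
    AssP ⊤ B q ↔ q ∈ associatedPrimes R (R ⧸ B) := by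
  rw [associatedPrimes, Set.mem_ofPred_eq, isAssociatedPrime_iff]
  refine and_congr_right fun _ => ?_
  constructor
  · rintro ⟨u, -, hu⟩
    refine ⟨Ideal.Quotient.mk B u, ?_⟩
    ext r
    rw [hu, Submodule.mem_colon_singleton, Submodule.mem_bot, ← Ideal.Quotient.eq_zero_iff_mem]
    rfl
  · rintro ⟨x, hx⟩
    obtain ⟨u, rfl⟩ := Ideal.Quotient.mk_surjective x
    refine ⟨u, trivial, fun r => ?_⟩
    rw [hx, Submodule.mem_colon_singleton, Submodule.mem_bot, ← Ideal.Quotient.eq_zero_iff_mem]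
    rfl

lemma assP_finite [IsNoetherianRing R] (A B : Ideal R) : {q | AssP A B q}.Finite := by
  refine (associatedPrimes.finite R (R ⧸ B)).subset fun q hq => ?_
  exact assP_top_iff.1 (hq.mono le_top)

lemma avoid_primes {c : Ideal R} {X : Set (Ideal R)} (hX : X.Finite)
    (hp : ∀ q ∈ X, q.IsPrime) (h : ∀ q ∈ X, ¬ c ≤ q) : ∃ x ∈ c, ∀ q ∈ X, x ∉ q := by
  by_contra! hc
  have := (Ideal.subset_union_prime (s := hX.toFinset) (f := id) (I := c) ⊤ ⊤
    (fun i hi _ _ => hp i (by simpa using hi))).1 (by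
      intro x hx
      obtain ⟨q, hq, hxq⟩ := hc x hx
      simp only [Set.mem_iUnion]
      exact ⟨q, by simpa using hq, hxq⟩)
  obtain ⟨q, hq, hle⟩ := this
  exact h q (by simpa using hq) hle

lemma reg_of_avoid [IsNoetherianRing R] {A B : Ideal R} {y : R} (h : ∀ q, AssP A B q → y ∉ q) :
    Reg A B y := by
  intro u hu hyu
  by_contra hc
  obtain ⟨q, hq, h2⟩ := exists_assP hu hc
  exact h q hq (h2 y hyu)

lemma Reg.notMem {A B q : Ideal R} {y : R} (h : Reg A B y) (hq : AssP A B q) : y ∉ q := by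
  obtain ⟨hp, u, hu, h2⟩ := hq
  intro hy
  exact hp.ne_top ((Ideal.eq_top_iff_one _).2 ((h2 1).2 (by simpa using h u hu ((h2 y).1 hy))))

lemma Soc0.not_le {c A B q : Ideal R} (h : Soc0 c A B) (hq : AssP A B q) : ¬ c ≤ q := by
  obtain ⟨hp, u, hu, h2⟩ := hq
  intro hy
  have := h u hu (fun r hr => (h2 r).1 (hy hr))
  exact hp.ne_top ((Ideal.eq_top_iff_one _).2 ((h2 1).2 (by simpa using this)))

lemma Reg.soc0 {c A B : Ideal R} {y : R} (hy : y ∈ c) (h : Reg A B y) : Soc0 c A B :=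
  fun u hu h2 => h u hu (h2 y hy)

/-- simultaneous regular element for finitely many subquotients with zero socle -/
lemma exists_reg [IsNoetherianRing R] (c : Ideal R) (X : List (Ideal R × Ideal R))
    (h : ∀ p ∈ X, Soc0 c p.1 p.2) : ∃ y ∈ c, ∀ p ∈ X, Reg p.1 p.2 y := by
  obtain ⟨y, hy, h2⟩ := avoid_primes (c := c) (X := ⋃ p ∈ {p | p ∈ X}, {q | AssP p.1 p.2 q})
    (Set.Finite.biUnion (List.finite_toSet X) (fun p _ => assP_finite _ _))
    (by simp only [Set.mem_iUnion]; rintro q ⟨p, _, hq⟩; exact hq.1)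
    (by simp only [Set.mem_iUnion]; rintro q ⟨p, hp, hq⟩; exact (h p hp).not_le hq)
  refine ⟨y, hy, fun p hp => reg_of_avoid fun q hq => h2 q ?_⟩
  simp only [Set.mem_iUnion]
  exact ⟨p, hp, hq⟩

lemma mem_sup_smul {A B : Ideal R} {x z : R} :
    z ∈ B ⊔ Ideal.span {x} * A ↔ ∃ a ∈ A, z - x * a ∈ B := by
  rw [Submodule.mem_sup]
  constructor
  · rintro ⟨b, hb, w, hw, rfl⟩
    obtain ⟨a, ha, rfl⟩ := Ideal.mem_span_singleton_mul.1 hw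
    exact ⟨a, ha, by simpa using hb⟩
  · rintro ⟨a, ha, h⟩
    exact ⟨_, h, x * a, Ideal.mem_span_singleton_mul.2 ⟨a, ha, rfl⟩, by ring⟩

lemma mem_sup_span {B : Ideal R} {x z : R} :
    z ∈ B ⊔ Ideal.span {x} ↔ ∃ a, z - x * a ∈ B := by
  rw [← Ideal.mul_top (Ideal.span {x}), mem_sup_smul]; simp

lemma Reg.swap {A B : Ideal R} {x z : R} (hx : Reg A B x)
    (hz : Reg A (B ⊔ Ideal.span {x} * A) z) : Reg A (B ⊔ Ideal.span {z} * A) x := by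
  intro u hu hxu
  obtain ⟨v, hv, hb⟩ := mem_sup_smul.1 hxu
  have h1 : v ∈ B ⊔ Ideal.span {x} * A := by
    refine hz v hv (mem_sup_smul.2 ⟨u, hu, ?_⟩)
    simpa using B.neg_mem hb
  obtain ⟨w, hw, h2⟩ := mem_sup_smul.1 h1
  refine mem_sup_smul.2 ⟨w, hw, hx _ (A.sub_mem hu (A.mul_mem_left _ hw)) ?_⟩
  have := B.add_mem hb (B.mul_mem_left z h2)
  convert this using 1; ring

lemma soc0_exchange {c A B : Ideal R} {x y : R} (hxc : x ∈ c) (hyc : y ∈ c)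
    (hx : Reg A B x) (hy : Reg A B y)
    (h : Soc0 c A (B ⊔ Ideal.span {x} * A)) : Soc0 c A (B ⊔ Ideal.span {y} * A) := by
  intro v hv h2
  -- x v = y u + b
  obtain ⟨u, hu, hb⟩ := mem_sup_smul.1 (h2 x hxc)
  have h3 : u ∈ B ⊔ Ideal.span {x} * A := by
    refine h u hu fun r hr => ?_
    obtain ⟨w, hw, hb2⟩ := mem_sup_smul.1 (h2 r hr)
    refine mem_sup_smul.2 ⟨w, hw, hy _ ?_ ?_⟩
    · exact A.sub_mem (A.mul_mem_left _ hu) (A.mul_mem_left _ hw)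
    · have := B.sub_mem (B.mul_mem_left x hb2) (B.mul_mem_left r hb)
      convert this using 1; ring
  obtain ⟨w, hw, h4⟩ := mem_sup_smul.1 h3
  refine mem_sup_smul.2 ⟨w, hw, hx _ (A.sub_mem hv (A.mul_mem_left _ hw)) ?_⟩
  have := B.add_mem hb (B.mul_mem_left y h4)
  convert this using 1; ring

/-- Generic recursive predicate. -/
def TT [IsLocalRing R] (T0 : Ideal R → Ideal R → Prop) (A : Ideal R) :
    ℕ → Ideal R → Ideal R → Prop
  | 0, B, s => T0 B s
  | n + 1, B, s => ∃ y ∈ maximalIdeal R, Reg A B y ∧ Reg ⊤ s y ∧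
      TT T0 A n (B ⊔ Ideal.span {y} * A) (s ⊔ Ideal.span {y} * ⊤)

theorem TT.drop [IsLocalRing R] [IsNoetherianRing R] {T0 Inv : Ideal R → Ideal R → Prop}
    {A : Ideal R}
    (hInv : ∀ B s y, Inv B s → Inv (B ⊔ Ideal.span {y} * A) (s ⊔ Ideal.span {y} * ⊤))
    (hex : ∀ B s x y, Inv B s → x ∈ maximalIdeal R → y ∈ maximalIdeal R → Reg A B x → Reg A B y →
      Reg ⊤ s x → Reg ⊤ s y → T0 (B ⊔ Ideal.span {x} * A) (s ⊔ Ideal.span {x} * ⊤) →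
      T0 (B ⊔ Ideal.span {y} * A) (s ⊔ Ideal.span {y} * ⊤))
    (n : ℕ) : ∀ B s y, Inv B s → TT T0 A (n + 1) B s → y ∈ maximalIdeal R → Reg A B y →
      Reg ⊤ s y → TT T0 A n (B ⊔ Ideal.span {y} * A) (s ⊔ Ideal.span {y} * ⊤) := by
  induction n with
  | zero =>
    rintro B s y hi ⟨x, hx, hxA, hxs, h⟩ hy hyA hys
    exact hex B s x y hi hx hy hxA hyA hxs hys h
  | succ n ih =>
    rintro B s y hi ⟨x, hx, hxA, hxs, h⟩ hy hyA hys
    obtain ⟨w, hw, hwA, hws, -⟩ := id h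
    have s1 := hwA.soc0 hw
    have s2 := hws.soc0 hw
    have s3 := soc0_exchange hx hy hxA hyA s1
    have s4 := soc0_exchange hx hy hxs hys s2
    obtain ⟨z, hz, hzr⟩ := exists_reg (maximalIdeal R)
      [(A, B), (⊤, s), (A, B ⊔ Ideal.span {x} * A), (⊤, s ⊔ Ideal.span {x} * ⊤),
        (A, B ⊔ Ideal.span {y} * A), (⊤, s ⊔ Ideal.span {y} * ⊤)] (by
        intro p hp
        simp only [List.mem_cons, List.not_mem_nil, or_false] at hp
        rcases hp with rfl | rfl | rfl | rfl | rfl | rfl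
        exacts [hxA.soc0 hx, hxs.soc0 hx, s1, s2, s3, s4])
    simp only [List.mem_cons, List.not_mem_nil, or_false, forall_eq_or_imp, forall_eq] at hzr
    obtain ⟨z1, z2, z3, z4, z5, z6⟩ := hzr
    have t1 := ih _ _ z (hInv B s x hi) h hz z3 z4
    have t2 : TT T0 A (n + 1) (B ⊔ Ideal.span {z} * A) (s ⊔ Ideal.span {z} * ⊤) := by
      refine ⟨x, hx, hxA.swap z3, hxs.swap z4, ?_⟩
      convert t1 using 1 <;> (simp only [sup_assoc]; rw [sup_comm (Ideal.span {z} * _)])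
    have t3 := ih _ _ y (hInv B s z hi) t2 hy (hyA.swap z5) (hys.swap z6)
    refine ⟨z, hz, z5, z6, ?_⟩
    convert t3 using 1 <;> (simp only [sup_assoc]; rw [sup_comm (Ideal.span {z} * _)])

/-- depth of `A/B` is at least `n` (the zero module has infinite depth) -/
def DD [IsLocalRing R] (A : Ideal R) : ℕ → Ideal R → Prop
  | 0, _ => True
  | n + 1, B => ∃ y ∈ maximalIdeal R, Reg A B y ∧ DD A n (B ⊔ Ideal.span {y} * A)

lemma DD_iff_TT [IsLocalRing R] (A : Ideal R) (n : ℕ) : ∀ B, DD A n B ↔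
    TT (fun _ _ => True) A n B ⊤ := by
  induction n with
  | zero => intro B; simp [DD, TT]
  | succ n ih =>
    intro B
    simp only [DD, TT]
    refine exists_congr fun y => and_congr_right fun _ => and_congr_right fun _ => ?_
    rw [ih]
    simp [Reg]

lemma TT.DD [IsLocalRing R] {T0 : Ideal R → Ideal R → Prop} {A : Ideal R} {n : ℕ} :
    ∀ {B s}, TT T0 A n B s → CPU.DD A n B := by
  induction n with
  | zero => intros; trivial
  | succ n ih => 
    rintro B s ⟨y, hy, h1, _, h2⟩
    exact ⟨y, hy, h1, ih h2⟩

lemma TT.DDs [IsLocalRing R] {T0 : Ideal R → Ideal R → Prop} {A : Ideal R} {n : ℕ} :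
    ∀ {B s}, TT T0 A n B s → CPU.DD ⊤ n s := by
  induction n with
  | zero => intros; trivial
  | succ n ih => 
    rintro B s ⟨y, hy, _, h1, h2⟩
    exact ⟨y, hy, h1, ih h2⟩

variable [IsLocalRing R] [IsNoetherianRing R]

lemma DD.drop {A B : Ideal R} {n : ℕ} {y : R} (h : DD A (n + 1) B) (hy : y ∈ maximalIdeal R)
    (hr : Reg A B y) : DD A n (B ⊔ Ideal.span {y} * A) := by
  rw [DD_iff_TT] at h ⊢
  have := TT.drop (T0 := fun _ _ => True) (Inv := fun _ _ => True) (A := A) (by simp) (by simp) n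
    B ⊤ y trivial h hy hr (by simp [Reg])
  simpa using this

lemma DD.mono {A : Ideal R} {n : ℕ} : ∀ {B : Ideal R} {m : ℕ}, m ≤ n → DD A n B → DD A m B := by
  induction n with
  | zero => intro B m hm _; obtain rfl : m = 0 := by omega
            trivial
  | succ n ih =>
    rintro B (_ | m) hm ⟨y, hy, h1, h2⟩
    · trivial
    · exact ⟨y, hy, h1, ih (by omega) h2⟩

lemma DD.soc0 {A B : Ideal R} {n : ℕ} (h : DD A (n + 1) B) : Soc0 (maximalIdeal R) A B := by
  obtain ⟨y, hy, h1, _⟩ := h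
  exact h1.soc0 hy

/-- isomorphism invariance: multiplication by `a` identifies `A/B` with `A'/B'`. -/
lemma DD.iso {A A' : Ideal R} {a : R} {n : ℕ} : ∀ {B B' : Ideal R}, B ≤ A →
    A' = B' ⊔ Ideal.span {a} * A → (∀ u ∈ A, a * u ∈ B' ↔ u ∈ B) →
    (DD A n B ↔ DD A' n B') := by
  induction n with
  | zero => intros; simp [DD]
  | succ n ih =>
    intro B B' hBA hA' h
    simp only [DD]
    refine exists_congr fun y => and_congr_right fun hy => ?_
    have hreg : Reg A B y ↔ Reg A' B' y := by
      constructor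
      · intro hr u hu hyu
        rw [hA', mem_sup_smul] at hu
        obtain ⟨w, hw, hb⟩ := hu
        have : w ∈ B := by
          refine hr w hw ((h _ (A.mul_mem_left _ hw)).1 ?_)
          have := B'.sub_mem hyu (B'.mul_mem_left y hb)
          convert this using 1; ring
        have := B'.add_mem hb ((h _ hw).2 this)
        simpa using this
      · intro hr u hu hyu
        refine (h u hu).1 (hr _ ?_ ?_)
        · rw [hA', mem_sup_smul]; exact ⟨u, hu, by simp⟩
        · have := (h _ (A.mul_mem_left y hu)).2 hyu
          convert this using 1; ring
    rw [hreg]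
    refine and_congr_right fun hr => ?_
    rw [← hreg] at hr
    refine ih (sup_le hBA Ideal.mul_le_right) ?_ ?_
    · apply le_antisymm
      · rw [hA']
        exact sup_le_sup_right le_sup_left _
      · refine sup_le (sup_le ?_ ?_) ?_
        · rw [hA']; exact le_sup_left
        · exact Ideal.mul_le_right
        · rw [hA']; exact le_sup_right
    · intro u hu
      rw [mem_sup_smul, mem_sup_smul]
      constructor
      · rintro ⟨w, hw, hb⟩
        rw [hA', mem_sup_smul] at hw
        obtain ⟨v, hv, hb2⟩ := hw
        refine ⟨v, hv, (h _ (A.sub_mem hu (A.mul_mem_left _ hv))).1 ?_⟩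
        have := B'.add_mem hb (B'.mul_mem_left y hb2)
        convert this using 1; ring
      · rintro ⟨v, hv, hb⟩
        refine ⟨a * v, ?_, ?_⟩
        · rw [hA', mem_sup_smul]; exact ⟨v, hv, by simp⟩
        · have := (h _ (A.sub_mem hu (A.mul_mem_left _ hv))).2 hb
          convert this using 1; ring

/-- `(C + yA)/(B + yA) ≅ C/(B+yC)` when `y` is regular on `A/C`. -/
lemma DD.iso_quot {A B C : Ideal R} {y : R} {n : ℕ} (hBC : B ≤ C) (hr : Reg A C y)
    (hCA : C ≤ A) :
    DD C n (B ⊔ Ideal.span {y} * C) ↔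
      DD (C ⊔ Ideal.span {y} * A) n (B ⊔ Ideal.span {y} * A) := by
  refine DD.iso (a := 1) (sup_le hBC Ideal.mul_le_right) ?_ ?_
  · apply le_antisymm
    · refine sup_le ?_ ?_
      · rw [Ideal.span_singleton_one, Ideal.one_eq_top.symm, one_mul]; exact le_sup_right
      · exact le_sup_right.trans le_sup_left
    · rw [Ideal.span_singleton_one, Ideal.one_eq_top.symm, one_mul]
      exact sup_le (sup_le_sup_right hBC _) le_sup_left
  · intro u hu
    rw [one_mul, mem_sup_smul, mem_sup_smul]
    constructor
    · rintro ⟨w, hw, hb⟩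
      refine ⟨w, hr w hw ?_, hb⟩
      have := C.sub_mem hu (hBC hb)
      simpa using this
    · rintro ⟨w, hw, hb⟩; exact ⟨w, hCA hw, hb⟩

lemma DD.quot {A : Ideal R} {n : ℕ} : ∀ {B C : Ideal R}, B ≤ C → C ≤ A →
    DD A n B → DD C (n + 1) B → DD A n C := by
  induction n with
  | zero => intros; trivial
  | succ n ih =>
    intro B C hBC hCA h1 h2
    obtain ⟨y, hy, hyr⟩ := exists_reg (maximalIdeal R) [(A, B), (C, B)] (by
      simp only [List.mem_cons, List.not_mem_nil, or_false, forall_eq_or_imp, forall_eq]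
      exact ⟨h1.soc0, h2.soc0⟩)
    simp only [List.mem_cons, List.not_mem_nil, or_false, forall_eq_or_imp, forall_eq] at hyr
    have h3 := (h2.drop hy hyr.2).soc0
    have hs : Soc0 (maximalIdeal R) A C := by
      intro u hu hm
      have : y * u ∈ B ⊔ Ideal.span {y} * C := by
        refine h3 _ (hm y hy) fun r hr => mem_sup_smul.2 ⟨r * u, hm r hr, ?_⟩
        convert B.zero_mem using 1; ring
      obtain ⟨c, hc, hb⟩ := mem_sup_smul.1 this
      have : u - c ∈ B := hyr.1 _ (A.sub_mem hu (hCA hc)) (by convert hb using 1; ring)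
      have := C.add_mem (hBC this) hc
      simpa using this
    obtain ⟨y, hy, hyr⟩ := exists_reg (maximalIdeal R) [(A, B), (C, B), (A, C)] (by
      simp only [List.mem_cons, List.not_mem_nil, or_false, forall_eq_or_imp, forall_eq]
      exact ⟨h1.soc0, h2.soc0, hs⟩)
    simp only [List.mem_cons, List.not_mem_nil, or_false, forall_eq_or_imp, forall_eq] at hyr
    obtain ⟨r1, r2, r3⟩ := hyr
    refine ⟨y, hy, r3, ih (B := B ⊔ Ideal.span {y} * A) (sup_le_sup_right hBC _)
      (sup_le hCA Ideal.mul_le_right) (h1.drop hy r1) ?_⟩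
    exact (DD.iso_quot hBC r3 hCA).1 (h2.drop hy r2)

lemma DD.sub {A : Ideal R} {n : ℕ} : ∀ {B C : Ideal R}, B ≤ C → C ≤ A →
    DD A (n + 1) B → DD A n C → DD C (n + 1) B := by
  induction n with
  | zero =>
    rintro B C hBC hCA ⟨y, hy, hr, _⟩ -
    exact ⟨y, hy, fun u hu => hr u (hCA hu), trivial⟩
  | succ n ih =>
    intro B C hBC hCA h1 h2
    obtain ⟨y, hy, hyr⟩ := exists_reg (maximalIdeal R) [(A, B), (A, C)] (by
      simp only [List.mem_cons, List.not_mem_nil, or_false, forall_eq_or_imp, forall_eq]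
      exact ⟨h1.soc0, h2.soc0⟩)
    simp only [List.mem_cons, List.not_mem_nil, or_false, forall_eq_or_imp, forall_eq] at hyr
    obtain ⟨r1, r2⟩ := hyr
    refine ⟨y, hy, fun u hu => r1 u (hCA hu), ?_⟩
    rw [DD.iso_quot hBC r2 hCA]
    exact ih (sup_le_sup_right hBC _)
      (sup_le hCA Ideal.mul_le_right) (h1.drop hy r1) (h2.drop hy r2)

lemma nakayama {A B : Ideal R} (h : A ≤ B ⊔ maximalIdeal R * A) : A ≤ B :=
  Submodule.le_of_le_smul_of_le_jacobson_bot (IsNoetherian.noetherian A)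
    (IsLocalRing.jacobson_eq_maximalIdeal (⊥ : Ideal R) bot_ne_top).ge h

lemma DD.ass {A : Ideal R} {n : ℕ} : ∀ {B : Ideal R}, DD A n B → ∀ p : PrimeSpectrum R,
    AssP A B p.asIdeal → (n : ℕ∞) ≤ Order.coheight p := by
  induction n with
  | zero => intros; simp
  | succ n ih =>
    rintro B ⟨y, hy, hr, h⟩ p hp
    have hyp := hr.notMem hp
    let N : Ideal R := A ⊓ B.colon (p.asIdeal : Set R)
    have hN : ∀ u, u ∈ N ↔ u ∈ A ∧ ∀ r ∈ p.asIdeal, r * u ∈ B := by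
      intro u
      simp only [N, Submodule.mem_inf, Submodule.mem_colon, smul_eq_mul, SetLike.mem_coe]
      simp only [mul_comm u]
    obtain ⟨_, u, hu, hu2⟩ := id hp
    have huN : u ∈ N := (hN u).2 ⟨hu, fun r hr => (hu2 r).1 hr⟩
    have huB : u ∉ B := fun hc => p.2.ne_top
      ((Ideal.eq_top_iff_one _).2 ((hu2 1).2 (by simpa using hc)))
    have : ¬ N ≤ B ⊔ Ideal.span {y} * A := by
      intro hle
      refine huB (nakayama (A := N) ?_ huN)
      intro v hv
      obtain ⟨a, ha, hb⟩ := mem_sup_smul.1 (hle hv)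
      have haN : a ∈ N := by
        refine (hN a).2 ⟨ha, fun r hr' => hr _ (A.mul_mem_left _ ha) ?_⟩
        have := B.sub_mem (((hN v).1 hv).2 r hr') (B.mul_mem_left r hb)
        convert this using 1; ring
      exact Submodule.mem_sup.2 ⟨_, hb, _, Ideal.mul_mem_mul hy haN, by ring⟩
    obtain ⟨w, hwN, hw⟩ := SetLike.not_le_iff_exists.1 this
    obtain ⟨q, hq, hq2⟩ := exists_assP ((hN w).1 hwN).1 hw
    have hlt : p < ⟨q, hq.1⟩ := by
      refine lt_of_le_of_ne ?_ ?_
      · intro r hr'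
        exact hq2 r (le_sup_left (a := B) (((hN w).1 hwN).2 r hr'))
      · rintro rfl
        refine hyp (hq2 y (mem_sup_smul.2 ⟨w, ((hN w).1 hwN).1, by simp⟩))
    have := ih h ⟨q, hq.1⟩ hq
    calc ((n + 1 : ℕ) : ℕ∞) = n + 1 := by simp
      _ ≤ Order.coheight (⟨q, hq.1⟩ : PrimeSpectrum R) + 1 := by gcongr
      _ ≤ _ := Order.coheight_add_one_le hlt

end A1
end Part1

section Part2
set_option linter.all false

section A2
variable {R : Type u} [CommRing R] [IsLocalRing R]

/-- the socle of `M` is zero or simple -/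
def SocSimple (R : Type u) [CommRing R] [IsLocalRing R] (M : Type u) [AddCommGroup M]
    [Module R M] : Prop :=
  ∀ u v : M, (∀ r ∈ maximalIdeal R, r • u = 0) → (∀ r ∈ maximalIdeal R, r • v = 0) → u ≠ 0 →
    ∃ r : R, v = r • u

lemma length_hom_le {M : Type u} [AddCommGroup M] [Module R M] (hM : SocSimple R M)
    {X : Type u} [AddCommGroup X] [Module R X] (hX : IsFiniteLength R X) :
    Module.length R (X →ₗ[R] M) ≤ Module.length R X := by
  induction hX with
  | of_subsingleton => 
    rename_i X _ _ _
    have : Subsingleton (X →ₗ[R] M) := ⟨fun f g => by ext x; simp [Subsingleton.elim x 0]⟩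
    rw [Module.length_eq_zero]; exact zero_le
  | of_simple_quotient _ ih =>
    rename_i X _ _ N hsimp hN
    -- Hom(X/N, M) has length ≤ 1
    have h1 : Module.length R ((X ⧸ N) →ₗ[R] M) ≤ 1 := by
      by_cases hz : ∃ φ : (X ⧸ N) →ₗ[R] M, φ ≠ 0
      · obtain ⟨φ, hφ⟩ := hz
        have : IsSimpleModule R ((X ⧸ N) →ₗ[R] M) := by
          rw [isSimpleModule_iff_toSpanSingleton_surjective]
          refine ⟨⟨φ, 0, hφ⟩, fun φ hφ ψ => ?_⟩
          obtain ⟨e, he⟩ : ∃ e, φ e ≠ 0 := by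
            by_contra! hc; exact hφ (LinearMap.ext hc)
          have he0 : e ≠ 0 := by rintro rfl; simp at he
          have hm : ∀ r ∈ maximalIdeal R, r • e = 0 := by
            have := IsSimpleModule.ker_toSpanSingleton_isMaximal R he0
            rw [IsLocalRing.eq_maximalIdeal this |>.symm]
            intro r hr; simpa using hr
          obtain ⟨r, hr⟩ := hM (φ e) (ψ e) (fun r hr => by rw [← map_smul, hm r hr, map_zero])
            (fun r hr => by rw [← map_smul, hm r hr, map_zero]) he
          refine ⟨r, LinearMap.ext fun x => ?_⟩
          obtain ⟨t, rfl⟩ := IsSimpleModule.toSpanSingleton_surjective R he0 x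
          simp [hr, smul_comm t r]
        rw [Module.length_eq_one]
      · push Not at hz
        have : Subsingleton ((X ⧸ N) →ₗ[R] M) := ⟨fun f g => by rw [hz f, hz g]⟩
        rw [Module.length_eq_zero]; exact zero_le
    let ρ : (X →ₗ[R] M) →ₗ[R] (N →ₗ[R] M) := LinearMap.lcomp R M N.subtype
    have h2 : Module.length R (X →ₗ[R] M) =
        Module.length R (LinearMap.ker ρ) + Module.length R (LinearMap.range ρ) :=
      Module.length_eq_add_of_exact (LinearMap.ker ρ).subtype ρ.rangeRestrict
        (Submodule.injective_subtype _) ρ.surjective_rangeRestrict (by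
          intro f
          simp [LinearMap.rangeRestrict, Subtype.ext_iff])
    have h3 : Module.length R (LinearMap.ker ρ) ≤ Module.length R ((X ⧸ N) →ₗ[R] M) := by
      let κ : ((X ⧸ N) →ₗ[R] M) →ₗ[R] (X →ₗ[R] M) := LinearMap.lcomp R M N.mkQ
      have hle : LinearMap.ker ρ ≤ LinearMap.range κ := by
        intro f hf
        refine ⟨N.liftQ f ?_, ?_⟩
        · intro x hx
          have := LinearMap.congr_fun (LinearMap.mem_ker.1 hf) ⟨x, hx⟩
          simpa [ρ] using this
        · ext x; simp [κ]
      refine (Module.length_le_of_injective (Submodule.inclusion hle)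
        (Submodule.inclusion_injective hle)).trans ?_
      exact Module.length_le_of_surjective κ.rangeRestrict κ.surjective_rangeRestrict
    have h4 : Module.length R (LinearMap.range ρ) ≤ Module.length R (N →ₗ[R] M) :=
      Module.length_le_of_injective _ (Submodule.injective_subtype _)
    have h5 : Module.length R X = Module.length R N + Module.length R (X ⧸ N) :=
      Module.length_eq_add_of_exact N.subtype N.mkQ
        (Submodule.injective_subtype _) N.mkQ_surjective (LinearMap.exact_subtype_mkQ N)
    rw [h2, h5, Module.length_eq_one R (X ⧸ N), add_comm]
    exact add_le_add (h4.trans ih) (h3.trans h1)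

/-- over an Artinian situation with simple socle every map from a submodule is a homothety -/
lemma homothety_of_socSimple {M N : Type u} [AddCommGroup M] [Module R M] [AddCommGroup N]
    [Module R N] (hM : SocSimple R M) (hN : IsFiniteLength R N) (i f : N →ₗ[R] M)
    (hi : Function.Injective i) : ∃ r : R, f = r • i := by
  let h : R →ₗ[R] (N →ₗ[R] M) := LinearMap.toSpanSingleton R _ i
  let Q := R ⧸ LinearMap.ker h
  -- evaluation N → Hom(Q, M)
  have key : Module.length R N ≤ Module.length R Q := by
    by_cases hQ : IsFiniteLength R Q
    · refine le_trans ?_ (length_hom_le hM hQ)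
      let ev : N →ₗ[R] (Q →ₗ[R] M) :=
        { toFun := fun n => (LinearMap.ker h).liftQ (LinearMap.toSpanSingleton R M (i n)) (by
            intro r hr
            have := LinearMap.congr_fun (LinearMap.mem_ker.1 hr) n
            simpa [h] using this)
          map_add' := by
            intro a b; apply Submodule.linearMap_qext; apply LinearMap.ext_ring
            change (1 : R) • i (a + b) = (1 : R) • i a + (1 : R) • i b; simp
          map_smul' := by
            intro a b; apply Submodule.linearMap_qext; apply LinearMap.ext_ring
            change (1 : R) • i (a • b) = a • (1 : R) • i b; simp }
      refine Module.length_le_of_injective ev ?_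
      intro a b hab
      have := LinearMap.congr_fun hab (Submodule.Quotient.mk 1)
      change (1 : R) • i a = (1 : R) • i b at this
      apply hi
      simpa using this
    · rw [← Module.length_ne_top_iff, not_not] at hQ
      rw [hQ]; exact le_top
  have hr : Module.length R Q = Module.length R (LinearMap.range h) :=
    (h.quotKerEquivRange).length_eq
  have hle : Module.length R (N →ₗ[R] M) ≤ Module.length R (LinearMap.range h) :=
    (length_hom_le hM hN).trans (key.trans hr.le)
  have hfin : IsFiniteLength R (N →ₗ[R] M) := by
    rw [← Module.length_ne_top_iff]
    exact ((length_hom_le hM hN).trans_lt (Module.length_ne_top_iff.2 hN).lt_top).ne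
  have htop : LinearMap.range h = ⊤ := by
    by_contra hc
    obtain ⟨_, _⟩ := isFiniteLength_iff_isNoetherian_isArtinian.1 hfin
    exact absurd hle (not_le.2 (Submodule.length_lt hc))
  obtain ⟨r, hr⟩ : f ∈ LinearMap.range h := htop ▸ Submodule.mem_top
  exact ⟨r, by simpa [h] using hr.symm⟩

end A2
end Part2

section Part3
set_option linter.all false

section A3
variable {R : Type u} [CommRing R]

lemma assP_of_minimalPrimes [IsNoetherianRing R] {s p : Ideal R} (hp : p ∈ s.minimalPrimes) :
    AssP ⊤ s p := by
  rw [assP_top_iff]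
  apply Module.associatedPrimes.minimalPrimes_annihilator_subset_associatedPrimes R (R ⧸ s)
  rwa [Ideal.annihilator_quotient]

variable [IsLocalRing R] [IsNoetherianRing R]

lemma primary_exchange {s : Ideal R} {x y : R} (hx : x ∈ maximalIdeal R)
    (hy : Reg ⊤ s y) {k : ℕ} (hk : maximalIdeal R ^ k ≤ s ⊔ Ideal.span {x}) :
    ∃ k, maximalIdeal R ^ k ≤ s ⊔ Ideal.span {y} := by
  apply Ideal.exists_pow_le_of_le_radical_of_fg _ (IsNoetherian.noetherian _)
  rw [Ideal.radical_eq_sInf, le_sInf_iff]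
  rintro P ⟨hP, hPp⟩
  by_contra hne
  have hPm : P < maximalIdeal R := lt_of_le_of_ne (IsLocalRing.le_maximalIdeal hPp.ne_top)
    (fun h => hne h.ge)
  have hsP : s ≤ P := le_sup_left.trans hP
  obtain ⟨p0, hp0, hp0P⟩ := Ideal.exists_minimalPrimes_le hsP
  have hy0 : y ∉ p0 := hy.notMem (assP_of_minimalPrimes hp0)
  have hyP : y ∈ P := hP (le_sup_right (a := s) (Ideal.mem_span_singleton_self y))
  have hsm : s ≤ maximalIdeal R := hsP.trans hPm.le
  have hmin : maximalIdeal R ∈ (s ⊔ Ideal.span {x}).minimalPrimes := by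
    refine ⟨⟨inferInstance, sup_le hsm ?_⟩, ?_⟩
    · rwa [Ideal.span_singleton_le_iff_mem]
    · rintro q ⟨hq, hle⟩ _
      have := hk.trans hle
      exact hq.le_of_pow_le this
  have hh := Ideal.map_height_le_one_of_mem_minimalPrimes hmin
  have hp0p := hp0.1.1
  have i0 : (p0.map (Ideal.Quotient.mk s)).IsPrime :=
    Ideal.map_isPrime_of_surjective Ideal.Quotient.mk_surjective (by simpa using hp0.1.2)
  have i1 : (P.map (Ideal.Quotient.mk s)).IsPrime :=
    Ideal.map_isPrime_of_surjective Ideal.Quotient.mk_surjective (by simpa using hsP)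
  have i2 : ((maximalIdeal R).map (Ideal.Quotient.mk s)).IsPrime :=
    Ideal.map_isPrime_of_surjective Ideal.Quotient.mk_surjective (by simpa using hsm)
  have key : ∀ {a b : Ideal R}, s ≤ a → s ≤ b → a < b →
      a.map (Ideal.Quotient.mk s) < b.map (Ideal.Quotient.mk s) := by
    intro a b ha hb hab
    refine lt_of_le_of_ne (Ideal.map_mono hab.le) fun h => hab.ne ?_
    have := congrArg (Ideal.comap (Ideal.Quotient.mk s)) h
    rwa [Ideal.comap_map_of_surjective _ Ideal.Quotient.mk_surjective,
      Ideal.comap_map_of_surjective _ Ideal.Quotient.mk_surjective, ← RingHom.ker_eq_comap_bot,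
      Ideal.mk_ker, sup_eq_left.2 ha, sup_eq_left.2 hb] at this
  have l1 := Ideal.height_add_one_le_of_lt_of_isPrime
    (key hp0.1.2 hsP (lt_of_le_of_ne hp0P (fun h => hy0 (h ▸ hyP))))
  have l2 := Ideal.height_add_one_le_of_lt_of_isPrime (key hsP hsm hPm)
  have : (2 : ℕ∞) ≤ 1 := by
    calc (2 : ℕ∞) = 0 + 1 + 1 := by norm_num
      _ ≤ (p0.map (Ideal.Quotient.mk s)).height + 1 + 1 := by gcongr; exact zero_le
      _ ≤ (P.map (Ideal.Quotient.mk s)).height + 1 := by gcongr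
      _ ≤ _ := l2
      _ ≤ 1 := hh
  exact absurd this (by norm_num)

/-- socle of `A/B` zero or simple -/
def SocS (A B : Ideal R) : Prop := ∀ u ∈ A, ∀ v ∈ A, (∀ r ∈ maximalIdeal R, r * u ∈ B) →
  (∀ r ∈ maximalIdeal R, r * v ∈ B) → u ∉ B → ∃ r : R, v - r * u ∈ B

lemma socS_exchange {A B : Ideal R} {x y : R} (hxc : x ∈ maximalIdeal R)
    (hyc : y ∈ maximalIdeal R) (hx : Reg A B x) (hy : Reg A B y)
    (h : SocS A (B ⊔ Ideal.span {x} * A)) : SocS A (B ⊔ Ideal.span {y} * A) := by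
  have key : ∀ v ∈ A, (∀ r ∈ maximalIdeal R, r * v ∈ B ⊔ Ideal.span {y} * A) →
      ∃ u ∈ A, x * v - y * u ∈ B ∧ ∀ r ∈ maximalIdeal R, r * u ∈ B ⊔ Ideal.span {x} * A := by
    intro v hv h2
    obtain ⟨u, hu, hb⟩ := mem_sup_smul.1 (h2 x hxc)
    refine ⟨u, hu, hb, fun r hr => ?_⟩
    obtain ⟨w, hw, hb2⟩ := mem_sup_smul.1 (h2 r hr)
    refine mem_sup_smul.2 ⟨w, hw, hy _ ?_ ?_⟩
    · exact A.sub_mem (A.mul_mem_left _ hu) (A.mul_mem_left _ hw)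
    · have := B.sub_mem (B.mul_mem_left x hb2) (B.mul_mem_left r hb)
      convert this using 1; ring
  intro v1 hv1 v2 hv2 h1 h2 hn
  obtain ⟨u1, hu1, e1, m1⟩ := key v1 hv1 h1
  obtain ⟨u2, hu2, e2, m2⟩ := key v2 hv2 h2
  have hn1 : u1 ∉ B ⊔ Ideal.span {x} * A := by
    intro hc
    obtain ⟨w, hw, hb⟩ := mem_sup_smul.1 hc
    refine hn (mem_sup_smul.2 ⟨w, hw, hx _ (A.sub_mem hv1 (A.mul_mem_left _ hw)) ?_⟩)
    have := B.add_mem e1 (B.mul_mem_left y hb)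
    convert this using 1; ring
  obtain ⟨r, hr⟩ := h u1 hu1 u2 hu2 m1 m2 hn1
  obtain ⟨w, hw, hb⟩ := mem_sup_smul.1 hr
  refine ⟨r, mem_sup_smul.2 ⟨w, hw, hx _ ?_ ?_⟩⟩
  · exact A.sub_mem (A.sub_mem hv2 (A.mul_mem_left _ hv1)) (A.mul_mem_left _ hw)
  · have := B.add_mem (B.sub_mem e2 (B.mul_mem_left r e1)) (B.mul_mem_left y hb)
    convert this using 1; ring

/-- `A/B` is faithful over `R/s`. -/
def Faith (A B s : Ideal R) : Prop := ∀ z, (∀ a ∈ A, z * a ∈ B) → z ∈ s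

lemma faith_pow {A B s : Ideal R} (hs : ∀ z ∈ s, ∀ a ∈ A, z * a ∈ B) {x : R} (hx : Reg A B x)
    (h : Faith A (B ⊔ Ideal.span {x} * A) (s ⊔ Ideal.span {x})) (n : ℕ) :
    Faith A (B ⊔ Ideal.span {x ^ (n + 1)} * A) (s ⊔ Ideal.span {x ^ (n + 1)}) := by
  induction n with
  | zero => simpa using h
  | succ n ih =>
    intro z hz
    have h1 : z ∈ s ⊔ Ideal.span {x} := by
      refine h z fun a ha => ?_
      obtain ⟨w, hw, hb⟩ := mem_sup_smul.1 (hz a ha)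
      refine mem_sup_smul.2 ⟨x ^ (n + 1) * w, A.mul_mem_left _ hw, ?_⟩
      convert hb using 1; ring
    obtain ⟨z', hz'⟩ := mem_sup_span.1 h1
    have h2 : z' ∈ s ⊔ Ideal.span {x ^ (n + 1)} := by
      refine ih z' fun a ha => ?_
      obtain ⟨w, hw, hb⟩ := mem_sup_smul.1 (hz a ha)
      refine mem_sup_smul.2 ⟨w, hw, hx _ ?_ ?_⟩
      · exact A.sub_mem (A.mul_mem_left _ ha) (A.mul_mem_left _ hw)
      · have := B.sub_mem hb (hs _ hz' a ha)
        convert this using 1; ring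
    obtain ⟨c, hc⟩ := mem_sup_span.1 h2
    refine mem_sup_span.2 ⟨c, ?_⟩
    have := s.add_mem hz' (s.mul_mem_left x hc)
    convert this using 1; ring

lemma faith_exchange {A B s : Ideal R} (hs : ∀ z ∈ s, ∀ a ∈ A, z * a ∈ B) {x y : R}
    (hxm : x ∈ maximalIdeal R)
    (hx : Reg A B x) (hxs : Reg ⊤ s x) (hys : Reg ⊤ s y)
    {k : ℕ} (hk : maximalIdeal R ^ k ≤ s ⊔ Ideal.span {x})
    (h : Faith A (B ⊔ Ideal.span {x} * A) (s ⊔ Ideal.span {x})) :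
    Faith A (B ⊔ Ideal.span {y} * A) (s ⊔ Ideal.span {y}) := by
  obtain ⟨N, hN⟩ := primary_exchange hxm hys hk
  have hxN : x ^ (N + 1) ∈ s ⊔ Ideal.span {y} := by
    rw [pow_succ]; exact Ideal.mul_mem_right _ _ (hN (Ideal.pow_mem_pow hxm N))
  obtain ⟨c, hc⟩ := mem_sup_span.1 hxN
  have hregx : Reg ⊤ s (x ^ (N + 1)) := by
    clear hxN hc hN
    generalize N + 1 = M
    induction M with
    | zero => intro u _ hu; simpa using hu
    | succ M ih =>
      intro u _ hu
      exact ih u trivial (hxs _ trivial (by convert hu using 1; ring))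
  intro z hz
  have h1 : z * c ∈ s ⊔ Ideal.span {x ^ (N + 1)} := by
    refine faith_pow hs hx h N _ fun a ha => ?_
    obtain ⟨w, hw, hb⟩ := mem_sup_smul.1 (hz a ha)
    refine mem_sup_smul.2 ⟨w, hw, ?_⟩
    have := B.sub_mem (B.mul_mem_left c hb) (hs _ hc w hw)
    convert this using 1; ring
  obtain ⟨r, hr⟩ := mem_sup_span.1 h1
  refine mem_sup_span.2 ⟨r, hregx _ trivial ?_⟩
  -- x^(N+1) (z - y r) = (yc + σ)(z - y r)
  have h2 := s.add_mem (s.mul_mem_left y (s.add_mem hr (s.mul_mem_left r hc)))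
    (s.mul_mem_right (z - y * r) hc)
  convert h2 using 1; ring

/-- base predicate -/
def Mat0 (A : Ideal R) (B s : Ideal R) : Prop :=
  SocS A B ∧ Faith A B s ∧ ∃ k, maximalIdeal R ^ k ≤ s

def MInv (A : Ideal R) (B s : Ideal R) : Prop := ∀ z ∈ s, ∀ a ∈ A, z * a ∈ B

def Mat (n : ℕ) (A B s : Ideal R) : Prop := TT (Mat0 A) A n B s

lemma MInv.step {A B s : Ideal R} {y : R} (h : MInv A B s) :
    MInv A (B ⊔ Ideal.span {y} * A) (s ⊔ Ideal.span {y} * ⊤) := by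
  intro z hz a ha
  obtain ⟨c, _, hc⟩ := mem_sup_smul.1 hz
  refine mem_sup_smul.2 ⟨c * a, A.mul_mem_left _ ha, ?_⟩
  convert h _ hc a ha using 1; ring

lemma Mat.drop {n : ℕ} {A B s : Ideal R} {y : R} (hi : MInv A B s) (h : Mat (n + 1) A B s)
    (hy : y ∈ maximalIdeal R) (h1 : Reg A B y) (h2 : Reg ⊤ s y) :
    Mat n A (B ⊔ Ideal.span {y} * A) (s ⊔ Ideal.span {y} * ⊤) := by
  refine TT.drop (Inv := MInv A) (fun B s y h => h.step) ?_ n B s y hi h hy h1 h2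
  rintro B s x y hi hx hy hxA hyA hxs hys ⟨a1, a2, k, a3⟩
  rw [Ideal.mul_top] at a2 a3 ⊢
  exact ⟨socS_exchange hx hy hxA hyA a1, faith_exchange hi hx hxA hxs hys a3 a2,
    primary_exchange hx hys a3⟩

lemma Mat.faith {n : ℕ} {A : Ideal R} : ∀ {B s : Ideal R}, MInv A B s → Mat n A B s →
    Faith A B s := by
  induction n with
  | zero => rintro B s _ ⟨_, h, _⟩; exact h
  | succ n ih =>
    rintro B s hi ⟨y, hy, h1, h2, h⟩
    let Z : Ideal R := B.colon (A : Set R)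
    have hZ : ∀ z, z ∈ Z ↔ ∀ a ∈ A, z * a ∈ B := by
      intro z; simp [Z, Submodule.mem_colon]
    have : Z ≤ s := by
      apply nakayama
      intro z hz
      rw [hZ] at hz
      have := ih hi.step h z fun a ha => le_sup_left (a := B) (hz a ha)
      obtain ⟨c, _, hc⟩ := mem_sup_smul.1 this
      have hcZ : c ∈ Z := by
        refine (hZ c).2 fun a ha => h1 _ (A.mul_mem_left _ ha) ?_
        have := B.sub_mem (hz a ha) (hi _ hc a ha)
        convert this using 1; ring
      exact Submodule.mem_sup.2 ⟨_, hc, _, Ideal.mul_mem_mul hy hcZ, by ring⟩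
    intro z hz
    exact this ((hZ z).2 hz)

/-- image of `A` in `R/B`. -/
abbrev img (A B : Ideal R) : Submodule R (R ⧸ B) := Submodule.map B.mkQ A

lemma mk_mem_img {A B : Ideal R} (hBA : B ≤ A) {u : R} :
    (Submodule.Quotient.mk u : R ⧸ B) ∈ img A B ↔ u ∈ A := by
  constructor
  · rintro ⟨a, ha, h⟩
    have : a - u ∈ B := (Submodule.Quotient.eq B).1 h
    have := A.sub_mem ha (hBA this)
    simpa using this
  · intro h; exact ⟨u, h, rfl⟩

/-- division by a regular element -/
lemma exists_div {A B : Ideal R} (hBA : B ≤ A) {y : R} (hy : Reg A B y) {C : Ideal R}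
    (φ : C →ₗ[R] R ⧸ B) (hφ : ∀ u, ∃ a ∈ A, φ u = Submodule.Quotient.mk (y * a)) :
    ∃ g : C →ₗ[R] R ⧸ B, (∀ u, g u ∈ img A B) ∧ φ = y • g := by
  let μ : img A B →ₗ[R] R ⧸ B := (LinearMap.lsmul R (R ⧸ B) y).comp (img A B).subtype
  have hμ : Function.Injective μ := by
    rw [← LinearMap.ker_eq_bot, LinearMap.ker_eq_bot']
    rintro ⟨_, a, ha, rfl⟩ h
    have : (Submodule.Quotient.mk (y * a) : R ⧸ B) = 0 := h
    rw [Submodule.Quotient.mk_eq_zero] at this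
    apply Subtype.ext
    change (Submodule.Quotient.mk a : R ⧸ B) = 0
    rw [Submodule.Quotient.mk_eq_zero]
    exact hy a ha this
  have hr : ∀ u, φ u ∈ LinearMap.range μ := by
    intro u
    obtain ⟨a, ha, h⟩ := hφ u
    exact ⟨⟨_, a, ha, rfl⟩, h.symm⟩
  let e := LinearEquiv.ofInjective μ hμ
  let g : C →ₗ[R] img A B := e.symm.toLinearMap.comp (φ.codRestrict _ hr)
  refine ⟨(img A B).subtype.comp g, fun u => (g u).2, LinearMap.ext fun u => ?_⟩
  have : μ (g u) = φ u := by
    have : e (g u) = ⟨φ u, hr u⟩ := by simp [g, LinearMap.codRestrict]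
    exact congrArg Subtype.val this
  exact this.symm

lemma finiteLength_of_pow {A : Ideal R} {B : Ideal R} {k : ℕ}
    (hk : ∀ z ∈ maximalIdeal R ^ k, ∀ a ∈ A, z * a ∈ B) :
    IsFiniteLength R (A ⧸ (Submodule.comap A.subtype B)) := by
  have hart : IsArtinian R (R ⧸ maximalIdeal R ^ (k + 1)) := by
    have hle : maximalIdeal R ^ (k + 1) ≤ maximalIdeal R := Ideal.pow_le_self (by omega)
    have : Nontrivial (R ⧸ maximalIdeal R ^ (k + 1)) :=
      Ideal.Quotient.nontrivial_iff.2 (ne_top_of_le_ne_top Ideal.IsPrime.ne_top' hle)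
    have : IsLocalRing (R ⧸ maximalIdeal R ^ (k + 1)) :=
      IsLocalRing.of_surjective' _ Ideal.Quotient.mk_surjective
    have : IsArtinianRing (R ⧸ maximalIdeal R ^ (k + 1)) := by
      rw [isArtinianRing_iff_isNilpotent_maximalIdeal]
      refine ⟨k + 1, ?_⟩
      have hm : maximalIdeal (R ⧸ maximalIdeal R ^ (k + 1)) ≤
          (maximalIdeal R).map (Ideal.Quotient.mk _) := by
        intro x hx
        obtain ⟨x, rfl⟩ := Ideal.Quotient.mk_surjective x
        apply Ideal.mem_map_of_mem
        rw [mem_maximalIdeal, mem_nonunits_iff] at hx ⊢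
        exact fun h => hx (h.map _)
      apply le_bot_iff.1
      refine (Ideal.pow_right_mono hm _).trans ?_
      rw [← Ideal.map_pow, Ideal.map_quotient_self]
    exact isArtinian_of_surjective_algebraMap (R := R ⧸ maximalIdeal R ^ (k + 1)) (S := R) 
      Ideal.Quotient.mk_surjective
  rw [isFiniteLength_iff_isNoetherian_isArtinian]
  refine ⟨inferInstance, ?_⟩
  set M := A ⧸ (Submodule.comap A.subtype B)
  have key : ∀ N : Submodule R M, N.FG → IsArtinian R N := by
    intro N hN
    induction N, hN using Submodule.fg_induction with
    | singleton x =>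
      obtain ⟨⟨a, ha⟩, rfl⟩ := Submodule.Quotient.mk_surjective _ x
      let f : (R ⧸ maximalIdeal R ^ (k + 1)) →ₗ[R] M :=
        Submodule.liftQ _ (LinearMap.toSpanSingleton R M (Submodule.Quotient.mk ⟨a, ha⟩)) (by
          intro z hz
          rw [LinearMap.mem_ker, LinearMap.toSpanSingleton_apply, ← Submodule.Quotient.mk_smul,
            Submodule.Quotient.mk_eq_zero]
          exact hk z (Ideal.pow_le_pow_right (by omega) hz) a ha)
      have : LinearMap.range f = Submodule.span R {(Submodule.Quotient.mk ⟨a, ha⟩ : M)} := by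
        rw [Submodule.range_liftQ, LinearMap.range_toSpanSingleton]
      rw [← this]
      exact isArtinian_of_surjective _ f.rangeRestrict f.surjective_rangeRestrict
    | sup N1 N2 _ _ h1 h2 => exact isArtinian_sup _ _
  have := key ⊤ (IsNoetherian.noetherian _)
  exact isArtinian_of_linearEquiv Submodule.topEquiv

end A3
end Part3

section Part4
set_option linter.all false

section A4
variable {R : Type u} [CommRing R] [IsLocalRing R] [IsNoetherianRing R]

lemma sup_right_swap (a b c : Ideal R) : a ⊔ b ⊔ c = a ⊔ c ⊔ b := by
  rw [sup_assoc, sup_comm b c, ← sup_assoc]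

lemma SocS.simple {A B : Ideal R} (hBA : B ≤ A) (h : SocS A B) : SocSimple R (img A B) := by
  rintro ⟨_, u, hu, rfl⟩ ⟨_, v, hv, rfl⟩ h1 h2 h3
  have key : ∀ r w, (B.mkQ (r * w) : R ⧸ B) = 0 ↔ r * w ∈ B := by
    intro r w; exact Submodule.Quotient.mk_eq_zero B
  have k1 : ∀ r ∈ maximalIdeal R, r * u ∈ B := by
    intro r hr
    have := congrArg Subtype.val (h1 r hr)
    rw [← key, ← smul_eq_mul, map_smul]; exact this
  have k2 : ∀ r ∈ maximalIdeal R, r * v ∈ B := by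
    intro r hr
    have := congrArg Subtype.val (h2 r hr)
    rw [← key, ← smul_eq_mul, map_smul]; exact this
  have k3 : u ∉ B := by
    intro hc
    apply h3
    apply Subtype.ext
    change (Submodule.Quotient.mk u : R ⧸ B) = 0
    rwa [Submodule.Quotient.mk_eq_zero]
  obtain ⟨r, hr⟩ := h u hu v hv k1 k2 k3
  refine ⟨r, Subtype.ext ?_⟩
  change (Submodule.Quotient.mk v : R ⧸ B) = r • (Submodule.Quotient.mk u : R ⧸ B)
  rw [← Submodule.Quotient.mk_smul, Submodule.Quotient.eq]
  exact hr

set_option maxHeartbeats 1000000 in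
lemma row_hom (I A : Ideal R) (e : ℕ) : ∀ B s : Ideal R, B ≤ A → MInv A B s → Mat e A B s →
    DD A e (B ⊔ I * A) → ∀ f : ↥(I * A) →ₗ[R] R ⧸ B, (∀ u, f u ∈ img A B) →
    (∀ u : ↥(I * A), (u : R) ∈ B → f u = 0) → ∃ r : R, ∀ u, f u = Submodule.Quotient.mk (r * (u : R)) := by
  induction e with
  | zero =>
    rintro B s hBA hi ⟨h1, h2, k, h3⟩ _ f hf hf0
    have hle : I * A ≤ A := Ideal.mul_le_right
    have hN : IsFiniteLength R (↥(I * A) ⧸ (Submodule.comap (I * A).subtype B)) :=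
      finiteLength_of_pow (k := k) fun z hz a ha => hi z (h3 hz) a (hle ha)
    let f1 : (↥(I * A) ⧸ (Submodule.comap (I * A).subtype B)) →ₗ[R] img A B :=
      Submodule.liftQ _ (f.codRestrict _ hf) (by
        intro u hu
        exact Subtype.ext (hf0 u hu))
    let i0 : ↥(I * A) →ₗ[R] img A B := (B.mkQ.comp (I * A).subtype).codRestrict _
      (fun u => ⟨u, hle u.2, rfl⟩)
    have hker : LinearMap.ker i0 = Submodule.comap (I * A).subtype B := by
      ext u
      rw [LinearMap.mem_ker, Submodule.mem_comap, ← Submodule.Quotient.mk_eq_zero B]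
      exact Subtype.ext_iff
    let i1 : (↥(I * A) ⧸ (Submodule.comap (I * A).subtype B)) →ₗ[R] img A B :=
      Submodule.liftQ _ i0 hker.ge
    have hi1 : Function.Injective i1 := by
      rw [← LinearMap.ker_eq_bot, Submodule.ker_liftQ_eq_bot _ _ _ hker.le]
    obtain ⟨r, hr⟩ := homothety_of_socSimple (N := ↥(I * A) ⧸ (Submodule.comap (I * A).subtype B))
      (h1.simple hBA) hN i1 f1 hi1
    refine ⟨r, fun u => ?_⟩
    have := LinearMap.congr_fun hr (Submodule.Quotient.mk u)
    exact congrArg Subtype.val this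
  | succ e ih =>
    intro B s hBA hi hM hD
    obtain ⟨y, hy, hreg⟩ := exists_reg (maximalIdeal R) [(A, B), (⊤, s), (A, B ⊔ I * A)] (by
      obtain ⟨y0, hy0, h1, h2, _⟩ := hM
      simp only [List.mem_cons, List.not_mem_nil, or_false, forall_eq_or_imp, forall_eq]
      exact ⟨h1.soc0 hy0, h2.soc0 hy0, hD.soc0⟩)
    simp only [List.mem_cons, List.not_mem_nil, or_false, forall_eq_or_imp, forall_eq] at hreg
    obtain ⟨r1, r2, r3⟩ := hreg
    set B' := B ⊔ Ideal.span {y} * A with hB'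
    have hB'A : B' ≤ A := sup_le hBA Ideal.mul_le_right
    have ih' := ih B' _ hB'A hi.step (hM.drop hi hy r1 r2) (by
      have := hD.drop hy r3
      rwa [sup_right_swap] at this)
    let ι : ↥(I * A) →ₗ[R] R ⧸ B := B.mkQ.comp (I * A).subtype
    let H : Submodule R (↥(I * A) →ₗ[R] R ⧸ B) :=
      { carrier := {f | (∀ u, f u ∈ img A B) ∧ ∀ u : ↥(I * A), (u : R) ∈ B → f u = 0}
        add_mem' := fun {a b} ha hb => ⟨fun u => add_mem (ha.1 u) (hb.1 u), fun u hu => by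
          simp [ha.2 u hu, hb.2 u hu]⟩
        zero_mem' := ⟨fun u => zero_mem _, fun u hu => rfl⟩
        smul_mem' := fun c a ha => ⟨fun u => Submodule.smul_mem _ _ (ha.1 u), fun u hu => by
          simp [ha.2 u hu]⟩ }
    have hH : H ≤ Submodule.span R {ι} := by
      refine Submodule.le_of_le_smul_of_le_jacobson_bot (I := maximalIdeal R)
        (IsNoetherian.noetherian _) (IsLocalRing.maximalIdeal_le_jacobson _) ?_
      rintro f ⟨hf, hf0⟩
      let f' : ↥(I * A) →ₗ[R] R ⧸ B' := (Submodule.factor (p := B) (p' := B') le_sup_left).comp f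
      obtain ⟨r, hr⟩ := ih' f' (by
          intro u
          obtain ⟨a, ha, h⟩ := hf u
          exact ⟨a, ha, by simp only [f', LinearMap.comp_apply, ← h]; rfl⟩) (by
          intro u hu
          obtain ⟨a, ha, h⟩ := mem_sup_smul.1 hu
          have h1 : a ∈ B ⊔ I * A := by
            refine r3 a ha (Submodule.mem_sup.2 ⟨-(u - y * a), B.neg_mem h, u, u.2, by ring⟩)
          obtain ⟨b1, hb1, n1, hn1, rfl⟩ := Submodule.mem_sup.1 h1
          obtain ⟨w, hw, hw2⟩ := hf ⟨n1, hn1⟩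
          have h2 : f (u - y • ⟨n1, hn1⟩) = 0 := by
            apply hf0
            have := B.add_mem h (B.mul_mem_left y hb1)
            simp only [Submodule.coe_sub, Submodule.coe_smul, smul_eq_mul]
            convert this using 1; ring
          rw [map_sub, map_smul, sub_eq_zero, ← hw2] at h2
          simp only [f', LinearMap.comp_apply, h2]
          change (Submodule.Quotient.mk (y * w) : R ⧸ B') = 0
          rw [Submodule.Quotient.mk_eq_zero]
          exact mem_sup_smul.2 ⟨w, hw, by simp⟩)
      obtain ⟨g, hg1, hg2⟩ := exists_div hBA r1 (f - r • ι) (by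
        intro u
        obtain ⟨v, hv, h⟩ := hf u
        have h1 := hr u
        simp only [f', LinearMap.comp_apply, ← h] at h1
        have h2 : v - r * u ∈ B' := (Submodule.Quotient.eq B').1 h1
        obtain ⟨a, ha, h3⟩ := mem_sup_smul.1 h2
        refine ⟨a, ha, ?_⟩
        rw [LinearMap.sub_apply, ← h]
        change (Submodule.Quotient.mk (v - r * u) : R ⧸ B) = _
        rwa [Submodule.Quotient.eq])
      have hgH : g ∈ H := by
        refine ⟨hg1, fun u hu => ?_⟩
        have h1 : (f - r • ι) u = 0 := by
          have : ι u = 0 := (Submodule.Quotient.mk_eq_zero B).2 hu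
          simp [hf0 u hu, this]
        obtain ⟨w, hw, h⟩ := hg1 u
        rw [hg2, LinearMap.smul_apply, ← h] at h1
        have h2 : y * w ∈ B := (Submodule.Quotient.mk_eq_zero B).1 h1
        rw [← h]
        exact (Submodule.Quotient.mk_eq_zero B).2 (r1 w hw h2)
      refine Submodule.mem_sup.2 ⟨r • ι, Submodule.smul_mem _ _ (Submodule.mem_span_singleton_self _),
        y • g, Submodule.smul_mem_smul hy hgH, ?_⟩
      rw [← hg2]; abel
    intro f hf hf0
    obtain ⟨r, hr⟩ := Submodule.mem_span_singleton.1 (hH (show f ∈ H from ⟨hf, hf0⟩))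
    exact ⟨r, fun u => by rw [← hr]; rfl⟩

lemma mem_col {R : Type u} [CommRing R] {s I : Ideal R} {z : R} : z ∈ Submodule.colon s (I : Set R) ↔ ∀ i ∈ I, z * i ∈ s := by
  simp [Submodule.mem_colon]

set_option maxHeartbeats 1000000 in
lemma row_mat (I A : Ideal R) (e : ℕ) : ∀ B s : Ideal R, B ≤ A → MInv A B s → Mat e A B s →
    DD A e (B ⊔ I * A) → Mat e (I * A) (B ⊓ I * A) (Submodule.colon s (I : Set R)) := by
  have hle : I * A ≤ A := Ideal.mul_le_right
  induction e with
  | zero =>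
    rintro B s hBA hi ⟨h1, h2, k, h3⟩ _
    refine ⟨?_, ?_, k, ?_⟩
    · intro u hu v hv a b c
      obtain ⟨r, hr⟩ := h1 u (hle hu) v (hle hv) (fun r hr => (a r hr).1) (fun r hr => (b r hr).1)
        (fun h => c ⟨h, hu⟩)
      exact ⟨r, hr, Submodule.sub_mem _ hv (Ideal.mul_mem_left _ _ hu)⟩
    · intro z hz
      rw [mem_col]
      intro i hi'
      refine h2 _ fun a ha => ?_
      have : z * (i * a) ∈ B := (hz (i * a) (Ideal.mul_mem_mul hi' ha)).1
      convert this using 1; ring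
    · intro z hz
      rw [mem_col]
      intro i _
      exact s.mul_mem_right _ (h3 hz)
  | succ e ih =>
    intro B s hBA hi hM hD
    obtain ⟨y, hy, hreg⟩ := exists_reg (maximalIdeal R) [(A, B), (⊤, s), (A, B ⊔ I * A)] (by
      obtain ⟨y0, hy0, h1, h2, _⟩ := hM
      simp only [List.mem_cons, List.not_mem_nil, or_false, forall_eq_or_imp, forall_eq]
      exact ⟨h1.soc0 hy0, h2.soc0 hy0, hD.soc0⟩)
    simp only [List.mem_cons, List.not_mem_nil, or_false, forall_eq_or_imp, forall_eq] at hreg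
    obtain ⟨r1, r2, r3⟩ := hreg
    set B' := B ⊔ Ideal.span {y} * A with hB'
    have hB'A : B' ≤ A := sup_le hBA Ideal.mul_le_right
    have ih' := ih B' _ hB'A hi.step (hM.drop hi hy r1 r2) (by
      have := hD.drop hy r3
      rwa [sup_right_swap] at this)
    refine ⟨y, hy, ?_, ?_, ?_⟩
    · intro u hu h
      exact ⟨r1 u (hle hu) h.1, hu⟩
    · intro u _ h
      rw [mem_col] at h ⊢
      intro i hi'
      exact r2 _ trivial (by have := h i hi'; rwa [mul_assoc] at this)
    · have e1 : B ⊓ I * A ⊔ Ideal.span {y} * (I * A) = B' ⊓ I * A := by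
        apply le_antisymm
        · refine sup_le (inf_le_inf_right _ le_sup_left) (le_inf ?_ Ideal.mul_le_right)
          exact (Ideal.mul_mono_right hle).trans le_sup_right
        · rintro n ⟨hn1, hn2⟩
          obtain ⟨a, ha, h⟩ := mem_sup_smul.1 hn1
          have h1 : a ∈ B ⊔ I * A := by
            refine r3 a ha (Submodule.mem_sup.2 ⟨-(n - y * a), B.neg_mem h, n, hn2, by ring⟩)
          obtain ⟨b1, hb1, n1, hn1, rfl⟩ := Submodule.mem_sup.1 h1
          refine mem_sup_smul.2 ⟨n1, hn1, ?_, ?_⟩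
          · have := B.add_mem h (B.mul_mem_left y hb1)
            change _ ∈ B
            convert this using 1; ring
          · exact Submodule.sub_mem _ hn2 (Ideal.mul_mem_left _ _ hn1)
      have e2 : Submodule.colon s (I : Set R) ⊔ Ideal.span {y} * ⊤ =
          Submodule.colon (s ⊔ Ideal.span {y} * ⊤) (I : Set R) := by
        apply le_antisymm
        · refine sup_le ?_ ?_
          · intro z hz
            rw [mem_col] at hz ⊢
            exact fun i hi' => le_sup_left (a := s) (hz i hi')
          · intro z hz
            rw [mem_col]
            exact fun i hi' => le_sup_right (a := s) (Ideal.mul_mem_right _ _ hz)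
        · intro z hz
          rw [mem_col] at hz
          have hzu : ∀ u ∈ I * A, z * u ∈ B' := by
            intro u hu
            refine Submodule.mul_induction_on hu ?_ ?_
            · intro i hi' a ha
              have := hi.step (y := y) _ (hz i hi') a ha
              rwa [mul_assoc] at this
            · intro a b ha hb; rw [mul_add]; exact B'.add_mem ha hb
          let ι : ↥(I * A) →ₗ[R] R ⧸ B := B.mkQ.comp (I * A).subtype
          obtain ⟨g, hg1, hg2⟩ := exists_div hBA r1 (z • ι) (by
            rintro ⟨u, hu⟩
            obtain ⟨a, ha, h⟩ := mem_sup_smul.1 (hzu u hu)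
            refine ⟨a, ha, ?_⟩
            change (Submodule.Quotient.mk (z * u) : R ⧸ B) = _
            rwa [Submodule.Quotient.eq])
          obtain ⟨r, hr⟩ := row_hom I A (e + 1) B s hBA hi hM hD g hg1 (by
            intro u hu
            have h1 : (z • ι) u = 0 := by
              have : ι u = 0 := (Submodule.Quotient.mk_eq_zero B).2 hu
              simp [this]
            obtain ⟨w, hw, h⟩ := hg1 u
            rw [hg2, LinearMap.smul_apply, ← h] at h1
            have h2 : y * w ∈ B := (Submodule.Quotient.mk_eq_zero B).1 h1
            rw [← h]
            exact (Submodule.Quotient.mk_eq_zero B).2 (r1 w hw h2))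
          refine mem_sup_smul.2 ⟨r, trivial, ?_⟩
          rw [mem_col]
          intro i hi'
          refine hM.faith hi _ fun a ha => ?_
          have h1 := LinearMap.congr_fun hg2 ⟨i * a, Ideal.mul_mem_mul hi' ha⟩
          rw [LinearMap.smul_apply y g, hr] at h1
          have h2 : z * (i * a) - y * (r * (i * a)) ∈ B := (Submodule.Quotient.eq B).1 h1
          convert h2 using 1; ring
      rw [e1, e2]
      exact ih'

end A4
end Part4

section Part5
set_option linter.all false

section A5
variable {R : Type u} [CommRing R] [IsLocalRing R] [IsNoetherianRing R]

lemma span_one_mul (A : Ideal R) : Ideal.span {(1 : R)} * A = A := by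
  rw [Ideal.span_singleton_one, Ideal.one_eq_top.symm, one_mul]

lemma mem_sup_left' {B A : Ideal R} {z : R} : z ∈ B ⊔ A ↔ ∃ a ∈ A, z - a ∈ B := by
  constructor
  · intro h
    obtain ⟨b, hb, a, ha, rfl⟩ := Submodule.mem_sup.1 h
    exact ⟨a, ha, by simpa using hb⟩
  · rintro ⟨a, ha, hb⟩
    exact Submodule.mem_sup.2 ⟨_, hb, a, ha, by ring⟩

lemma Mat.iso1 {A A' s : Ideal R} {n : ℕ} : ∀ {B B' s : Ideal R}, 
    A' = B' ⊔ A → (∀ u ∈ A, u ∈ B' ↔ u ∈ B) → Mat n A B s → Mat n A' B' s := by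
  induction n with
  | zero =>
    rintro B B' s hA' h ⟨h1, h2, h3⟩
    have hB' : B' ≤ A' := hA' ▸ le_sup_left
    have hA : A ≤ A' := hA' ▸ le_sup_right
    refine ⟨?_, ?_, h3⟩
    · intro u hu v hv k1 k2 k3
      rw [hA', mem_sup_left'] at hu hv
      obtain ⟨u', hu', bu⟩ := hu
      obtain ⟨v', hv', bv⟩ := hv
      obtain ⟨r, hr⟩ := h1 u' hu' v' hv' (fun r hr => by
        rw [← h _ (A.mul_mem_left _ hu')]
        have := B'.sub_mem (k1 r hr) (B'.mul_mem_left r bu)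
        convert this using 1; ring) (fun r hr => by
        rw [← h _ (A.mul_mem_left _ hv')]
        have := B'.sub_mem (k2 r hr) (B'.mul_mem_left r bv)
        convert this using 1; ring) (fun hc => by
        rw [← h _ hu'] at hc
        apply k3
        have := B'.add_mem hc bu
        convert this using 1; ring)
      refine ⟨r, ?_⟩
      rw [← h _ (A.sub_mem hv' (A.mul_mem_left _ hu'))] at hr
      have := B'.add_mem hr (B'.sub_mem bv (B'.mul_mem_left r bu))
      convert this using 1; ring
    · intro z hz
      refine h2 z fun a ha => ?_
      rw [← h _ (A.mul_mem_left _ ha)]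
      exact hz a (hA ha)
  | succ n ih =>
    rintro B B' s hA' h ⟨y, hy, h1, h2, h3⟩
    have hB' : B' ≤ A' := hA' ▸ le_sup_left
    have hA : A ≤ A' := hA' ▸ le_sup_right
    refine ⟨y, hy, ?_, h2, ih ?_ ?_ h3⟩
    · intro u hu hyu
      rw [hA', mem_sup_left'] at hu
      obtain ⟨w, hw, hb⟩ := hu
      have : w ∈ B := by
        refine h1 w hw ((h _ (A.mul_mem_left _ hw)).1 ?_)
        have := B'.sub_mem hyu (B'.mul_mem_left y hb)
        convert this using 1; ring
      have := B'.add_mem hb ((h _ hw).2 this)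
      simpa using this
    · apply le_antisymm
      · conv_lhs => rw [hA']
        exact sup_le_sup_right le_sup_left _
      · exact sup_le (sup_le hB' Ideal.mul_le_right) hA
    · intro u hu
      rw [mem_sup_smul, mem_sup_smul]
      constructor
      · rintro ⟨w, hw, hb⟩
        rw [hA', mem_sup_left'] at hw
        obtain ⟨v, hv, hb2⟩ := hw
        refine ⟨v, hv, (h _ (A.sub_mem hu (A.mul_mem_left _ hv))).1 ?_⟩
        have := B'.add_mem hb (B'.mul_mem_left y hb2)
        convert this using 1; ring
      · rintro ⟨v, hv, hb⟩
        exact ⟨v, hA hv, (h _ (A.sub_mem hu (A.mul_mem_left _ hv))).2 hb⟩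

lemma DD.iso1 {A A' : Ideal R} {n : ℕ} {B B' : Ideal R} (hBA : B ≤ A)
    (hA' : A' = B' ⊔ A) (h : ∀ u ∈ A, u ∈ B' ↔ u ∈ B) (hd : DD A n B) : DD A' n B' :=
  (DD.iso (a := 1) hBA (by rw [span_one_mul]; exact hA') (by simpa using h)).1 hd

lemma soc0_pow {A B : Ideal R} (h : Soc0 (maximalIdeal R) A B) {u : R} (hu : u ∈ A) (N : ℕ) 
    (hN : ∀ z ∈ maximalIdeal R ^ N, z * u ∈ B) : u ∈ B := by
  induction N with
  | zero => simpa using hN 1 (by simp)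
  | succ N ih =>
    refine ih fun z hz => h _ (A.mul_mem_left _ hu) fun r hr => ?_
    have := hN (r * z) (by rw [pow_succ']; exact Ideal.mul_mem_mul hr hz)
    rwa [mul_assoc] at this

/-- data of local theorem E -/
structure LocE (I : Ideal R) (a : ℕ → R) (d g : ℕ) (aa K : ℕ → Ideal R) : Prop where
  hIm : I ≤ maximalIdeal R
  hgd : g < d
  ha : ∀ i < d, a i ∈ I
  aa0 : aa 0 = ⊥
  aaS : ∀ i, aa (i + 1) = aa i ⊔ Ideal.span {a i}
  hK : ∀ i, K i = Submodule.colon (aa i) (I : Set R)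
  h1 : ∀ i < d, K i ⊓ I ≤ aa i
  h2 : ∀ i < d, Reg ⊤ (K i) (a i)
  h3 : ∃ N, maximalIdeal R ^ N ≤ I ⊔ K (d - 1)
  h4 : ∀ i < g, K i = aa i
  h5 : ∀ j, 1 ≤ j → j ≤ d - g → DD (⊤ : Ideal R) (d - g - j + 1) (I ^ j)
  hM : Mat d (⊤ : Ideal R) ⊥ ⊥

namespace LocE
variable {I : Ideal R} {a : ℕ → R} {d g : ℕ} {aa K : ℕ → Ideal R}

lemma aaK (h : LocE I a d g aa K) (i : ℕ) : aa i ≤ K i := by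
  intro z hz
  rw [h.hK, mem_col]
  exact fun i _ => Ideal.mul_mem_right _ _ hz

lemma aa_le (h : LocE I a d g aa K) {i : ℕ} (hi : i ≤ d) : aa i ≤ I := by
  induction i with
  | zero => rw [h.aa0]; exact bot_le
  | succ i ih => 
    rw [h.aaS]
    exact sup_le (ih (by omega)) ((Ideal.span_singleton_le_iff_mem _).2 (h.ha i (by omega)))

lemma aa_mono (h : LocE I a d g aa K) {i j : ℕ} (hij : i ≤ j) : aa i ≤ aa j := by
  refine monotone_nat_of_le_succ (f := aa) (fun i => ?_) hij
  rw [h.aaS]; exact le_sup_left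

lemma a_mem (h : LocE I a d g aa K) {i j : ℕ} (hij : i < j) : a i ∈ aa j := by
  refine h.aa_mono (Nat.succ_le_of_lt hij) ?_
  rw [Nat.succ_eq_add_one, h.aaS]
  exact le_sup_right (a := aa i) (Ideal.mem_span_singleton_self _)

lemma K_mono (h : LocE I a d g aa K) {i j : ℕ} (hij : i ≤ j) : K i ≤ K j := by
  intro z hz
  rw [h.hK, mem_col] at hz ⊢
  exact fun i hi => h.aa_mono hij (hz i hi)

/-- Formal lemma (L). -/
lemma formal (h : LocE I a d g aa K) : ∀ c i, i + c = d - 1 → ∀ m, K i ⊓ aa (d - 1) ^ (m + 1) ≤ aa i * aa (d - 1) ^ m := by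
  intro c
  induction c with
  | zero =>
    rintro i hi m
    obtain rfl : i = d - 1 := by omega
    rw [pow_succ']; exact inf_le_right
  | succ c ihc =>
    intro i hi m
    induction m with
    | zero =>
      simp only [zero_add, pow_one, pow_zero, mul_one]
      refine le_trans (inf_le_inf_left _ (h.aa_le (by omega))) (h.h1 i (by have := h.hgd; omega))
    | succ m ihm =>
      rintro u ⟨hu1, hu2⟩
      have hu3 := ihc (i + 1) (by omega) (m + 1) ⟨h.K_mono (by omega) hu1, hu2⟩
      rw [h.aaS, Ideal.sup_mul] at hu3
      obtain ⟨w, hw, hv⟩ := mem_sup_smul.1 hu3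
      have hwK : w ∈ K i := by
        refine h.h2 i (by omega) w trivial ?_
        have := (K i).sub_mem hu1 (h.aaK i (Ideal.mul_le_left hv))
        convert this using 1; ring
      have h6 := ihm ⟨hwK, hw⟩
      have h7 : a i * w ∈ aa i * aa (d - 1) ^ (m + 1) := by
        have := Ideal.mul_mem_mul h6 (h.a_mem (i := i) (j := d - 1) (by omega))
        rw [mul_assoc, ← pow_succ] at this
        rwa [mul_comm (a i)]
      have := Ideal.add_mem _ hv h7
      simpa using this

/-- Consequence: `K_{k+1} ∩ (I^j + K_k) = a_k I^{j-1} + K_k` under depth. -/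
lemma L (h : LocE I a d g aa K) {k j : ℕ} (hk : k + 1 ≤ d - 1) 
    (hX : DD (I ^ (j + 1) ⊔ K k) 1 (K k)) (hY : DD (I ^ j ⊔ K k) 2 (K k)) :
    ∀ u ∈ I ^ (j + 1) ⊔ K k, u ∈ K (k + 1) ↔
      u ∈ K k ⊔ Ideal.span {a k} * (I ^ j ⊔ K k) := by
  have hgd := h.hgd
  set Y := K k ⊔ Ideal.span {a k} * (I ^ j ⊔ K k) with hYdef
  have hYX : Y ≤ I ^ (j + 1) ⊔ K k := by
    refine sup_le le_sup_right ?_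
    rw [Ideal.mul_sup]
    refine sup_le_sup ?_ Ideal.mul_le_right
    rw [pow_succ']
    exact Ideal.mul_mono_left ((Ideal.span_singleton_le_iff_mem _).2 (h.ha k (by omega)))
  have hYK : Y ≤ K (k + 1) := by
    refine sup_le (h.K_mono (by omega)) (Ideal.mul_le_left.trans ?_)
    exact (Ideal.span_singleton_le_iff_mem _).2 (h.aaK _ (h.a_mem (by omega)))
  have hYd : DD Y 2 (K k) := by
    refine (DD.iso (a := a k) le_sup_right rfl ?_).1 hY
    intro u hu
    exact ⟨h.h2 k (by omega) u trivial, fun hu => Ideal.mul_mem_left _ _ hu⟩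
  have hsoc : Soc0 (maximalIdeal R) (I ^ (j + 1) ⊔ K k) Y :=
    (DD.quot (n := 1) le_sup_left hYX hX hYd).soc0
  have key : ∀ u ∈ I ^ (j + 1), u ∈ K (k + 1) → u ∈ Y := by
    intro u hu huK
    have hYgen : ∀ v ∈ I ^ j, ∀ w, a k * v + w ∈ Y ↔ w ∈ Y := by
      intro v hv w
      refine Ideal.add_mem_iff_right _ (mem_sup_smul.2 ⟨v, le_sup_left (a := I ^ j) hv, ?_⟩)
      simp
    let Z : Ideal R := Submodule.colon Y (Ideal.span {u} : Set R)
    have hZ : ∀ z, z * u ∈ Y → z ∈ Z := by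
      intro z hz
      rw [mem_col]
      intro i hi
      obtain ⟨c, rfl⟩ := Ideal.mem_span_singleton.1 hi
      rw [← mul_assoc]; exact Y.mul_mem_right _ hz
    have hmulY : ∀ b ∈ aa (k + 1) * I ^ j, b ∈ Y := by
      rw [h.aaS, Ideal.sup_mul]
      intro b hb
      obtain ⟨w, hw, hb2⟩ := mem_sup_smul.1 hb
      refine mem_sup_smul.2 ⟨w, le_sup_left (a := I ^ j) hw, ?_⟩
      exact h.aaK k (Ideal.mul_le_left hb2)
    have hrad : I ⊔ K (d - 1) ≤ Z.radical := by
      refine sup_le ?_ ?_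
      · intro z hz
        refine ⟨j + 1, hZ _ (hmulY _ ?_)⟩
        rw [pow_succ, mul_assoc, mul_comm (z ^ j)]
        refine Ideal.mul_mem_mul ?_ (Ideal.pow_mem_pow hz j)
        have := huK
        rw [h.hK, mem_col] at this
        rw [mul_comm z]; exact this z hz
      · intro z hz
        refine ⟨j + 1, hZ _ (hmulY _ ?_)⟩
        have h8 : z ^ (j + 1) * u ∈ aa (d - 1) ^ (j + 1) := by
          have : (Ideal.span {z} * I) ^ (j + 1) ≤ aa (d - 1) ^ (j + 1) := by
            refine Ideal.pow_right_mono ?_ _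
            rw [Ideal.span_singleton_mul_le_iff]
            rw [h.hK, mem_col] at hz
            exact hz
          apply this
          rw [mul_pow]
          exact Ideal.mul_mem_mul (Ideal.pow_mem_pow (Ideal.mem_span_singleton_self _) _) hu
        have h9 := h.formal (d - 1 - (k + 1)) (k + 1) (by omega) j
          ⟨Ideal.mul_mem_left _ _ huK, h8⟩
        exact Ideal.mul_mono_right (Ideal.pow_right_mono (h.aa_le (by omega)) _) h9
    obtain ⟨N, hN⟩ := h.h3
    obtain ⟨N', hN'⟩ := Ideal.exists_pow_le_of_le_radical_of_fg (hN.trans hrad)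
      (IsNoetherian.noetherian _)
    refine soc0_pow hsoc (le_sup_left (a := I ^ (j + 1)) hu) (N * N') fun z hz => ?_
    rw [pow_mul] at hz
    have := hN' hz
    rw [mem_col] at this
    exact this u (Ideal.mem_span_singleton_self u)
  intro u hu
  refine ⟨fun huK => ?_, fun hu => hYK hu⟩
  obtain ⟨v, hv, w, hw, rfl⟩ := Submodule.mem_sup.1 hu
  refine Y.add_mem (key v hv ?_) (le_sup_left (a := K k) hw)
  have := (K (k + 1)).sub_mem huK (h.K_mono (by omega) hw)
  simpa using this


lemma matC (h : LocE I a d g aa K) : ∀ k, k ≤ g → Mat (d - k) ⊤ (aa k) (aa k) := by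
  intro k
  induction k with
  | zero => intro _; rw [h.aa0]; exact h.hM
  | succ k ih =>
    intro hk
    have hgd := h.hgd
    have h6 := ih (by omega)
    rw [show d - k = (d - (k + 1)) + 1 by omega] at h6
    have hreg : Reg ⊤ (aa k) (a k) := by rw [← h.h4 k (by omega)]; exact h.h2 k (by omega)
    have := h6.drop (fun z hz a _ => (aa k).mul_mem_right _ hz) (h.hIm (h.ha k (by omega)))
      hreg hreg
    rw [Ideal.mul_top, ← h.aaS] at this
    exact this

def D (K : ℕ → Ideal R) (I : Ideal R) (d g k : ℕ) : Prop :=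
  ∀ j ≤ d - g, ∀ n ≤ d - k, (j = 0 ∨ n + g + j ≤ d + 2) → DD (I ^ j ⊔ K k) n (K k)

lemma rowg (h : LocE I a d g aa K) : Mat (d - g) (I ⊔ K g) (K g) (K g) := by
  have hgd := h.hgd
  have h6 := row_mat I ⊤ (d - g) (aa g) (aa g) le_top (fun z hz a _ => (aa g).mul_mem_right _ hz)
    (h.matC g le_rfl) (by
      rw [Ideal.mul_top, sup_eq_right.2 (h.aa_le (by omega))]
      have := h.h5 1 le_rfl (by omega)
      rw [pow_one] at this
      convert this using 1; omega)
  rw [Ideal.mul_top, ← h.hK] at h6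
  refine Mat.iso1 (s := ⊥) (sup_comm _ _) (fun u hu => ?_) h6
  exact ⟨fun h7 => ⟨h.h1 g hgd ⟨h7, hu⟩, hu⟩, fun h7 => h.aaK g h7.1⟩

lemma DzeroOf (h : LocE I a d g aa K) (k : ℕ) (hk : k < d) (hr : g ≤ k → Mat (d - k) (I ^ (k - g + 1) ⊔ K k) (K k) (K k)) :
    DD ⊤ (d - k) (K k) := by
  by_cases hgk : g ≤ k
  · exact TT.DDs (hr hgk)
  · rw [h.h4 k (by omega)]
    exact TT.DDs (h.matC k (by omega))

lemma main (h : LocE I a d g aa K) : ∀ k, k < d → D K I d g k ∧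
    (g ≤ k → Mat (d - k) (I ^ (k - g + 1) ⊔ K k) (K k) (K k)) := by
  have hgd := h.hgd
  intro k
  induction k with
  | zero =>
    intro _
    have hr : g ≤ 0 → Mat (d - 0) (I ^ (0 - g + 1) ⊔ K 0) (K 0) (K 0) := by
      intro hg
      obtain rfl : g = 0 := by omega
      simpa using h.rowg
    refine ⟨?_, hr⟩
    rintro j hj n hn hor
    rcases j with _ | j
    · have := h.DzeroOf 0 (by omega) hr
      rw [pow_zero, Ideal.one_eq_top, top_sup_eq]
      exact this.mono hn
    · rcases n with _ | n
      · trivial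
      have h7 : DD (I ^ (j + 1)) (n + 1) ⊥ := by
        refine DD.sub bot_le le_top ((TT.DDs h.hM).mono (by omega)) 
          ((h.h5 (j + 1) (by omega) hj).mono (by omega))
      refine DD.iso1 bot_le (sup_comm _ _) (fun u hu => ?_) h7
      constructor
      · intro hK
        have := h.h1 0 (by omega) ⟨hK, Ideal.pow_le_self (by omega) hu⟩
        rwa [h.aa0] at this
      · intro hb
        rw [Ideal.mem_bot] at hb
        rw [hb]; exact Ideal.zero_mem _
  | succ k ih =>
    intro hk
    obtain ⟨hD, hrow⟩ := ih (by omega)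
    have hL : ∀ j, j + 1 ≤ d - g → ∀ u ∈ I ^ (j + 1) ⊔ K k, u ∈ K (k + 1) ↔
      u ∈ K k ⊔ Ideal.span {a k} * (I ^ j ⊔ K k) := by
      intro j hj
      refine h.L (by omega) (hD _ hj 1 (by omega) (by omega)) (hD j (by omega) 2 (by omega) 
        (by omega))
    have hYX : ∀ j, K k ⊔ Ideal.span {a k} * (I ^ j ⊔ K k) ≤ I ^ (j + 1) ⊔ K k := by
      intro j
      refine sup_le le_sup_right ?_
      rw [Ideal.mul_sup]
      refine sup_le_sup ?_ Ideal.mul_le_right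
      rw [pow_succ']
      exact Ideal.mul_mono_left ((Ideal.span_singleton_le_iff_mem _).2 (h.ha k (by omega)))
    have hKm : K k ≤ K (k + 1) := h.K_mono (by omega)
    have hAA : ∀ j, I ^ j ⊔ K (k + 1) = K (k + 1) ⊔ (I ^ j ⊔ K k) := by
      intro j
      apply le_antisymm
      · exact sup_le (le_sup_left.trans le_sup_right) le_sup_left
      · exact sup_le le_sup_right (sup_le_sup_left hKm _)
    have hr : g ≤ k + 1 → 
        Mat (d - (k + 1)) (I ^ (k + 1 - g + 1) ⊔ K (k + 1)) (K (k + 1)) (K (k + 1)) := by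
      intro hg
      rcases Nat.lt_or_ge k g with hkg | hkg
      · obtain rfl : g = k + 1 := by omega
        simpa using h.rowg
      · have h6 := hrow hkg
        set j := k - g + 1 with hj
        rw [show d - k = (d - (k + 1)) + 1 by omega] at h6
        have hi0 : MInv (I ^ j ⊔ K k) (K k) (K k) := fun z hz a _ => (K k).mul_mem_right _ hz
        have hreg := h.h2 k (by omega)
        have h7 := h6.drop hi0 (h.hIm (h.ha k (by omega))) (fun u _ hu => hreg u trivial hu) hreg
        have h8 := row_mat I _ _ _ _ (sup_le le_sup_right Ideal.mul_le_right) hi0.step h7 (by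
          have e : K k ⊔ Ideal.span {a k} * (I ^ j ⊔ K k) ⊔ I * (I ^ j ⊔ K k) =
              I ^ (j + 1) ⊔ K k := by
            apply le_antisymm
            · refine sup_le (hYX j) ?_
              rw [Ideal.mul_sup, ← pow_succ']
              exact sup_le_sup_left Ideal.mul_le_right _
            · refine sup_le ?_ (le_sup_left.trans le_sup_left)
              rw [pow_succ']
              exact (Ideal.mul_mono_right le_sup_left).trans le_sup_right
          rw [e]
          refine DD.quot (B := K k) le_sup_right (sup_le_sup_right (Ideal.pow_le_pow_right 
            (by omega)) _) ?_ ?_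
          · exact hD j (by omega) _ (by omega) (by omega)
          · exact hD (j + 1) (by omega) _ (by omega) (by omega))
        have es : Submodule.colon (K k ⊔ Ideal.span {a k} * ⊤) (I : Set R) = K (k + 1) := by
          rw [h.hK (k + 1)]
          apply le_antisymm
          · intro z hz
            rw [mem_col] at hz ⊢
            intro i hi
            obtain ⟨c, _, hc⟩ := mem_sup_smul.1 (hz i hi)
            rw [h.aaS]
            refine mem_sup_span.2 ⟨c, h.h1 k (by omega) ⟨hc, ?_⟩⟩
            exact I.sub_mem (I.mul_mem_left _ hi) (I.mul_mem_right _ (h.ha k (by omega)))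
          · intro z hz
            rw [mem_col] at hz ⊢
            intro i hi
            have := hz i hi
            rw [h.aaS] at this
            rw [Ideal.mul_top]
            exact sup_le_sup_right (h.aaK k) _ this
        rw [es] at h8
        have hle : I * (I ^ j ⊔ K k) ≤ I ^ (j + 1) ⊔ K k := by
          rw [Ideal.mul_sup, ← pow_succ']
          exact sup_le_sup_left Ideal.mul_le_right _
        refine Mat.iso1 (s := ⊥) ?_ (fun u hu => ?_) h8
        · rw [show k + 1 - g + 1 = j + 1 by omega]
          apply le_antisymm
          · refine sup_le ?_ le_sup_left
            rw [Ideal.mul_sup, ← pow_succ']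
            exact le_sup_left.trans le_sup_right
          · refine sup_le le_sup_right (hle.trans (sup_le_sup_left hKm _))
        · rw [hL j (by omega) u (hle hu)]
          exact ⟨fun h => ⟨h, hu⟩, fun h => h.1⟩
    refine ⟨?_, hr⟩
    rintro j hj n hn hor
    rcases j with _ | j
    · have := h.DzeroOf (k + 1) (by omega) hr
      rw [pow_zero, Ideal.one_eq_top, top_sup_eq]
      exact this.mono hn
    · have h7 : DD (I ^ (j + 1) ⊔ K k) n (K k ⊔ Ideal.span {a k} * (I ^ j ⊔ K k)) := by
        refine DD.quot (B := K k) le_sup_left (hYX j) (hD _ hj n (by omega) (by omega)) ?_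
        refine (DD.iso (a := a k) le_sup_right rfl ?_).1 (hD j (by omega) (n + 1) (by omega)
          (by omega))
        intro u hu
        exact ⟨h.h2 k (by omega) u trivial, fun hu => Ideal.mul_mem_left _ _ hu⟩
      exact DD.iso1 (hYX j) (hAA _) (hL j (by omega)) h7

/-- Local theorem E. -/
theorem E (h : LocE I a d g aa K) {z : R} (hz : ∀ i ∈ I ^ (d - g), z * i ∈ K (d - 1) ⊔ Ideal.span {a (d - 1)} * I ^ (d - g)) :
    z ∈ K (d - 1) ⊔ Ideal.span {a (d - 1)} := by
  have hgd := h.hgd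
  have h6 := (h.main (d - 1) (by omega)).2 (by omega)
  rw [show d - (d - 1) = 0 + 1 by omega, show d - 1 - g + 1 = d - g by omega] at h6
  have hreg := h.h2 (d - 1) (by omega)
  have h7 := h6.drop (fun z hz a _ => (K (d - 1)).mul_mem_right _ hz) 
    (h.hIm (h.ha (d - 1) (by omega))) (fun u _ hu => hreg u trivial hu) hreg
  have := h7.2.1 z (by
    intro u hu
    obtain ⟨v, hv, w, hw, rfl⟩ := Submodule.mem_sup.1 hu
    rw [mul_add]
    refine Ideal.add_mem _ ?_ (le_sup_left (a := K (d - 1)) (Ideal.mul_mem_left _ _ hw))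
    have hle : K (d - 1) ⊔ Ideal.span {a (d - 1)} * I ^ (d - g) ≤ 
        K (d - 1) ⊔ Ideal.span {a (d - 1)} * (I ^ (d - g) ⊔ K (d - 1)) :=
      sup_le_sup_left (Ideal.mul_mono_right le_sup_left) _
    exact hle (hz v hv))
  rwa [Ideal.mul_top] at this

end LocE
end A5
end Part5

section Part6
set_option linter.all false

section A6
variable {R : Type u} [CommRing R]

lemma smulReg_iff {K : Ideal R} {r : R} : IsSMulRegular (R ⧸ K) r ↔ Reg ⊤ K r := by
  rw [isSMulRegular_iff_right_eq_zero_of_smul]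
  constructor
  · intro h u _ hu
    rw [← Submodule.Quotient.mk_eq_zero K] at hu ⊢
    exact h _ hu
  · intro h u hu
    obtain ⟨u, rfl⟩ := Submodule.Quotient.mk_surjective _ u
    rw [← Submodule.Quotient.mk_smul, Submodule.Quotient.mk_eq_zero] at hu
    rw [Submodule.Quotient.mk_eq_zero]
    exact h u trivial hu

noncomputable def quotSMulTopEquiv (K : Ideal R) (r : R) :
    QuotSMulTop r (R ⧸ K) ≃ₗ[R] R ⧸ (K ⊔ Ideal.span {r}) :=
  (Submodule.quotEquivOfEq _ _ (by
    ext x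
    rw [Submodule.mem_smul_pointwise_iff_exists]
    constructor
    · rintro ⟨b, _, rfl⟩
      obtain ⟨b, rfl⟩ := Submodule.Quotient.mk_surjective _ b
      exact ⟨r * b, Ideal.mul_mem_right _ _ (Ideal.mem_span_singleton_self r), rfl⟩
    · rintro ⟨b, hb, rfl⟩
      obtain ⟨c, rfl⟩ := Ideal.mem_span_singleton.1 hb
      exact ⟨Submodule.Quotient.mk c, trivial, rfl⟩)).trans
  (Submodule.quotientQuotientEquivQuotientSup K (Ideal.span {r}))

lemma wreg_cons {K : Ideal R} {r : R} {rs : List R} :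
    RingTheory.Sequence.IsWeaklyRegular (R ⧸ K) (r :: rs) ↔ Reg ⊤ K r ∧
    RingTheory.Sequence.IsWeaklyRegular (R ⧸ (K ⊔ Ideal.span {r})) rs := by
  rw [RingTheory.Sequence.isWeaklyRegular_cons_iff, smulReg_iff,
    (quotSMulTopEquiv K r).isWeaklyRegular_congr]

lemma DD_of_wreg [IsLocalRing R] (rs : List R) : ∀ (K : Ideal R), (∀ x ∈ rs, x ∈ maximalIdeal R) →
    RingTheory.Sequence.IsWeaklyRegular (R ⧸ K) rs → DD ⊤ rs.length K := by
  induction rs with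
  | nil => intros; trivial
  | cons r rs ih =>
    intro K hm h
    rw [wreg_cons] at h
    refine ⟨r, hm r (by simp), h.1, ?_⟩
    rw [Ideal.mul_top]
    exact ih _ (fun x hx => hm x (by simp [hx])) h.2

lemma DD_of_qDepth [IsLocalRing R] [IsNoetherianRing R] {K : Ideal R} {n : ℕ}
    (h : (n : ℕ∞) ≤ qDepth R K) : DD ⊤ n K := by
  rcases n with _ | n
  · trivial
  have h1 : (n : ℕ∞) < qDepth R K := lt_of_lt_of_le (by exact_mod_cast Nat.lt_succ_self n) h
  obtain ⟨a, ⟨rs, hm, hr, rfl⟩, h2⟩ := lt_sSup_iff.1 h1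
  have : n < rs.length := by exact_mod_cast h2
  exact (DD_of_wreg rs K hm hr.toIsWeaklyRegular).mono this

/-- regular sequences in `c` -/
def RegIn (c : Ideal R) : ℕ → Ideal R → Ideal R → Prop
  | 0, B, B' => B = B'
  | n + 1, B, B' => ∃ C, RegIn c n B C ∧ ∃ y ∈ c, Reg ⊤ C y ∧ B' = C ⊔ Ideal.span {y}

lemma RegIn.mono {c c' : Ideal R} (hc : c ≤ c') {n : ℕ} {B : Ideal R} : ∀ {B' : Ideal R},
    RegIn c n B B' → RegIn c' n B B' := by
  induction n with
  | zero => intro B' h; exact h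
  | succ n ih =>
    rintro B' ⟨C, h1, y, hy, h2, rfl⟩
    exact ⟨C, ih h1, y, hc hy, h2, rfl⟩

lemma RegIn.le {c : Ideal R} {n : ℕ} {B : Ideal R} : ∀ {B' : Ideal R},
    RegIn c n B B' → B ≤ B' := by
  induction n with
  | zero => intro B' h; exact le_of_eq h
  | succ n ih =>
    rintro B' ⟨C, h1, y, hy, h2, rfl⟩
    exact (ih h1).trans le_sup_left

lemma RegIn.le' {c : Ideal R} {n : ℕ} {B : Ideal R} (hB : B ≤ c) : ∀ {B' : Ideal R},
    RegIn c n B B' → B' ≤ c := by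
  induction n with
  | zero => rintro B' rfl; exact hB
  | succ n ih =>
    rintro B' ⟨C, h1, y, hy, h2, rfl⟩
    exact sup_le (ih h1) ((Ideal.span_singleton_le_iff_mem _).2 hy)

section
variable [IsLocalRing R] [IsNoetherianRing R]

lemma RegIn.drop {c : Ideal R} (hc : c ≤ maximalIdeal R) {n : ℕ} {B : Ideal R} : 
    ∀ {k : ℕ} {B' : Ideal R},
    RegIn c n B B' → DD ⊤ (n + k) B → DD ⊤ k B' := by
  induction n with
  | zero => rintro k B' rfl h; simpa using h
  | succ n ih =>
    rintro k B' ⟨C, h1, y, hy, h2, rfl⟩ h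
    have := (ih (k := k + 1) h1 (by convert h using 1; omega)).drop (hc hy) h2
    rwa [Ideal.mul_top] at this

lemma RegIn.lift {n : ℕ} {B : Ideal R} : 
    ∀ {k : ℕ} {B' : Ideal R},
    RegIn (maximalIdeal R) n B B' → DD ⊤ k B' → DD ⊤ (n + k) B := by
  induction n with
  | zero => rintro k B' rfl h; simpa using h
  | succ n ih =>
    rintro k B' ⟨C, h1, y, hy, h2, rfl⟩ h
    have := ih (k := k + 1) h1 ⟨y, hy, h2, by rwa [Ideal.mul_top]⟩
    convert this using 1; omega
end

/-- heights of primes containing a regular sequence -/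
lemma RegIn.height_ge [IsNoetherianRing R] {c B : Ideal R} {n : ℕ} : ∀ {B' : Ideal R}, 
    RegIn c n B B' →
    ∀ q : Ideal R, q.IsPrime → B' ≤ q → (n : ℕ∞) ≤ q.height := by
  induction n with
  | zero => intros; simp
  | succ n ih =>
    rintro B' ⟨C, h1, y, hy, h2, rfl⟩ q hq hle
    obtain ⟨p0, hp0, hp0q⟩ := Ideal.exists_minimalPrimes_le (le_sup_left.trans hle)
    have hpr := hp0.1.1
    have hyp : y ∉ p0 := h2.notMem (assP_of_minimalPrimes hp0)
    have hlt : p0 < q := lt_of_le_of_ne hp0q (fun h => hyp (h ▸ hle (le_sup_right (a := C)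
      (Ideal.mem_span_singleton_self y))))
    have := ih h1 p0 hpr hp0.1.2
    push_cast
    exact (add_le_add_left this 1).trans (Ideal.height_add_one_le_of_lt_of_isPrime hlt)

/-- Cohen-Macaulay local ring of dimension `d`. -/
def CMd (R : Type u) [CommRing R] [IsLocalRing R] (d : ℕ) : Prop :=
  ringKrullDim R = d ∧ DD (⊤ : Ideal R) d ⊥

section
variable [IsLocalRing R] [IsNoetherianRing R]

lemma CMd.of (h : IsCMLocalRing R) : ∃ d, CMd R d := by
  have h1 := IsLocalRing.maximalIdeal_height_eq_ringKrullDim (R := R)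
  have h2 : (maximalIdeal R).height ≠ ⊤ := by
    have := Ideal.finiteHeight_of_isNoetherianRing (maximalIdeal R)
    exact Ideal.height_ne_top Ideal.IsPrime.ne_top'
  obtain ⟨d, hd⟩ := ENat.ne_top_iff_exists.1 h2
  refine ⟨d, ?_, DD_of_qDepth ?_⟩
  · rw [← h1, ← hd]; rfl
  · have h3 : rDim R = _ := h
    rw [rDim, ← h1, ← hd] at h3
    exact (WithBot.coe_injective h3).le

lemma CMd.height_le {d : ℕ} (h : CMd R d) {c : Ideal R} (hc : c ≤ maximalIdeal R)
    {n : ℕ} (hn : n ≤ d) {B : Ideal R} (hB : RegIn c n ⊥ B) {q : Ideal R} (hq : AssP ⊤ B q) :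
    q.height ≤ n := by
  have h1 : DD ⊤ (d - n) B := RegIn.drop hc hB (by convert h.2 using 1; omega)
  have h2 := h1.ass ⟨q, hq.1⟩ hq
  have h3 := PrimeSpectrum.height_eq_orderHeight ⟨q, hq.1⟩
  have h4 : Order.height (⟨q, hq.1⟩ : PrimeSpectrum R) + Order.coheight (⟨q, hq.1⟩ : PrimeSpectrum R)
      ≤ d := by
    have h5 := h.1
    rw [ringKrullDim, Order.krullDim_eq_iSup_height_add_coheight_of_nonempty] at h5
    have h6 : (⨆ a : PrimeSpectrum R, Order.height a + Order.coheight a) = (d : ℕ∞) :=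
      WithBot.coe_injective h5
    rw [← h6]
    exact le_iSup (fun a : PrimeSpectrum R => Order.height a + Order.coheight a) ⟨q, hq.1⟩
  simp only at h3
  rw [h3]
  generalize Order.height (⟨q, hq.1⟩ : PrimeSpectrum R) = x at *
  generalize Order.coheight (⟨q, hq.1⟩ : PrimeSpectrum R) = z at *
  have hx : x ≠ ⊤ := by rintro rfl; simp at h4
  have hz : z ≠ ⊤ := by rintro rfl; simp at h4
  lift x to ℕ using hx
  lift z to ℕ using hz
  norm_cast at *
  omega

lemma CMd.height_le_d {d : ℕ} (h : CMd R d) {q : Ideal R} (hq : q ≠ ⊤) : q.height ≤ d := by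
  have := Ideal.height_le_ringKrullDim_of_ne_top hq
  rw [h.1] at this
  exact_mod_cast this

lemma CMd.exists_regIn {d : ℕ} (h : CMd R d) {c : Ideal R} (hc : c ≤ maximalIdeal R) (n : ℕ)
    (hh : ∀ q : Ideal R, q.IsPrime → c ≤ q → (n : ℕ∞) ≤ q.height) :
    ∃ B, RegIn c n ⊥ B := by
  have hnd : n ≤ d := by
    have := (hh (maximalIdeal R) inferInstance hc).trans (h.height_le_d Ideal.IsPrime.ne_top')
    exact_mod_cast this
  have : ∀ k, k ≤ n → ∃ B, RegIn c k ⊥ B := by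
    intro k
    induction k with
    | zero => intro _; exact ⟨⊥, rfl⟩
    | succ k ih =>
      intro hk
      obtain ⟨C, hC⟩ := ih (by omega)
      obtain ⟨y, hy, h2⟩ := avoid_primes (c := c) (assP_finite ⊤ C) (fun q hq => hq.1) (by
        intro q hq hcq
        have h3 := h.height_le hc (by omega) hC hq
        have h4 := (hh q hq.1 hcq).trans h3
        have : n ≤ k := by exact_mod_cast h4
        omega)
      exact ⟨_, C, hC, y, hy, reg_of_avoid h2, rfl⟩
  exact this n le_rfl

end
end A6
end Part6

section Part7
set_option linter.all false

section A7
variable {R : Type u} [CommRing R]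

section loc
variable (p : Ideal R) [hp : p.IsPrime]

abbrev Lp := Localization.AtPrime p
abbrev toL : R →+* Lp p := algebraMap R (Localization.AtPrime p)
abbrev mp (C : Ideal R) : Ideal (Lp p) := C.map (algebraMap R (Localization.AtPrime p))

variable {p}

lemma loc_mem {C : Ideal R} {x : R} : toL p x ∈ mp p C ↔ ∃ s, s ∉ p ∧ s * x ∈ C := by
  rw [IsLocalization.algebraMap_mem_map_algebraMap_iff p.primeCompl]
  rfl

lemma loc_unit {s : R} (hs : s ∉ p) : IsUnit (toL p s) :=
  IsLocalization.map_units (Lp p) (⟨s, hs⟩ : p.primeCompl)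

lemma loc_rep (z : Lp p) : ∃ x : R, ∃ w : Lp p, IsUnit w ∧ z = w * toL p x := by
  obtain ⟨⟨x, s⟩, h⟩ := IsLocalization.surj p.primeCompl z
  obtain ⟨w, hw⟩ := loc_unit (p := p) s.2
  refine ⟨x, ↑w⁻¹, Units.isUnit _, ?_⟩
  simp only at h
  rw [← h, ← hw]
  rw [mul_comm z, ← mul_assoc, Units.inv_mul, one_mul]

lemma unit_mul_mem {S : Type*} [CommRing S] {C : Ideal S} {w x : S} (hw : IsUnit w) : w * x ∈ C ↔ x ∈ C :=
  C.unit_mul_mem_iff_mem hw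

lemma loc_reg {A B : Ideal R} {y : R} (h : Reg A B y) : Reg (mp p A) (mp p B) (toL p y) := by
  intro z hz hyz
  obtain ⟨x, w, hw, rfl⟩ := loc_rep z
  rw [unit_mul_mem hw] at hz ⊢
  rw [mul_left_comm, unit_mul_mem hw, ← map_mul] at hyz
  obtain ⟨s, hs, h1⟩ := loc_mem.1 hz
  obtain ⟨t, ht, h2⟩ := loc_mem.1 hyz
  refine loc_mem.2 ⟨t * s, fun h => (hp.mem_or_mem h).elim ht hs, h _ ?_ ?_⟩
  · rw [mul_assoc]; exact A.mul_mem_left _ h1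
  · have := B.mul_mem_left s h2
    convert this using 1; ring

lemma loc_regIn {c : Ideal R} {n : ℕ} {B : Ideal R} : ∀ {B' : Ideal R}, RegIn c n B B' →
    RegIn (mp p c) n (mp p B) (mp p B') := by
  induction n with
  | zero => rintro B' rfl; rfl
  | succ n ih =>
    rintro B' ⟨C, h1, y, hy, h2, rfl⟩
    refine ⟨_, ih h1, toL p y, Ideal.mem_map_of_mem _ hy, ?_, ?_⟩
    · have := loc_reg (p := p) h2
      rwa [mp, Ideal.map_top] at this
    · rw [mp, Ideal.map_sup, Ideal.map_span, Set.image_singleton]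

lemma loc_le {A B : Ideal R} : mp p A ≤ mp p B ↔ ∀ x ∈ A, ∃ s, s ∉ p ∧ s * x ∈ B := by
  rw [mp, Ideal.map_le_iff_le_comap]
  exact forall₂_congr fun x hx => loc_mem

lemma loc_colon [IsNoetherianRing R] {C I : Ideal R} : 
    mp p (Submodule.colon C (I : Set R)) = Submodule.colon (mp p C) (mp p I : Set (Lp p)) := by
  apply le_antisymm
  · rw [mp, Ideal.map_le_iff_le_comap]
    intro x hx
    rw [mem_col] at hx
    rw [Ideal.mem_comap, mem_col]
    have : mp p I ≤ Submodule.colon (mp p C) (Ideal.span {toL p x} : Set (Lp p)) := by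
      rw [mp, Ideal.map_le_iff_le_comap]
      intro i hi
      rw [Ideal.mem_comap, mem_col]
      intro z hz
      obtain ⟨c, rfl⟩ := Ideal.mem_span_singleton.1 hz
      rw [← mul_assoc, ← map_mul, mul_comm i]
      exact Ideal.mul_mem_right _ _ (Ideal.mem_map_of_mem _ (hx i hi))
    intro i hi
    have := mem_col.1 (this hi) _ (Ideal.mem_span_singleton_self _)
    rwa [mul_comm]
  · intro z hz
    obtain ⟨x, w, hw, rfl⟩ := loc_rep z
    rw [unit_mul_mem hw] at hz ⊢
    rw [mem_col] at hz
    obtain ⟨F, hF⟩ := (IsNoetherian.noetherian I : I.FG)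
    have h1 : ∀ i ∈ F, ∃ s, s ∉ p ∧ s * (x * i) ∈ C := by
      intro i hi
      rw [← loc_mem, map_mul]
      exact hz _ (Ideal.mem_map_of_mem _ (hF ▸ Submodule.subset_span hi))
    choose! s hs hsC using h1
    refine loc_mem.2 ⟨∏ i ∈ F, s i, ?_, ?_⟩
    · rw [hp.prod_mem_iff]
      rintro ⟨i, hi, h⟩
      exact hs i hi h
    · have : I ≤ Submodule.colon C (Ideal.span {(∏ i ∈ F, s i) * x} : Set R) := by
        rw [← hF, Ideal.submodule_span_eq, Ideal.span_le]
        intro i hi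
        rw [SetLike.mem_coe, mem_col]
        intro z hz
        obtain ⟨c, rfl⟩ := Ideal.mem_span_singleton.1 hz
        have h3 : s i ∣ ∏ i ∈ F, s i := Finset.dvd_prod_of_mem s hi
        obtain ⟨b, hb⟩ := h3
        have := C.mul_mem_left (b * c) (hsC i hi)
        rw [hb]
        convert this using 1; ring
      rw [mem_col]
      intro i hi
      have := mem_col.1 (this hi) _ (Ideal.mem_span_singleton_self _)
      rwa [mul_comm]

lemma loc_assP [IsNoetherianRing R] {A B q : Ideal R} (h : AssP A B q) (hqp : q ≤ p) : 
    AssP (mp p A) (mp p B) (mp p q) := by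
  obtain ⟨hq, u, hu, h1⟩ := h
  have hd : Disjoint (p.primeCompl : Set R) q := by
    rw [Set.disjoint_left]
    exact fun x hx hxq => hx (hqp hxq)
  have hpr : (mp p q).IsPrime := IsLocalization.isPrime_of_isPrime_disjoint p.primeCompl _ q hq hd
  refine ⟨hpr, toL p u, Ideal.mem_map_of_mem _ hu, fun z => ?_⟩
  obtain ⟨x, w, hw, rfl⟩ := loc_rep z
  rw [mul_assoc, unit_mul_mem hw, unit_mul_mem hw, ← map_mul, loc_mem, loc_mem]
  refine exists_congr fun s => and_congr_right fun hs => ?_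
  rw [← mul_assoc, h1]

lemma mp_self_max : mp p p = maximalIdeal (Lp p) := Localization.AtPrime.map_eq_maximalIdeal

lemma mp_height [IsNoetherianRing R] {q : Ideal R} [q.IsPrime] (hqp : q ≤ p) : (mp p q).height = q.height := by
  refine IsLocalization.height_map_of_disjoint p.primeCompl q ?_
  rw [Set.disjoint_left]
  exact fun x hx hxq => hx (hqp hxq)

lemma rDim_loc : rDim (Lp p) = (p.height : WithBot ℕ∞) :=
  IsLocalization.AtPrime.ringKrullDim_eq_height p (Lp p)

end loc

lemma height_coe [IsNoetherianRing R] (p : Ideal R) [p.IsPrime] : ∃ h : ℕ, p.height = h := by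
  have : p.height ≠ ⊤ := by
    have := Ideal.finiteHeight_of_isNoetherianRing p
    exact Ideal.height_ne_top Ideal.IsPrime.ne_top'
  obtain ⟨d, hd⟩ := ENat.ne_top_iff_exists.1 this
  exact ⟨d, hd.symm⟩

variable [IsLocalRing R] [IsNoetherianRing R]

lemma CMd.loc {d : ℕ} (h : CMd R d) (p : Ideal R) [hp : p.IsPrime] {n : ℕ} (hn : p.height = n) : 
    CMd (Lp p) n := by
  refine ⟨?_, ?_⟩
  · have := rDim_loc (p := p)
    rw [rDim] at this
    rw [this, hn]; rfl
  · obtain ⟨B, hB⟩ := h.exists_regIn (c := p) (IsLocalRing.le_maximalIdeal hp.ne_top) n (by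
      intro q hq hpq
      rw [← hn]; exact Ideal.height_mono hpq)
    have := loc_regIn (p := p) hB
    rw [mp_self_max, mp, Ideal.map_bot] at this
    exact RegIn.lift (k := 0) this trivial

/-- catenarity -/
lemma CMd.cat {d : ℕ} (h : CMd R d) {P q : Ideal R} [hP : P.IsPrime] [hq : q.IsPrime] (hPq : P ≤ q)
    {a : ℕ} (hP2 : P.height = a)
    (hdim : ringKrullDim (Lp q ⧸ mp q P) ≤ 1) : q.height ≤ a + 1 := by
  obtain ⟨b, hb⟩ := height_coe q
  obtain ⟨B, hB⟩ := h.exists_regIn (c := P) (IsLocalRing.le_maximalIdeal hP.ne_top) a (by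
    intro q hq hpq
    rw [← hP2]; exact Ideal.height_mono hpq)
  have hBP : B ≤ P := hB.le' bot_le
  have hmin : P ∈ B.minimalPrimes := by
    obtain ⟨p0, hp0, hp0P⟩ := Ideal.exists_minimalPrimes_le hBP
    have hpr := hp0.1.1
    rcases eq_or_lt_of_le hp0P with h1 | h1
    · rwa [← h1]
    · have := Ideal.finiteHeight_of_isNoetherianRing p0
      have := Ideal.height_strict_mono_of_isPrime h1
      have h2 := hB.height_ge p0 hpr hp0.1.2
      rw [hP2] at this
      exact absurd h2 (not_le.2 this)
  have hass := loc_assP (p := q) (assP_of_minimalPrimes hmin) hPq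
  have hC := h.loc q hb
  have hab : a ≤ b := by
    have := Ideal.height_mono hPq
    rw [hP2, hb] at this; exact_mod_cast this
  have hr := loc_regIn (p := q) hB
  have hDD : DD ⊤ (b - a) (mp q B) := by
    refine RegIn.drop (c := mp q P) (IsLocalRing.le_maximalIdeal hass.1.ne_top) hr ?_
    rw [mp, Ideal.map_bot]
    convert hC.2 using 1; omega
  rw [mp, Ideal.map_top] at hass
  have h1 := hDD.ass ⟨_, hass.1⟩ hass
  rw [hb]
  have h2 : (Order.coheight (⟨_, hass.1⟩ : PrimeSpectrum (Lp q)) : WithBot ℕ∞) ≤ 1 := by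
    refine le_trans ?_ hdim
    rw [ringKrullDim_quotient, Order.coheight_eq_krullDim_Ici]
    apply Order.krullDim_le_of_strictMono 
      (fun x => (⟨x.1, x.2⟩ : PrimeSpectrum.zeroLocus (mp q P : Set (Lp q))))
    intro x y hxy
    exact hxy
  have h3 : ((b - a : ℕ) : ℕ∞) ≤ 1 := h1.trans (by exact_mod_cast h2)
  have : b - a ≤ 1 := by exact_mod_cast h3
  have : b ≤ a + 1 := by omega
  exact_mod_cast this

end A7
end Part7

section Part8
set_option linter.all false

section A8
variable {R : Type u} [CommRing R] [IsLocalRing R] [IsNoetherianRing R]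

lemma ofList_cons' (K : Ideal R) (r : R) (rs : List R) :
    K ⊔ Ideal.ofList (r :: rs) = (K ⊔ Ideal.span {r}) ⊔ Ideal.ofList rs := by
  rw [Ideal.ofList_cons, sup_assoc]

lemma mat_of_wreg (rs : List R) : ∀ (K : Ideal R), (∀ x ∈ rs, x ∈ maximalIdeal R) →
    RingTheory.Sequence.IsWeaklyRegular (R ⧸ K) rs → 
    Mat0 ⊤ (K ⊔ Ideal.ofList rs) (K ⊔ Ideal.ofList rs) → Mat rs.length ⊤ K K := by
  induction rs with
  | nil => 
    intro K _ _ h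
    rw [Ideal.ofList_nil, sup_bot_eq] at h
    exact h
  | cons r rs ih =>
    intro K hm h h0
    rw [wreg_cons] at h
    refine ⟨r, hm r (by simp), h.1, h.1, ?_⟩
    rw [Ideal.mul_top]
    exact ih _ (fun x hx => hm x (by simp [hx])) h.2 (by rwa [ofList_cons'] at h0)

lemma wreg_height (rs : List R) : ∀ (K : Ideal R) (n : ℕ),
    RingTheory.Sequence.IsWeaklyRegular (R ⧸ K) rs → 
    (∀ q : Ideal R, q.IsPrime → K ≤ q → (n : ℕ∞) ≤ q.height) →
    (∀ q : Ideal R, q.IsPrime → K ⊔ Ideal.ofList rs ≤ q → ((n + rs.length : ℕ) : ℕ∞) ≤ q.height) := by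
  induction rs with
  | nil => 
    intro K n _ h q hq hle
    exact h q hq (le_sup_left.trans hle)
  | cons r rs ih =>
    intro K n h h0 q hq hle
    rw [wreg_cons] at h
    have := ih (K ⊔ Ideal.span {r}) (n + 1) h.2 (by
      intro q hq hle
      obtain ⟨p0, hp0, hp0q⟩ := Ideal.exists_minimalPrimes_le (le_sup_left.trans hle)
      have hpr := hp0.1.1
      have hyp : r ∉ p0 := h.1.notMem (assP_of_minimalPrimes hp0)
      have hlt : p0 < q := lt_of_le_of_ne hp0q (fun h => hyp (h ▸ hle (le_sup_right (a := K)
        (Ideal.mem_span_singleton_self r))))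
      have := h0 p0 hpr hp0.1.2
      push_cast
      exact (add_le_add_left this 1).trans (Ideal.height_add_one_le_of_lt_of_isPrime hlt)) q hq
        (by rwa [ofList_cons'] at hle)
    refine le_trans (le_of_eq ?_) this
    simp; ring

lemma muE_one {M : Type v} [AddCommGroup M] [Module R M] {N : Submodule R M} {n : ℕ} (h : muE N = n) :
    ∃ s : Finset M, s.card = n ∧ Submodule.span R (s : Set M) = N := by
  have hne : {n : ℕ∞ | ∃ s : Finset M, (s.card : ℕ∞) = n ∧ Submodule.span R (s : Set M) = N}.Nonempty := by
    by_contra hc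
    rw [Set.not_nonempty_iff_eq_empty] at hc
    rw [muE, hc, sInf_empty] at h
    exact ENat.top_ne_coe n h
  obtain ⟨s, h1, h2⟩ := csInf_mem hne
  refine ⟨s, ?_, h2⟩
  rw [muE] at h
  rw [h] at h1
  exact_mod_cast h1

lemma Gor.mat {d : ℕ} (hG : IsGorensteinLocalRing R) (hd : CMd R d) : Mat d (⊤ : Ideal R) ⊥ ⊥ := by
  obtain ⟨hCM, hT⟩ := hG
  have hne : {n : ℕ∞ | ∃ rs : List R, (∀ x ∈ rs, x ∈ maximalIdeal R) ∧
    RingTheory.Sequence.IsRegular (R ⧸ (⊥ : Ideal R)) rs ∧ (rs.length : ℕ∞) = qDepth R (⊥ : Ideal R) ∧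
    muE (socle R ((⊥ : Ideal R) ⊔ Ideal.ofList rs)) = n}.Nonempty := by
    by_contra hc
    rw [Set.not_nonempty_iff_eq_empty] at hc
    rw [qType, hc, sInf_empty] at hT
    simp at hT
  obtain ⟨rs, hm, hr, hlen, hmu⟩ := csInf_mem hne
  have hlen' : rs.length = d := by
    rw [IsCMLocalRing, rDim, hd.1, ← hlen] at hCM
    exact_mod_cast hCM.symm
  have hmu1 : muE (socle R ((⊥ : Ideal R) ⊔ Ideal.ofList rs)) = ((1 : ℕ) : ℕ∞) := by
    rw [qType] at hT
    rw [hmu]; exact_mod_cast hT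
  rw [← hlen']
  refine mat_of_wreg rs ⊥ hm hr.toIsWeaklyRegular ?_
  set B := (⊥ : Ideal R) ⊔ Ideal.ofList rs with hB
  have hmB : B ≤ maximalIdeal R := by
    rw [hB, bot_sup_eq, Ideal.ofList, Ideal.span_le]
    exact fun x hx => hm x hx
  refine ⟨?_, ?_, ?_⟩
  · have hmuu : muE (socle R B) = ((1:ℕ):ℕ∞) := hmu1
    have : IsLocalRing (R ⧸ B) := 
      have : Nontrivial (R ⧸ B) := Ideal.Quotient.nontrivial_iff.2 (fun h => by
        rw [h] at hmB; exact (Ideal.IsPrime.ne_top' (I := maximalIdeal R)) (top_le_iff.1 hmB))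
      IsLocalRing.of_surjective' (Ideal.Quotient.mk B) Ideal.Quotient.mk_surjective
    obtain ⟨s, hs1, hs2⟩ := muE_one (R := R ⧸ B) hmuu
    obtain ⟨w, rfl⟩ := Finset.card_eq_one.1 hs1
    obtain ⟨w, rfl⟩ := Ideal.Quotient.mk_surjective w
    have hsoc : ∀ u : R, (∀ r ∈ maximalIdeal R, r * u ∈ B) ↔ Ideal.Quotient.mk B u ∈ socle R B := by
      intro u
      rw [socle, mem_col]
      constructor
      · intro h i hi
        rw [Ideal.mem_map_iff_of_surjective _ Ideal.Quotient.mk_surjective] at hi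
        obtain ⟨r, hr, rfl⟩ := hi
        rw [Ideal.mem_bot, ← map_mul, Ideal.Quotient.eq_zero_iff_mem, mul_comm]
        exact h r hr
      · intro h r hr
        have := h _ (Ideal.mem_map_of_mem (Ideal.Quotient.mk B) hr)
        rwa [Ideal.mem_bot, ← map_mul, Ideal.Quotient.eq_zero_iff_mem, mul_comm] at this
    have key : ∀ u : R, (∀ r ∈ maximalIdeal R, r * u ∈ B) → ∃ c : R, u - c * w ∈ B := by
      intro u hu
      rw [hsoc, ← hs2, Finset.coe_singleton, Submodule.mem_span_singleton] at hu
      obtain ⟨c, hc⟩ := hu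
      obtain ⟨c, rfl⟩ := Ideal.Quotient.mk_surjective c
      refine ⟨c, ?_⟩
      rw [← Ideal.Quotient.eq_zero_iff_mem, map_sub, map_mul, ← hc]
      simp
    have hw : ∀ r ∈ maximalIdeal R, r * w ∈ B := by
      rw [hsoc, ← hs2]
      exact Submodule.subset_span (by simp)
    intro u _ v _ hu hv huB
    obtain ⟨c, hc⟩ := key u hu
    obtain ⟨e, he⟩ := key v hv
    have hcu : IsUnit c := by
      by_contra h
      have := hw c h
      apply huB
      have := B.add_mem hc this
      simpa using this
    obtain ⟨c, rfl⟩ := hcu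
    refine ⟨e * ↑c⁻¹, ?_⟩
    have h1 := B.sub_mem he (B.mul_mem_left (e * ↑c⁻¹) hc)
    convert h1 using 1
    linear_combination (-e*w) * c.inv_mul
  · intro z hz
    simpa using hz 1 trivial
  · refine Ideal.exists_pow_le_of_le_radical_of_fg ?_ (IsNoetherian.noetherian _)
    rw [Ideal.radical_eq_sInf]
    refine le_sInf ?_
    rintro q ⟨hq1, hq⟩
    have h1 := wreg_height rs ⊥ 0 hr.toIsWeaklyRegular (by intros; simp) q hq hq1
    rw [zero_add, hlen'] at h1
    have hqm := IsLocalRing.le_maximalIdeal hq.ne_top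
    rcases hqm.lt_or_eq with h | h
    · have h2 := Ideal.height_add_one_le_of_lt_of_isPrime h
      have h3 := h2.trans (hd.height_le_d (Ideal.IsPrime.ne_top'))
      have h4 := (add_le_add_left h1 1).trans h3
      have : d + 1 ≤ d := by exact_mod_cast h4
      omega
    · exact h.ge

end A8
end Part8

section Part9
set_option linter.all false

section A9
variable {R : Type u} [CommRing R]

lemma ht_ge_iff {I : Ideal R} {g : ℕ} : (g : WithBot ℕ∞) ≤ ht I ↔
    ∀ q : Ideal R, q.IsPrime → I ≤ q → (g : ℕ∞) ≤ q.height := by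
  rw [ht]
  simp only [le_iInf_iff]
  constructor
  · intro h q hq hle
    have := h ⟨q, hq⟩ hle
    rw [rDim_loc] at this
    exact_mod_cast this
  · intro h q hle
    have := h q.asIdeal q.2 hle
    rw [rDim_loc]
    exact_mod_cast this

lemma ne_top_of_ht {I : Ideal R} {g : ℕ} (h : ht I = g) : I ≠ ⊤ := by
  rintro rfl
  have : ((g + 1 : ℕ) : WithBot ℕ∞) ≤ ht (⊤ : Ideal R) := by
    rw [ht_ge_iff]
    intro q hq hle
    exact absurd (top_le_iff.1 hle) hq.ne_top
  rw [h] at this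
  have h2 : g + 1 ≤ g := by exact_mod_cast this
  omega

variable [IsLocalRing R]

lemma inf_units [hres : Infinite (ResidueField R)] :
    ∃ S : Set R, S.Infinite ∧ ∀ a ∈ S, ∀ b ∈ S, a ≠ b → IsUnit (a - b) := by
  choose f hf using (IsLocalRing.residue_surjective (R := R))
  have hinj : Function.Injective f := fun a b h => by rw [← hf a, h, hf]
  refine ⟨Set.range f, Set.infinite_range_of_injective hinj, ?_⟩
  rintro _ ⟨a, rfl⟩ _ ⟨b, rfl⟩ hab
  by_contra h
  have h1 : f a - f b ∈ maximalIdeal R := h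
  rw [← IsLocalRing.residue_eq_zero_iff, map_sub, hf, hf, sub_eq_zero] at h1
  exact hab (by rw [h1])

/-- points on a line avoiding an ideal -/
lemma line_avoid {S : Set R} (hS : ∀ a ∈ S, ∀ b ∈ S, a ≠ b → IsUnit (a - b)) 
    {X : Ideal R} {x y : R} (h : x ∉ X ∨ y ∉ X) : {s ∈ S | x + s * y ∈ X}.Subsingleton := by
  rintro a ⟨ha, ha2⟩ b ⟨hb, hb2⟩
  by_contra hab
  have hu := hS a ha b hb hab
  have h1 : (a - b) * y ∈ X := by
    have := X.sub_mem ha2 hb2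
    convert this using 1; ring
  rw [unit_mul_mem hu] at h1
  refine h.elim (fun h => h ?_) (fun h => h h1)
  have := X.sub_mem ha2 (X.mul_mem_left a h1)
  simpa using this

lemma line_avoid_fin {S : Set R} (hS : ∀ a ∈ S, ∀ b ∈ S, a ≠ b → IsUnit (a - b)) 
    {XX : Set (Ideal R)} (hX : XX.Finite) {x y : R} (h : ∀ X ∈ XX, x ∉ X ∨ y ∉ X) :
    {s ∈ S | ∃ X ∈ XX, x + s * y ∈ X}.Finite := by
  have : {s ∈ S | ∃ X ∈ XX, x + s * y ∈ X} = ⋃ X ∈ XX, {s ∈ S | x + s * y ∈ X} := by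
    ext s; simp
  rw [this]
  exact hX.biUnion (fun X hX => (line_avoid hS (h X hX)).finite)

lemma avoid_ideals [hres : Infinite (ResidueField R)] {J : Ideal R} {XX : Set (Ideal R)} (hX : XX.Finite)
    (h : ∀ X ∈ XX, ¬ J ≤ X) : ∃ x ∈ J, ∀ X ∈ XX, x ∉ X := by
  obtain ⟨S, hS, hS2⟩ := inf_units (R := R)
  induction XX, hX using Set.Finite.induction_on with
  | empty => exact ⟨0, J.zero_mem, by simp⟩
  | @insert X XX hXX hf ih =>
    obtain ⟨x, hx, hx2⟩ := ih (fun X hX => h X (Or.inr hX))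
    obtain ⟨y, hy, hy2⟩ := SetLike.not_le_iff_exists.1 (h X (Or.inl rfl))
    have := line_avoid_fin (x := x) (y := y) hS2 (hf.insert X) (by
      rintro Z (rfl | hZ)
      · exact Or.inr hy2
      · exact Or.inl (hx2 Z hZ))
    obtain ⟨s, hs, hs2⟩ := (hS.diff this).nonempty
    refine ⟨x + s * y, J.add_mem hx (J.mul_mem_left _ hy), ?_⟩
    intro Z hZ hmem
    exact hs2 ⟨hs, Z, hZ, hmem⟩

end A9
end Part9

section Part10
set_option linter.all false

section A10
variable {R : Type u} [CommRing R] [IsLocalRing R] [IsNoetherianRing R]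

abbrev col (a I : Ideal R) : Ideal R := Submodule.colon a (I : Set R)

/-- ambient hypotheses -/
structure Amb (I : Ideal R) (g l d : ℕ) : Prop where
  cm : CMd R d
  hI : I ≤ maximalIdeal R
  hg : ∀ q : Ideal R, q.IsPrime → I ≤ q → (g : ℕ∞) ≤ q.height
  hG : ∀ p : Ideal R, p.IsPrime → I ≤ p → ∀ h : ℕ, p.height = h → h < l →
    ∃ T : Finset R, (T : Set R) ⊆ I ∧ T.card ≤ h ∧ ¬ col (Ideal.span (T : Set R)) I ≤ p
  hgI : ht I = g
  hS : ∀ s < l, ∀ K, IsGeometricRI I K s → ∀ (q : Ideal R) [q.IsPrime] (x : R), Reg ⊤ K x →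
    AssP ⊤ (K ⊔ Ideal.span {x}) q → ringKrullDim (Lp q ⧸ mp q K) ≤ 1

structure Good (I : Ideal R) (g l s : ℕ) (a : Ideal R) : Prop where
  le : a ≤ I
  gen : ∃ f : Finset R, f.card ≤ s ∧ Ideal.span (f : Set R) = a
  hA : ∀ p : Ideal R, p.IsPrime → I ≤ p → ∀ h : ℕ, p.height = h → h < l →
    ∃ T : Finset R, (T : Set R) ⊆ I ∧ T.card ≤ h - s ∧ ¬ col (a ⊔ Ideal.span (T : Set R)) I ≤ p
  hB : ∀ q : Ideal R, q.IsPrime → col a I ≤ q → (s : ℕ∞) ≤ q.height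
  pureI : ∀ q, AssP I a q → q.height ≤ s
  reg : s ≤ g → RegIn I s ⊥ a

lemma le_col {a I : Ideal R} : a ≤ col a I := fun x hx => mem_col.2 fun i hi => a.mul_mem_right _ hx

lemma col_mono {a b I : Ideal R} (h : a ≤ b) : col a I ≤ col b I :=
  fun x hx => mem_col.2 fun i hi => h (mem_col.1 hx i hi)

lemma assP_col {a I q : Ideal R} (h : AssP ⊤ (col a I) q) : AssP I a q := by
  obtain ⟨hq, u, -, hu⟩ := h
  obtain ⟨F, hF⟩ := (IsNoetherian.noetherian I : I.FG)
  have key : ∃ f ∈ F, ∀ r, r * (u * f) ∈ a → r ∈ q := by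
    by_contra hc
    push Not at hc
    choose! r hr hr2 using hc
    have h1 : ∏ f ∈ F, r f ∈ q := by
      rw [hu, mem_col]
      have : I ≤ col a (Ideal.span {(∏ f ∈ F, r f) * u}) := by
        rw [← hF, Ideal.submodule_span_eq, Ideal.span_le]
        intro i hi
        rw [SetLike.mem_coe, mem_col]
        intro z hz
        obtain ⟨c, rfl⟩ := Ideal.mem_span_singleton.1 hz
        obtain ⟨b, hb⟩ : r i ∣ ∏ i ∈ F, r i := Finset.dvd_prod_of_mem r hi
        have := a.mul_mem_left (b * c) (hr i hi)
        rw [hb]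
        convert this using 1; ring
      intro i hi
      have := mem_col.1 (this hi) _ (Ideal.mem_span_singleton_self _)
      rwa [mul_comm]
    rw [hq.prod_mem_iff] at h1
    obtain ⟨f, hf, h2⟩ := h1
    exact hr2 f hf h2
  obtain ⟨f, hf, h1⟩ := key
  have hfI : f ∈ I := hF ▸ Submodule.subset_span hf
  refine ⟨hq, u * f, I.mul_mem_left _ hfI, fun r => ⟨fun hr => ?_, h1 r⟩⟩
  rw [hu, mem_col] at hr
  rw [← mul_assoc]
  exact hr f hfI

lemma Good.not_le {I a : Ideal R} {g l s : ℕ} (h : Good I g l s a) (hs : s < l) {q : Ideal R}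
    (hq : q.IsPrime) (hI : I ≤ q) (hK : col a I ≤ q) : ((s + 1 : ℕ) : ℕ∞) ≤ q.height := by
  obtain ⟨k, hk⟩ := height_coe q
  rw [hk]
  by_contra hc
  have hc' : k < s + 1 := by
    by_contra h; exact hc (by exact_mod_cast not_lt.1 h)
  obtain ⟨T, hT, hT2, hT3⟩ := h.hA q hq hI k hk (by omega)
  have : T = ∅ := Finset.card_eq_zero.1 (by omega)
  subst this
  simp at hT3
  exact hT3 hK

lemma Good.ass {I a : Ideal R} {g l s : ℕ} (h : Good I g l s a) (hs : s < l) {q : Ideal R}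
    (hq : AssP ⊤ (col a I) q) : ¬ I ≤ q := by
  intro hI
  have h1 := h.pureI q (assP_col hq)
  have h2 := (h.not_le hs hq.1 hI hq.le).trans h1
  have : s + 1 ≤ s := by exact_mod_cast h2
  omega

lemma Good.inter {I a : Ideal R} {g l s : ℕ} (h : Good I g l s a) (hs : s < l) :
    col a I ⊓ I ≤ a := by
  intro u hu
  by_contra hua
  obtain ⟨q, hq, hq2⟩ := exists_assP hu hua
  obtain ⟨hqp, v, hv, hv2⟩ := hq
  have hI : I ≤ q := fun i hi => (hv2 i).2 (by rw [mul_comm]; exact mem_col.1 hv.1 i hi)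
  have hK : col a I ≤ q := fun i hi => (hv2 i).2 (mem_col.1 hi _ hv.2)
  have h1 := h.pureI q ⟨hqp, v, hv.2, hv2⟩
  have h2 := (h.not_le hs hqp hI hK).trans h1
  have : s + 1 ≤ s := by exact_mod_cast h2
  omega

variable {I : Ideal R} {g l d : ℕ}

lemma Amb.gd (H : Amb I g l d) : g ≤ d := by
  have := (H.hg (maximalIdeal R) inferInstance H.hI).trans (H.cm.height_le_d Ideal.IsPrime.ne_top')
  exact_mod_cast this

lemma Good.K_eq (H : Amb I g l d) {a : Ideal R} {s : ℕ} (h : Good I g l s a) (hs : s < g) :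
    col a I = a := by
  refine le_antisymm ?_ le_col
  intro z hz
  by_contra hza
  obtain ⟨q, hq, hq2⟩ := exists_assP (A := ⊤) trivial hza
  have hI : I ≤ q := fun i hi => hq2 i (by rw [mul_comm]; exact mem_col.1 hz i hi)
  have h1 := H.cm.height_le H.hI (by have := H.gd; omega) (h.reg hs.le) hq
  have h2 := (H.hg q hq.1 hI).trans h1
  have : g ≤ s := by exact_mod_cast h2
  omega

lemma Good.U (H : Amb I g l d) {a : Ideal R} {s : ℕ} (h : Good I g l s a) (hs : s < l) {x : R}
    (hxI : x ∈ I) (hx : Reg ⊤ (col a I) x) {q : Ideal R} 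
    (hq : AssP ⊤ (col a I ⊔ Ideal.span {x}) q) : q.height ≤ (s + 1 : ℕ) := by
  have hqp := hq.1
  rcases lt_or_ge s g with hsg | hsg
  · rw [h.K_eq H hsg] at hq hx
    exact H.cm.height_le (n := s + 1) H.hI (by have := H.gd; omega) ⟨a, h.reg hsg.le, x, hxI, hx, rfl⟩ hq
  · have hKq : col a I ≤ q := le_sup_left.trans hq.le
    have hgeo : IsGeometricRI I (col a I) s := by
      refine ⟨⟨fun h => hqp.ne_top (top_le_iff.1 (h ▸ hKq)), ?_, ?_, a, h.le, h.gen, rfl⟩, ?_⟩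
      · rw [H.hgI]; exact_mod_cast hsg
      · exact ht_ge_iff.2 h.hB
      · have : ((s + 1 : ℕ) : WithBot ℕ∞) ≤ ht (I ⊔ col a I) := ht_ge_iff.2 fun q hq hle => 
          h.not_le hs hq (le_sup_left.trans hle) (le_sup_right.trans hle)
        exact_mod_cast this
    have hd := H.hS s hs _ hgeo q x hx hq
    obtain ⟨P, hP, hPq⟩ := Ideal.exists_minimalPrimes_le hKq
    have hPp := hP.1.1
    have hP1 := h.pureI P (assP_col (assP_of_minimalPrimes hP))
    obtain ⟨b, hb⟩ := height_coe P
    have hdP : ringKrullDim (Lp q ⧸ mp q P) ≤ 1 := by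
      refine le_trans ?_ hd
      exact ringKrullDim_le_of_surjective (Ideal.Quotient.factor (Ideal.map_mono hP.1.2))
        (Ideal.Quotient.factor_surjective _)
    have h3 := H.cm.cat hPq hb hdP
    rw [hb] at hP1
    refine h3.trans ?_
    have : b ≤ s := by exact_mod_cast hP1
    exact_mod_cast Nat.succ_le_succ this

lemma Good.base (H : Amb I g l d) : Good I g l 0 ⊥ where
  le := bot_le
  gen := ⟨∅, by simp, by simp⟩
  hA := by
    intro p hp hI h hh hl
    obtain ⟨T, hT⟩ := H.hG p hp hI h hh hl
    exact ⟨T, by simpa using hT⟩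
  hB := by simp
  pureI := fun q hq => H.cm.height_le H.hI (Nat.zero_le _) (rfl : RegIn I 0 ⊥ ⊥) (hq.mono le_top)
  reg := fun _ => rfl

end A10
end Part10

section Part11
set_option linter.all false

section A11
variable {R : Type u} [CommRing R] [IsLocalRing R] [IsNoetherianRing R]
variable {I : Ideal R} {g l d : ℕ}

lemma IsReduction.le_prime {J I q : Ideal R} (hJ : IsReduction J I) (hq : q.IsPrime) (h : J ≤ q) : I ≤ q := by
  obtain ⟨_, r, hr⟩ := hJ
  apply hq.le_of_pow_le (n := r + 1)
  rw [hr]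
  exact Ideal.mul_le_left.trans h

open Classical in
/-- the ideal to be avoided at `p` -/
noncomputable def Xp (I a p : Ideal R) : Ideal R :=
  if hp : p.IsPrime then Ideal.comap (toL p) (mp p (p * I ⊔ a)) else ⊥

lemma Xp_eq {I a p : Ideal R} [hp : p.IsPrime] : Xp I a p = Ideal.comap (toL p) (mp p (p * I ⊔ a)) := by
  rw [Xp, dif_pos hp]

lemma mem_Xp {I a p : Ideal R} [hp : p.IsPrime] {x : R} : x ∈ Xp I a p ↔ ∃ s, s ∉ p ∧ s * x ∈ p * I ⊔ a := by
  rw [Xp_eq, Ideal.mem_comap, loc_mem]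

lemma Xp_red {I a p : Ideal R} [hp : p.IsPrime] (haI : a ≤ I)
    (hI : ∀ q, AssP ⊤ (col a I) q → ¬ I ≤ q) (hK : col a I ≤ p)
    {J : Ideal R} (hJ : IsReduction J I) : ¬ J ≤ Xp I a p := by
  intro hle
  obtain ⟨P, hP, hPp⟩ := Ideal.exists_minimalPrimes_le hK
  have hPI := hI P (assP_of_minimalPrimes hP)
  have hPp' := hP.1.1
  apply hPI
  obtain ⟨hJI, r, hr⟩ := hJ
  have h1 : mp p J ≤ mp p (p * I ⊔ a) := by
    rw [Xp_eq] at hle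
    exact Ideal.map_le_iff_le_comap.2 hle
  have h2 : mp p (I ^ (r + 1)) ≤ mp p P ⊔ maximalIdeal (Lp p) * mp p (I ^ (r+1)) := by
    conv_lhs => rw [hr]
    rw [mp, Ideal.map_mul]
    refine (Ideal.mul_mono_left h1).trans ?_
    rw [mp, Ideal.map_sup, Ideal.map_mul, Ideal.sup_mul]
    refine sup_le ?_ ?_
    · refine le_sup_of_le_right ?_
      rw [show Ideal.map (algebraMap R (Localization.AtPrime p)) p = _ from mp_self_max, mul_assoc, mp, ← Ideal.map_mul, ← pow_succ']
    · refine le_sup_of_le_left ?_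
      refine Ideal.mul_le_left.trans (Ideal.map_mono ?_)
      exact le_col.trans hP.1.2
  have h3 := nakayama h2
  apply hPp'.le_of_pow_le (n := r + 1)
  intro x hx
  obtain ⟨s, hs, hs2⟩ := loc_le.1 h3 x hx
  exact (hPp'.mem_or_mem hs2).resolve_left (fun h => hs (hPp h))

open Classical in
lemma exchange {I a p : Ideal R} [hp : p.IsPrime] {T : Finset R} (hT : (T : Set R) ⊆ I) (hTn : 
    ¬ col (a ⊔ Ideal.span (T : Set R)) I ≤ p) {x : R} (hxI : x ∈ I) (hx : x ∉ Xp I a p) :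
    ∃ T' : Finset R, (T' : Set R) ⊆ I ∧ T'.card + 1 = T.card ∧
     ¬ col ((a ⊔ Ideal.span {x}) ⊔ Ideal.span (T' : Set R)) I ≤ p := by
  obtain ⟨σ, hσ, hσp⟩ := SetLike.not_le_iff_exists.1 hTn
  obtain ⟨α, hα, β, hβ, hαβ⟩ := Submodule.mem_sup.1 (mem_col.1 hσ x hxI)
  obtain ⟨c, -, hc⟩ := Submodule.mem_span_finset.1 (show β ∈ Submodule.span R (T : Set R) from hβ)
  have h1 : ∃ t ∈ T, c t ∉ p := by
    by_contra hcon
    push Not at hcon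
    apply hx
    rw [mem_Xp]
    refine ⟨σ, hσp, ?_⟩
    rw [← hαβ, add_comm]
    refine Ideal.add_mem _ (Ideal.mem_sup_left ?_) (Ideal.mem_sup_right hα)
    rw [← hc]
    exact Ideal.sum_mem _ fun t ht => Ideal.mul_mem_mul (hcon t ht) (hT ht)
  obtain ⟨t, ht, htp⟩ := h1
  refine ⟨T.erase t, fun z hz => hT (Finset.mem_of_mem_erase hz), Finset.card_erase_add_one ht, ?_⟩
  set b := (a ⊔ Ideal.span {x}) ⊔ Ideal.span (T.erase t : Set R) with hb
  have hab : a ≤ b := le_sup_left.trans le_sup_left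
  have hTb : ∀ s ∈ T, s ≠ t → s ∈ b := fun s hs hst => 
    (le_sup_right (a := a ⊔ Ideal.span {x})) (Ideal.subset_span (by simp [hs, hst]))
  have hxb : x ∈ b := (le_sup_left.trans' le_sup_right : Ideal.span {x} ≤ b) (Ideal.mem_span_singleton_self x)
  have htb : c t * t ∈ b := by
    have h2 : c t * t + ∑ s ∈ T.erase t, c s * s = β := by
      rw [← hc, Finset.add_sum_erase T (fun s => c s * s) ht]; rfl
    have h3 : c t * t = σ * x - α - ∑ s ∈ T.erase t, c s * s := by
      rw [← hαβ, ← h2]; ring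
    rw [h3]
    refine b.sub_mem (b.sub_mem (b.mul_mem_left _ hxb) (hab hα)) (b.sum_mem fun s hs => b.mul_mem_left _ ?_)
    exact hTb s (Finset.mem_of_mem_erase hs) (Finset.ne_of_mem_erase hs)
  intro hle
  have : c t * σ ∈ p := hle (by
    rw [mem_col]
    intro i hi
    have h4 := mem_col.1 hσ i hi
    have h5 : a ⊔ Ideal.span (T : Set R) ≤ col b (Ideal.span {c t}) := by
      refine sup_le (fun z hz => mem_col.2 fun w hw => b.mul_mem_right _ (hab hz)) ?_
      rw [Ideal.span_le]
      intro s hs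
      rw [SetLike.mem_coe, mem_col]
      intro w hw
      obtain ⟨w, rfl⟩ := Ideal.mem_span_singleton.1 hw
      by_cases hst : s = t
      · subst hst
        have := b.mul_mem_left w htb
        convert this using 1; ring
      · exact b.mul_mem_right _ (hTb s hs hst)
    have := mem_col.1 (h5 h4) _ (Ideal.mem_span_singleton_self _)
    convert this using 1; ring)
  exact (hp.mem_or_mem this).elim htp hσp

/-- sup of the residual ideals -/
noncomputable def FF (I a : Ideal R) (k : ℕ) : Ideal R :=
  ⨆ (T : Finset R) (_ : (T : Set R) ⊆ I ∧ T.card ≤ k), col (a ⊔ Ideal.span (T : Set R)) I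

lemma FF_le {I a p : Ideal R} {k : ℕ} : FF I a k ≤ p ↔ ∀ T : Finset R, (T : Set R) ⊆ I → T.card ≤ k →
    col (a ⊔ Ideal.span (T : Set R)) I ≤ p := by
  simp [FF, iSup_le_iff]

open Classical in
theorem Good.step (H : Amb I g l d) {a : Ideal R} {s : ℕ} (h : Good I g l s a) (hs : s < l) :
    ∃ XX : Set (Ideal R), XX.Finite ∧ (∀ X ∈ XX, ∀ J, IsReduction J I → ¬ J ≤ X) ∧
      ∀ x ∈ I, (∀ X ∈ XX, x ∉ X) → Good I g l (s + 1) (a ⊔ Ideal.span {x}) := by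
  let PP : Set (Ideal R) := {p | (∃ k, k < l ∧ p ∈ (FF I a (k - s - 1) ⊔ I).minimalPrimes) ∧ col a I ≤ p}
  have hPP : PP.Finite := by
    have : PP ⊆ ⋃ k ∈ Set.Iio l, (FF I a (k - s - 1) ⊔ I).minimalPrimes := by
      rintro p ⟨⟨k, hk, hp⟩, -⟩
      simp only [Set.mem_iUnion]
      exact ⟨k, hk, hp⟩
    refine Set.Finite.subset ?_ this
    exact (Set.finite_Iio l).biUnion fun k _ => Ideal.finite_minimalPrimes_of_isNoetherianRing R _
  refine ⟨{q | AssP ⊤ (col a I) q} ∪ (Xp I a) '' PP, (assP_finite _ _).union (hPP.image _), ?_, ?_⟩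
  · rintro X (hX | ⟨p, ⟨⟨k, hk, hp⟩, hKp⟩, rfl⟩) J hJ
    · exact fun hle => h.ass hs hX (hJ.le_prime hX.1 hle)
    · have := hp.1.1
      exact Xp_red h.le (fun q hq => h.ass hs hq) hKp hJ
  intro x hxI hx
  have hxreg : Reg ⊤ (col a I) x := reg_of_avoid fun q hq => hx q (Or.inl hq)
  set a' := a ⊔ Ideal.span {x} with ha'
  have hA : ∀ p : Ideal R, p.IsPrime → I ≤ p → ∀ h : ℕ, p.height = h → h < l →
    ∃ T : Finset R, (T : Set R) ⊆ I ∧ T.card ≤ h - (s + 1) ∧ ¬ col (a' ⊔ Ideal.span (T : Set R)) I ≤ p := by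
    intro p hp hIp k hk hkl
    by_cases hKp : col a I ≤ p
    swap
    · refine ⟨∅, by simp, by simp, fun hle => hKp (le_trans (col_mono ?_) hle)⟩
      exact le_sup_left.trans le_sup_left
    have hks : s + 1 ≤ k := by
      have := h.not_le hs hp hIp hKp
      rw [hk] at this
      exact_mod_cast this
    by_cases hF : FF I a (k - s - 1) ≤ p
    swap
    · rw [FF_le] at hF
      push Not at hF
      obtain ⟨T, hT1, hT2, hT3⟩ := hF
      refine ⟨T, hT1, by omega, fun hle => hT3 (le_trans (col_mono ?_) hle)⟩
      exact sup_le_sup_right le_sup_left _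
    have hpPP : p ∈ PP := by
      refine ⟨⟨k, hkl, ⟨⟨hp, sup_le hF hIp⟩, ?_⟩⟩, hKp⟩
      rintro q ⟨hq, hq2⟩ hqp
      have hqp' : q ≤ p := hqp
      rcases hqp'.lt_or_eq with hlt | heq
      · exfalso
        obtain ⟨k', hk'⟩ := height_coe q
        have h1 := Ideal.height_add_one_le_of_lt_of_isPrime hlt
        rw [hk, hk'] at h1
        have h2 : k' + 1 ≤ k := by exact_mod_cast h1
        obtain ⟨T, hT1, hT2, hT3⟩ := h.hA q hq (le_sup_right.trans hq2) k' hk' (by omega)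
        exact hT3 (FF_le.1 (le_sup_left.trans hq2) T hT1 (by omega))
      · exact heq.ge
    obtain ⟨T, hT1, hT2, hT3⟩ := h.hA p hp hIp k hk hkl
    obtain ⟨T', hT'1, hT'2, hT'3⟩ := exchange hT1 hT3 hxI (hx _ (Or.inr ⟨p, hpPP, rfl⟩))
    exact ⟨T', hT'1, by omega, hT'3⟩
  have hle' : a' ≤ I := sup_le h.le ((Ideal.span_singleton_le_iff_mem _).2 hxI)
  refine ⟨hle', ?_, hA, ?_, ?_, ?_⟩
  · obtain ⟨f, hf, rfl⟩ := h.gen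
    refine ⟨insert x f, (Finset.card_insert_le _ _).trans (by omega), ?_⟩
    rw [Finset.coe_insert, Ideal.span_insert, sup_comm]
  · intro q hq hKq
    obtain ⟨k, hk⟩ := height_coe q
    by_cases hIq : I ≤ q
    · rw [hk]
      by_contra hc
      have hc' : k < s + 1 := by
        by_contra h; exact hc (by exact_mod_cast not_lt.1 h)
      obtain ⟨T, hT, hT2, hT3⟩ := hA q hq hIq k hk (by omega)
      have : T = ∅ := Finset.card_eq_zero.1 (by omega)
      subst this
      simp at hT3
      exact hT3 hKq
    · obtain ⟨i, hi, hiq⟩ := SetLike.not_le_iff_exists.1 hIq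
      have hKle : col a I ≤ q := (col_mono le_sup_left).trans hKq
      have hxq : x ∈ q := hKq (le_col (Ideal.mem_sup_right (Ideal.mem_span_singleton_self x)))
      obtain ⟨P, hP, hPq⟩ := Ideal.exists_minimalPrimes_le hKle
      have hPp := hP.1.1
      have hxP : x ∉ P := hxreg.notMem (assP_of_minimalPrimes hP)
      have hlt : P < q := lt_of_le_of_ne hPq (fun h => hxP (h ▸ hxq))
      have := h.hB P hPp hP.1.2
      push_cast
      exact (add_le_add_left this 1).trans (Ideal.height_add_one_le_of_lt_of_isPrime hlt)
  · intro q hq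
    refine h.U H hs hxI hxreg (q := q) ?_
    obtain ⟨hqp, u, hu, hu2⟩ := hq
    refine ⟨hqp, u, trivial, fun r => (hu2 r).trans ⟨fun hr => ?_, fun hr => ?_⟩⟩
    · exact (sup_le_sup_right (le_col : a ≤ col a I) (Ideal.span {x}) : _) hr
    · obtain ⟨c, hc⟩ := mem_sup_span.1 hr
      refine mem_sup_span.2 ⟨c, h.inter hs ⟨hc, ?_⟩⟩
      exact I.sub_mem (I.mul_mem_left _ hu) (I.mul_mem_right _ hxI)
  · intro hsg
    refine ⟨a, h.reg (by omega), x, hxI, ?_, rfl⟩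
    rwa [h.K_eq H (by omega)] at hxreg

end A11
end Part11

section Part12
set_option linter.all false

section A12

lemma wb_succ {a : WithBot ℕ∞} {n : ℕ} (h : ¬ a ≤ n) : ((n + 1 : ℕ) : WithBot ℕ∞) ≤ a := by
  induction a using WithBot.recBotCoe with
  | bot => exact absurd bot_le h
  | coe x =>
    have h1 : ¬ x ≤ (n : ℕ∞) := fun h2 => h (by exact_mod_cast h2)
    have := Order.add_one_le_of_lt (not_le.1 h1)
    exact_mod_cast this

lemma S2_dim {S : Type u} [CommRing S] [IsNoetherianRing S] {K : Ideal S} (hK : QuotS2 K) (q : Ideal S) [hq : q.IsPrime]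
    (x : S) (hx : Reg ⊤ K x) (hA : AssP ⊤ (K ⊔ Ideal.span {x}) q) : 
    ringKrullDim (Lp q ⧸ mp q K) ≤ 1 := by
  by_contra hc
  have hKq : K ≤ q := le_sup_left.trans hA.le
  have hxq : x ∈ q := hA.le (Ideal.mem_sup_right (Ideal.mem_span_singleton_self x))
  have h2 : (2 : WithBot ℕ∞) ≤ ringKrullDim (Lp q ⧸ mp q K) := by
    exact_mod_cast wb_succ (n := 1) (by exact_mod_cast hc)
  have h3 := hK q hq hKq
  rw [rDim, min_eq_left h2] at h3
  have h4 : ((2 : ℕ) : ℕ∞) ≤ qDepth (Lp q) (mp q K) := WithBot.coe_le_coe.1 (by exact h3)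
  have h5 := DD_of_qDepth h4
  have hreg := loc_reg (p := q) hx
  rw [mp, Ideal.map_top] at hreg
  have hxm : toL q x ∈ maximalIdeal (Lp q) := by
    rw [← mp_self_max]; exact Ideal.mem_map_of_mem _ hxq
  have h6 := DD.drop (n := 1) h5 hxm hreg
  have h7 := loc_assP hA (le_refl q)
  rw [mp, Ideal.map_top, mp_self_max, mp, Ideal.map_sup, Ideal.map_span, Set.image_singleton] at h7
  rw [Ideal.mul_top] at h6
  exact (DD.soc0 (n := 0) h6).not_le h7 le_rfl

variable {R S : Type u} [CommRing R] [CommRing S]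

lemma em_mem (e : R ≃+* S) {C : Ideal R} {x : R} : e x ∈ Ideal.map e C ↔ x ∈ C := by
  rw [Ideal.mem_map_of_equiv]
  constructor
  · rintro ⟨y, hy, h⟩; rwa [← e.injective h]
  · exact fun h => ⟨x, h, rfl⟩

lemma ht_map (e : R ≃+* S) {C : Ideal R} {n : ℕ} (h : (n : WithBot ℕ∞) ≤ ht C) :
    (n : WithBot ℕ∞) ≤ ht (Ideal.map e C) := by
  rw [ht_ge_iff] at h ⊢
  intro q hq hle
  rw [← RingEquiv.height_comap e]
  exact h _ (hq.comap _) (Ideal.map_le_iff_le_comap.1 hle)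

lemma ht_map' (e : R ≃+* S) {C : Ideal R} {n : ℕ} (h : ht C ≤ n) :
    ht (Ideal.map e C) ≤ n := by
  by_contra hc
  have h1 : ((n + 1 : ℕ) : WithBot ℕ∞) ≤ ht (Ideal.map e C) := by
    exact wb_succ hc
  have h2 := ht_map e.symm h1
  have h3 : Ideal.map e.symm (Ideal.map e C) = C := Ideal.map_of_equiv e
  rw [h3] at h2
  have : n + 1 ≤ n := by exact_mod_cast h2.trans h
  omega

open Classical in
lemma geo_map (e : R ≃+* S) {I K : Ideal R} {s : ℕ} (h : IsGeometricRI I K s) :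
    IsGeometricRI (Ideal.map e I) (Ideal.map e K) s := by
  obtain ⟨⟨h1, h2, h3, a, h4, ⟨f, h5, h6⟩, h7⟩, h8⟩ := h
  refine ⟨⟨?_, ht_map' e h2, ht_map e h3, Ideal.map e a, Ideal.map_mono h4, ⟨f.image e, ?_, ?_⟩, ?_⟩, ?_⟩
  · intro h
    apply h1
    rw [Ideal.eq_top_iff_one] at h ⊢
    rwa [← map_one e, em_mem] at h
  · exact Finset.card_image_le.trans h5
  · rw [← h6, Ideal.map_span, Finset.coe_image]
  · ext z
    obtain ⟨x, rfl⟩ := e.surjective z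
    rw [em_mem, h7, mem_col, mem_col]
    constructor
    · intro h i hi
      obtain ⟨i, rfl⟩ := e.surjective i
      rw [em_mem] at hi
      rw [← map_mul, em_mem]
      exact h i hi
    · intro h i hi
      have := h _ ((em_mem e).2 hi)
      rwa [← map_mul, em_mem] at this
  · rw [← Ideal.map_sup]
    have := ht_map e (n := s + 1) (by exact_mod_cast h8)
    exact_mod_cast this

lemma dim_map (e : R ≃+* S) {K q : Ideal R} [hq : q.IsPrime] [hq' : (Ideal.map e q).IsPrime] :
    ringKrullDim (Lp q ⧸ mp q K) = ringKrullDim (Lp (Ideal.map e q) ⧸ mp (Ideal.map e q) (Ideal.map e K)) := by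
  have H : Submonoid.map e.toMonoidHom q.primeCompl = (Ideal.map e q).primeCompl := by
    ext z
    obtain ⟨x, rfl⟩ := e.surjective z
    constructor
    · rintro ⟨y, hy, h⟩
      have : y = x := e.injective h
      subst this
      exact fun h => hy ((em_mem e).1 h)
    · intro h
      exact ⟨x, fun h' => h ((em_mem e).2 h'), rfl⟩
  let E : Lp q ≃+* Lp (Ideal.map e q) := IsLocalization.ringEquivOfRingEquiv _ _ e H
  refine ringKrullDim_eq_of_ringEquiv (Ideal.quotientEquiv _ _ E ?_)
  rw [mp, mp, Ideal.map_map]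
  change Ideal.map _ (Ideal.map (e : R →+* S) K) = _
  rw [Ideal.map_map]
  congr 1
  ext x
  exact (IsLocalization.ringEquivOfRingEquiv_eq H x).symm

lemma assP_map (e : R ≃+* S) {A B q : Ideal R} (h : AssP A B q) :
    AssP (Ideal.map e A) (Ideal.map e B) (Ideal.map e q) := by
  obtain ⟨hq, u, hu, h2⟩ := h
  refine ⟨Ideal.map_isPrime_of_equiv e, e u, (em_mem e).2 hu, fun r => ?_⟩
  obtain ⟨r, rfl⟩ := e.surjective r
  rw [← map_mul, em_mem, em_mem]
  exact h2 r

lemma reg_map (e : R ≃+* S) {A B : Ideal R} {x : R} (h : Reg A B x) :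
    Reg (Ideal.map e A) (Ideal.map e B) (e x) := by
  intro u hu hxu
  obtain ⟨u, rfl⟩ := e.surjective u
  rw [← map_mul, em_mem] at hxu
  rw [em_mem] at hu ⊢
  exact h u hu hxu

lemma S2_transfer [IsNoetherianRing R] (e : R ≃+* S) {I : Ideal R} {s : ℕ} (h : WeaklyResS2 (Ideal.map e I) s) :
    ∀ i ≤ s, ∀ K, IsGeometricRI I K i → ∀ (q : Ideal R) [q.IsPrime] (x : R), Reg ⊤ K x →
    AssP ⊤ (K ⊔ Ideal.span {x}) q → ringKrullDim (Lp q ⧸ mp q K) ≤ 1 := by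
  intro i hi K hK q hq x hx hA
  have : IsNoetherianRing S := isNoetherianRing_of_ringEquiv R e
  have h1 := h i hi _ (geo_map e hK)
  have h2 := assP_map e hA
  have h3 := reg_map e hx
  rw [Ideal.map_top] at h2 h3
  rw [Ideal.map_sup, Ideal.map_span, Set.image_singleton] at h2
  have := h2.1
  rw [dim_map e]
  exact S2_dim h1 _ _ h3 h2

lemma S2_of_univ [IsNoetherianRing R] [IsLocalRing R] {I : Ideal R} {s : ℕ} (h : UnivWeaklyResS2 I s) :
    ∀ i ≤ s, ∀ K, IsGeometricRI I K i → ∀ (q : Ideal R) [q.IsPrime] (x : R), Reg ⊤ K x →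
    AssP ⊤ (K ⊔ Ideal.span {x}) q → ringKrullDim (Lp q ⧸ mp q K) ≤ 1 := by
  let e0 : R ≃+* MvPolynomial (Fin 0) R := (MvPolynomial.isEmptyRingEquiv R (Fin 0)).symm
  have he0 : (e0 : R →+* MvPolynomial (Fin 0) R) = MvPolynomial.C := by
    ext x : 1
    apply (MvPolynomial.isEmptyRingEquiv R (Fin 0)).injective
    simp [e0]
  set P := Ideal.map (MvPolynomial.C (σ := Fin 0)) (maximalIdeal R) with hP
  have hPe : P = Ideal.map e0 (maximalIdeal R) := by rw [hP, ← he0]; rfl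
  have hPp : P.IsPrime := by rw [hPe]; exact Ideal.map_isPrime_of_equiv e0
  have hu : P.primeCompl ≤ IsUnit.submonoid _ := by
    intro z hz
    obtain ⟨x, rfl⟩ := e0.surjective z
    have : x ∉ maximalIdeal R := fun hx => hz (by rw [hPe]; exact (em_mem e0).2 hx)
    have hx : IsUnit x := by simpa using this
    exact hx.map e0
  let e1 := (IsLocalization.atUnits (MvPolynomial (Fin 0) R) P.primeCompl (S := Localization.AtPrime P) hu).toRingEquiv
  have he1 : ∀ x, e1 x = algebraMap _ _ x := fun x => 
    (IsLocalization.atUnits (MvPolynomial (Fin 0) R) P.primeCompl (S := Localization.AtPrime P) hu).commutes x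
  refine S2_transfer (e0.trans e1) (s := s) ?_
  have h1 := h 0 hPp
  convert h1 using 1
  change Ideal.map ((e0.trans e1 : R ≃+* Localization.AtPrime P) : R →+* Localization.AtPrime P) I = _
  congr 1

open Classical in
lemma G_elem [IsNoetherianRing R] {I : Ideal R} {l : ℕ} (hG : Gcond I l) :
    ∀ p : Ideal R, p.IsPrime → I ≤ p → ∀ h : ℕ, p.height = h → h < l →
    ∃ T : Finset R, (T : Set R) ⊆ I ∧ T.card ≤ h ∧ ¬ col (Ideal.span (T : Set R)) I ≤ p := by
  intro p hp hI h hh hl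
  have h1 := hG ⟨p, hp⟩ hI (by
    change rDim (Lp p) < _
    rw [rDim_loc, hh]; exact_mod_cast hl)
  have h2 : muE (mp p I) ≤ (h : ℕ∞) := by
    change ((muE (mp p I) : ℕ∞) : WithBot ℕ∞) ≤ rDim (Lp p) at h1
    rw [rDim_loc, hh] at h1
    exact_mod_cast h1
  obtain ⟨m, hm⟩ := ENat.ne_top_iff_exists.1 (ne_top_of_le_ne_top (ENat.coe_ne_top h) h2)
  rw [← hm] at h2
  have hmh : m ≤ h := by exact_mod_cast h2
  obtain ⟨s, hs1, hs2⟩ := muE_one hm.symm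
  have key : ∀ z ∈ s, ∃ t ∈ I, ∃ w, IsUnit w ∧ toL p t = w * z := by
    intro z hz
    obtain ⟨x, w, hw, rfl⟩ := loc_rep z
    have hxI : w * toL p x ∈ mp p I := hs2 ▸ Submodule.subset_span hz
    rw [unit_mul_mem hw] at hxI
    obtain ⟨σ, hσ, hσ2⟩ := loc_mem.1 hxI
    obtain ⟨w, rfl⟩ := hw
    refine ⟨σ * x, hσ2, toL p σ * ↑w⁻¹, (loc_unit hσ).mul (Units.isUnit _), ?_⟩
    rw [map_mul, mul_assoc, Units.inv_mul_cancel_left]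
  choose! t ht w hw htw using key
  refine ⟨s.image t, ?_, Finset.card_image_le.trans (by omega), ?_⟩
  · intro z hz
    simp only [Finset.coe_image, Set.mem_image] at hz
    obtain ⟨y, hy, rfl⟩ := hz
    exact ht y hy
  · intro hle
    have h3 : mp p I ≤ mp p (Ideal.span (s.image t : Set R)) := by
      rw [← hs2, Submodule.span_le]
      intro z hz
      rw [SetLike.mem_coe, ← unit_mul_mem (hw z hz), ← htw z hz]
      exact Ideal.mem_map_of_mem _ (Ideal.subset_span (by simpa using ⟨z, hz, rfl⟩))
    have h4 : (1 : Lp p) ∈ mp p (col (Ideal.span (s.image t : Set R)) I) := by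
      rw [loc_colon, mem_col]
      intro i hi
      rw [one_mul]; exact h3 hi
    rw [← map_one (toL p)] at h4
    obtain ⟨σ, hσ, h5⟩ := loc_mem.1 h4
    rw [mul_one] at h5
    exact hσ (hle h5)

theorem Amb.of [IsNoetherianRing R] [IsLocalRing R] (hCM : IsCMLocalRing R) 
    (I : Ideal R) (g l : ℕ) (hg : ht I = (g : WithBot ℕ∞)) 
    (hG : Gcond I l) (hS2 : UnivWeaklyResS2 I (l - 1)) : ∃ d, Amb I g l d := by
  obtain ⟨d, hd⟩ := CMd.of hCM
  exact ⟨d, hd, IsLocalRing.le_maximalIdeal (ne_top_of_ht hg), ht_ge_iff.1 hg.ge, G_elem hG, hg, 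
    fun s hs => S2_of_univ hS2 s (by omega)⟩

end A12
end Part12

section Part13
set_option linter.all false

section A13

lemma dim_le_of_integral {A : Type u} {B : Type v} [CommRing A] [CommRing B] (f : A →+* B) (hf : f.IsIntegral) :
    ringKrullDim B ≤ ringKrullDim A := by
  letI := f.toAlgebra
  haveI : Algebra.IsIntegral A B := ⟨hf⟩
  refine Order.krullDim_le_of_strictMono (PrimeSpectrum.comap f) ?_
  intro p q h
  exact Ideal.IsIntegral.comap_lt_comap (R := A) (I := p.asIdeal) (J := q.asIdeal) h

lemma dim_ge_of_integral {A : Type u} {B : Type v} [CommRing A] [CommRing B] (f : A →+* B) (hf : f.IsIntegral)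
    (hi : Function.Injective f) : ringKrullDim A ≤ ringKrullDim B := by
  letI := f.toAlgebra
  haveI : Algebra.IsIntegral A B := ⟨hf⟩
  unfold ringKrullDim Order.krullDim
  refine iSup_le fun l => ?_
  obtain ⟨Q, -, hQ, hQ2⟩ := Ideal.exists_ideal_over_prime_of_isIntegral (RelSeries.head l).asIdeal (⊥ : Ideal B)
    (by
      intro x hx
      have : f x = 0 := hx
      rw [(injective_iff_map_eq_zero f).1 hi x this]; exact Ideal.zero_mem _)
  haveI : Q.LiesOver (RelSeries.head l).asIdeal := ⟨hQ2.symm⟩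
  obtain ⟨L, hL, -⟩ := Ideal.exists_ltSeries_of_hasGoingUp l Q
  exact le_iSup_of_le L (by rw [hL])

variable {R : Type u} [CommRing R]

noncomputable def tt (I : Ideal R) {x : R} {n : ℕ} (hx : x ∈ I ^ n) : reesAlgebra I :=
  ⟨Polynomial.monomial n x, reesAlgebra.monomial_mem.2 hx⟩

open MvPolynomial in
noncomputable def Phi (I : Ideal R) {σ : Type} (a : σ → R) (ha : ∀ i, a i ∈ I) :
    MvPolynomial σ R →ₐ[R] reesAlgebra I :=
  aeval fun i => tt I (n := 1) (by simpa using ha i)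

open MvPolynomial in
lemma Phi_coeff (I : Ideal R) {σ : Type} (a : σ → R) (ha : ∀ i, a i ∈ I) (f : MvPolynomial σ R) (D : ℕ) :
    ((Phi I a ha f : reesAlgebra I) : Polynomial R).coeff D = aeval a (homogeneousComponent D f) := by
  classical
  induction f using MvPolynomial.induction_on' with
  | monomial s c =>
    have h1 : ((Phi I a ha (monomial s c) : reesAlgebra I) : Polynomial R) =
        Polynomial.monomial s.degree (aeval a (monomial s c)) := by
      have : ((Phi I a ha (monomial s c) : reesAlgebra I) : Polynomial R) = 
        ((reesAlgebra I).val.comp (Phi I a ha)) (monomial s c) := rfl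
      rw [this, Phi, MvPolynomial.comp_aeval]
      simp only [aeval_monomial, tt, Subalgebra.coe_val, Function.comp_apply]
      simp only [Polynomial.monomial_pow, Finsupp.prod, Finsupp.degree, one_mul]
      have : ∀ T : Finset σ, ∏ i ∈ T, (Polynomial.monomial (s i)) (a i ^ s i) = 
          Polynomial.monomial (∑ i ∈ T, s i) (∏ i ∈ T, a i ^ s i) := by
        classical
        intro T
        induction T using Finset.induction_on with
        | empty => simp
        | insert i T hi ih => 
          rw [Finset.prod_insert hi, ih, Finset.sum_insert hi, Finset.prod_insert hi, Polynomial.monomial_mul_monomial]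
      rw [this, Polynomial.algebraMap_eq, Polynomial.C_mul_monomial]; rfl
    rw [h1, Polynomial.coeff_monomial, homogeneousComponent_apply]
    by_cases hD : s.degree = D
    · subst hD
      by_cases hc : c = 0
      · simp [hc]
      · rw [support_monomial, if_neg hc]
        simp [Finset.filter_singleton, coeff_monomial]
    · rw [if_neg hD]
      by_cases hc : c = 0
      · simp [hc]
      · rw [support_monomial, if_neg hc]
        simp [Finset.filter_singleton, hD]
  | add p q hp hq =>
    rw [map_add, map_add, map_add, ← hp, ← hq]
    simp

lemma Phi_integral [IsNoetherianRing R] (I : Ideal R) {σ : Type} [Finite σ] (a : σ → R) (ha : ∀ i, a i ∈ I) 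
    (hr : ∃ r, I ^ (r+1) = Ideal.span (Set.range a) * I ^ r) : (Phi I a ha).toRingHom.IsIntegral := by
  apply RingHom.Finite.to_isIntegral
  letI := (Phi I a ha).toRingHom.toAlgebra
  show Module.Finite (MvPolynomial σ R) (reesAlgebra I)
  obtain ⟨r, hr⟩ := hr
  have hsm : ∀ (p : MvPolynomial σ R) (z : reesAlgebra I), p • z = Phi I a ha p * z := fun p z => rfl
  choose G hG using fun j => (IsNoetherian.noetherian (I ^ j) : (I ^ j).FG)
  let M : Submodule (MvPolynomial σ R) (reesAlgebra I) := Submodule.span _ 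
    (⋃ j ∈ Finset.range (r+1), ⋃ c ∈ G j, {z : reesAlgebra I | (z : Polynomial R) = Polynomial.monomial j c})
  have hmul : ∀ (q : R) (z z' : reesAlgebra I) (j : ℕ) (c : R), (z : Polynomial R) = Polynomial.monomial j c →
      (z' : Polynomial R) = Polynomial.monomial j (q * c) → z ∈ M → z' ∈ M := by
    intro q z z' j c h1 h2 h3
    have : z' = (MvPolynomial.C q : MvPolynomial σ R) • z := by
      rw [hsm]
      apply Subtype.ext
      rw [h2, MulMemClass.coe_mul, h1]
      have : ((Phi I a ha (MvPolynomial.C q) : reesAlgebra I) : Polynomial R) = Polynomial.C q := by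
        rw [← MvPolynomial.algebraMap_eq, AlgHom.commutes]; rfl
      rw [this, Polynomial.C_mul_monomial]
    rw [this]
    exact M.smul_mem _ h3
  have hadd : ∀ (z z' z'' : reesAlgebra I) (j : ℕ) (c c' : R), (z : Polynomial R) = Polynomial.monomial j c →
      (z' : Polynomial R) = Polynomial.monomial j c' → (z'' : Polynomial R) = Polynomial.monomial j (c + c') → 
      z ∈ M → z' ∈ M → z'' ∈ M := by
    intro z z' z'' j c c' h1 h2 h3 h4 h5
    have : z'' = z + z' := by
      apply Subtype.ext
      rw [h3, AddMemClass.coe_add, h1, h2, map_add]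
    rw [this]
    exact M.add_mem h4 h5
  have low : ∀ j, j ≤ r → ∀ c, ∀ hc : c ∈ I ^ j, tt I hc ∈ M := by
    · intro j hj c hc
      have hc' := hc
      rw [← hG j] at hc'
      induction hc' using Submodule.span_induction with
      | mem x hx =>
        refine Submodule.subset_span ?_
        simp only [Set.mem_iUnion]
        exact ⟨j, by simpa using Nat.lt_succ_of_le hj, x, hx, rfl⟩
      | zero => 
        have : tt I hc = 0 := by apply Subtype.ext; simp [tt]
        rw [this]; exact M.zero_mem
      | add x y hx hy h1 h2 =>
        exact hadd (tt I ((hG j) ▸ hx)) (tt I ((hG j) ▸ hy)) _ j x y rfl rfl rfl (h1 _) (h2 _)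
      | smul q x hx h1 =>
        exact hmul q (tt I ((hG j) ▸ hx)) _ j x rfl rfl (h1 _)
  have key : ∀ j, ∀ c, ∀ hc : c ∈ I ^ j, tt I hc ∈ M := by
    intro j
    induction j with
    | zero => exact low 0 (Nat.zero_le _)
    | succ j ih =>
      by_cases hj : j + 1 ≤ r
      · exact low _ hj
      have hJ : I ^ (j+1) = Ideal.span (Set.range a) * I ^ j := by
        obtain ⟨k, rfl⟩ : ∃ k, j = r + k := ⟨j - r, by omega⟩
        rw [pow_add I r k, ← mul_assoc, ← hr, ← pow_add]; congr 1; omega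
      intro c hc
      have hc' := hc
      rw [hJ] at hc'
      induction hc' using Submodule.mul_induction_on' with
      | mem_mul_mem m hm n hn =>
        have hm' : ∀ m ∈ Ideal.span (Set.range a), m * n ∈ I ^ (j+1) := 
          fun m hm => hJ ▸ Ideal.mul_mem_mul hm hn
        revert hc
        induction hm using Submodule.span_induction with
        | mem x hx =>
          obtain ⟨i, rfl⟩ := hx
          intro hc
          have : tt I hc = (MvPolynomial.X i : MvPolynomial σ R) • tt I hn := by
            rw [hsm]
            apply Subtype.ext
            simp only [Phi, MvPolynomial.aeval_X, MulMemClass.coe_mul, tt]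
            rw [Polynomial.monomial_mul_monomial, add_comm]
          rw [this]
          exact M.smul_mem _ (ih _ _)
        | zero =>
          intro hc
          have : tt I hc = 0 := by apply Subtype.ext; simp [tt]
          rw [this]; exact M.zero_mem
        | add x y hx hy h1 h2 =>
          intro hc
          exact hadd (tt I (hm' x hx)) (tt I (hm' y hy)) _ (j+1) (x * n) (y * n) rfl rfl (by simp [tt, add_mul]) (h1 _) (h2 _)
        | smul q x hx h1 => 
          intro hc
          exact hmul q (tt I (hm' x hx)) _ (j+1) (x*n) rfl (by simp [tt, mul_assoc]) (h1 _)
      | add x hx y hy h1 h2 => 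
        exact hadd (tt I (hJ ▸ hx)) (tt I (hJ ▸ hy)) _ (j+1) x y rfl rfl rfl (h1 _) (h2 _)
  refine ⟨(Submodule.fg_def).2 ⟨_, ?_, (?_ : M = ⊤)⟩⟩
  · refine Set.Finite.biUnion (Finset.finite_toSet _) fun j _ => Set.Finite.biUnion (Finset.finite_toSet _) fun c _ => ?_
    refine Set.Subsingleton.finite ?_
    intro x hx y hy
    exact Subtype.ext (hx.trans hy.symm)
  · rw [eq_top_iff]
    rintro ⟨f, hf⟩ -
    have h1 : (⟨f, hf⟩ : reesAlgebra I) = ∑ j ∈ f.support, tt I ((mem_reesAlgebra_iff I f).1 hf j) := by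
      apply Subtype.ext
      rw [AddSubmonoidClass.coe_finset_sum]
      exact f.as_sum_support
    rw [h1]
    exact Submodule.sum_mem _ fun j _ => key _ _ _

section fib
variable [IsLocalRing R]

def Fib (I : Ideal R) : Type u := ↥(reesAlgebra I) ⧸ (Ideal.map (algebraMap R ↥(reesAlgebra I)) (maximalIdeal R))

noncomputable instance instFib (I : Ideal R) : CommRing (Fib I) := Ideal.Quotient.commRing _

noncomputable def mkF (I : Ideal R) : reesAlgebra I →+* Fib I := Ideal.Quotient.mk _

lemma mkF_surj (I : Ideal R) : Function.Surjective (mkF I) := Ideal.Quotient.mk_surjective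

lemma mkF_zero (I : Ideal R) (z : reesAlgebra I) : mkF I z = 0 ↔ z ∈ Ideal.map (algebraMap R ↥(reesAlgebra I)) (maximalIdeal R) := 
  Ideal.Quotient.eq_zero_iff_mem

noncomputable def kF (I : Ideal R) : ResidueField R →+* Fib I :=
  Ideal.Quotient.lift (maximalIdeal R) ((mkF I).comp (algebraMap R (reesAlgebra I))) 
    (fun x hx => (mkF_zero I _).2 (Ideal.mem_map_of_mem _ hx))

noncomputable def Psi (I : Ideal R) {σ : Type} (a : σ → R) (ha : ∀ i, a i ∈ I) : 
    MvPolynomial σ (ResidueField R) →+* Fib I :=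
  MvPolynomial.eval₂Hom (kF I) fun i => mkF I (tt I (n := 1) (x := a i) (by simpa using ha i))

lemma Psi_comp (I : Ideal R) {σ : Type} (a : σ → R) (ha : ∀ i, a i ∈ I) :
    (Psi I a ha).comp (MvPolynomial.map (residue R)) = (mkF I).comp (Phi I a ha).toRingHom := by
  apply MvPolynomial.ringHom_ext
  · intro r
    simp only [RingHom.comp_apply, MvPolynomial.map_C, Psi, MvPolynomial.eval₂Hom_C]
    rw [← MvPolynomial.algebraMap_eq]
    have : (Phi I a ha).toRingHom (algebraMap R _ r) = algebraMap R (reesAlgebra I) r := (Phi I a ha).commutes r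
    rw [this]; rfl
  · intro i
    simp only [RingHom.comp_apply, MvPolynomial.map_X, Psi, MvPolynomial.eval₂Hom_X']
    congr 1
    exact (MvPolynomial.aeval_X (R := R) (fun i => tt I (n := 1) (x := a i) (by simpa using ha i)) i).symm

lemma Psi_integral [IsNoetherianRing R] (I : Ideal R) {σ : Type} [Finite σ] (a : σ → R) (ha : ∀ i, a i ∈ I) 
    (hr : ∃ r, I ^ (r+1) = Ideal.span (Set.range a) * I ^ r) : (Psi I a ha).IsIntegral := by
  refine RingHom.IsIntegral.tower_top (MvPolynomial.map (residue R)) (Psi I a ha) ?_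
  rw [Psi_comp]
  exact RingHom.IsIntegral.trans _ _ (Phi_integral I a ha hr) (RingHom.isIntegral_of_surjective _ (mkF_surj I))

lemma dim_mv {k : Type u} [Field k] (e : ℕ) : ringKrullDim (MvPolynomial (Fin e) k) = e := by
  rw [MvPolynomial.ringKrullDim_of_isNoetherianRing, ringKrullDim_eq_zero_of_field]; simp

/-- N1 -/
lemma fiber_le [IsNoetherianRing R] (I : Ideal R) {e : ℕ} (a : Fin e → R) 
    (h : IsReduction (Ideal.span (Set.range a)) I) : fiberDim I ≤ e := by
  have ha : ∀ i, a i ∈ I := fun i => h.1 (Ideal.subset_span ⟨i, rfl⟩)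
  have := dim_le_of_integral (Psi I a ha) (Psi_integral I a ha h.2)
  rwa [dim_mv] at this

lemma fiber_coeff (I : Ideal R) (z : reesAlgebra I) (hz : z ∈ Ideal.map (algebraMap R ↥(reesAlgebra I)) (maximalIdeal R)) :
    ∀ D : ℕ, (z : Polynomial R).coeff D ∈ maximalIdeal R * I ^ D := by
  induction hz using Submodule.span_induction with
  | mem x hx =>
    obtain ⟨y, hy, rfl⟩ := hx
    have : ((algebraMap R (reesAlgebra I) y : reesAlgebra I) : Polynomial R) = Polynomial.C y := rfl
    intro D
    rw [this, Polynomial.coeff_C]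
    split_ifs with h
    · subst h; simpa using hy
    · exact Ideal.zero_mem _
  | zero => simp
  | add x y _ _ h1 h2 => 
    intro D
    rw [AddMemClass.coe_add, Polynomial.coeff_add]; exact Ideal.add_mem _ (h1 D) (h2 D)
  | smul q x _ h1 => 
    intro D
    rw [smul_eq_mul, MulMemClass.coe_mul, Polynomial.coeff_mul]
    refine Ideal.sum_mem _ fun ij hij => ?_
    have hij := Finset.HasAntidiagonal.mem_antidiagonal.1 hij
    rw [← hij, pow_add, ← mul_assoc, mul_comm (maximalIdeal R), mul_assoc]
    exact Ideal.mul_mem_mul ((mem_reesAlgebra_iff I _).1 q.2 _) (h1 _)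

end fib

end A13
end Part13

section Part14
set_option linter.all false

section A14
variable {R : Type u} [CommRing R] [IsLocalRing R] [IsNoetherianRing R]

def GenLE (J : Ideal R) (e : ℕ) : Prop := ∃ f : Finset R, f.card ≤ e ∧ Ideal.span (f : Set R) = J

lemma IsReduction.of_le {J I : Ideal R} (hle : J ≤ I) {r : ℕ} (h : I ^ (r+1) ≤ J * I ^ r) : IsReduction J I :=
  ⟨hle, r, le_antisymm h (by rw [pow_succ']; exact Ideal.mul_mono_left hle)⟩

lemma IsReduction.pow {J I : Ideal R} {r : ℕ} (h : I ^ (r+1) = J * I ^ r) (D : ℕ) : I ^ (r + D) = J ^ D * I ^ r := by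
  induction D with
  | zero => simp
  | succ D ih => 
    calc I ^ (r + (D+1)) = I ^ D * I ^ (r+1) := by rw [← pow_add]; congr 1; omega
      _ = J * I ^ (r + D) := by rw [h, pow_add]; ring
      _ = _ := by rw [ih]; ring

lemma mono_diff {I B : Ideal R} {σ : Type} (a c : σ → R) (w : R) (hw : w ∈ I) (ha : ∀ i, a i ∈ I)
    (hb : ∀ i, a i - c i * w ∈ B) (s : Multiset σ) : 
    ∀ w' ∈ I, w' * ((s.map a).prod - (s.map c).prod * w ^ s.card) ∈ B * I ^ s.card := by
  induction s using Multiset.induction_on with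
  | empty => intro w' hw'; simp
  | cons j s ih =>
    intro w' hw'
    have hA : (s.map a).prod ∈ I ^ s.card := by
      clear ih
      induction s using Multiset.induction_on with
      | empty => simp
      | cons i s ih => 
        rw [Multiset.map_cons, Multiset.prod_cons, Multiset.card_cons, pow_succ']
        exact Ideal.mul_mem_mul (ha i) ih
    rw [Multiset.map_cons, Multiset.prod_cons, Multiset.map_cons, Multiset.prod_cons, Multiset.card_cons]
    have e : w' * (a j * (s.map a).prod - c j * (s.map c).prod * w ^ (s.card + 1)) = 
      (a j - c j * w) * ((s.map a).prod * w') + 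
        (w * ((s.map a).prod - (s.map c).prod * w ^ s.card)) * (w' * c j) := by ring
    rw [e]
    refine Ideal.add_mem _ (Ideal.mul_mem_mul (hb j) ?_) ?_
    · rw [pow_succ]; exact Ideal.mul_mem_mul hA hw'
    · rw [pow_succ, ← mul_assoc]
      exact Ideal.mul_mem_mul (ih w hw) (I.mul_mem_right _ hw')

open MvPolynomial in
lemma poly_diff {I B : Ideal R} {σ : Type} (a c : σ → R) (w : R) (hw : w ∈ I) (ha : ∀ i, a i ∈ I)
    (hb : ∀ i, a i - c i * w ∈ B) (P : MvPolynomial σ R) (D : ℕ) (hP : P.IsHomogeneous D) : 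
    ∀ w' ∈ I, w' * (eval a P - eval c P * w ^ D) ∈ B * I ^ D := by
  intro w' hw'
  have hpr : ∀ (a : σ → R) (s : σ →₀ ℕ), ∏ i ∈ s.support, a i ^ s i = ((Finsupp.toMultiset s).map a).prod := by
    intro a s
    rw [Finsupp.toMultiset_map, Finsupp.prod_toMultiset, Finsupp.prod_mapDomain_index]
    · rfl
    · intro b; simp
    · intro b m n; exact pow_add _ _ _
  rw [eval_eq, eval_eq, Finset.sum_mul, ← Finset.sum_sub_distrib, Finset.mul_sum]
  refine Ideal.sum_mem _ fun s hs => ?_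
  have hD : (Finsupp.toMultiset s).card = D := by
    have := hP (mem_support_iff.1 hs)
    rw [Finsupp.card_toMultiset, ← this, Finsupp.weight_apply]
    apply Finset.sum_congr rfl
    intro i _; simp
  have := mono_diff a c w hw ha hb (Finsupp.toMultiset s) w' hw'
  rw [hD] at this
  rw [hpr, hpr]
  have h2 := Ideal.mul_mem_left _ (coeff s P) this
  convert h2 using 1; ring

lemma pow_aux (I B : Ideal R) (x : R) (hx : x ∈ I) (hB : B ≤ I) (D : ℕ) : 
    I * (B ⊔ Ideal.span {x}) ^ D ≤ Ideal.span {x ^ D} * I ⊔ B * I ^ D := by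
  induction D with
  | zero => simp
  | succ D ih =>
    calc I * (B ⊔ Ideal.span {x}) ^ (D+1) = (I * (B ⊔ Ideal.span {x}) ^ D) * (B ⊔ Ideal.span {x}) := by
          rw [pow_succ, mul_assoc]
      _ ≤ (Ideal.span {x ^ D} * I ⊔ B * I ^ D) * (B ⊔ Ideal.span {x}) := Ideal.mul_mono_left ih
      _ ≤ _ := by
        rw [Ideal.sup_mul, Ideal.mul_sup, Ideal.mul_sup]
        have hxI : Ideal.span {x} ≤ I := by rwa [Ideal.span_singleton_le_iff_mem]
        refine sup_le (sup_le ?_ ?_) (sup_le ?_ ?_)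
        · refine le_sup_of_le_right ?_
          rw [mul_comm, ← Ideal.span_singleton_pow]
          refine Ideal.mul_mono_right ?_
          rw [pow_succ]
          exact Ideal.mul_mono_left (Ideal.pow_right_mono hxI _)
        · refine le_sup_of_le_left ?_
          rw [mul_right_comm, Ideal.span_singleton_mul_span_singleton, pow_succ]
        · refine le_sup_of_le_right ?_
          rw [mul_assoc, pow_succ]
          exact Ideal.mul_mono_right (Ideal.mul_mono_right hB)
        · refine le_sup_of_le_right ?_
          rw [mul_assoc, pow_succ]
          exact Ideal.mul_mono_right (Ideal.mul_mono_right hxI)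

open MvPolynomial in
lemma homog_rel (I : Ideal R) {e : ℕ} (a : Fin e → R) 
    (h : IsReduction (Ideal.span (Set.range a)) I) (hlt : ¬ (e : WithBot ℕ∞) ≤ fiberDim I) : 
    ∃ D, ∃ P : MvPolynomial (Fin e) R, P.IsHomogeneous D ∧ MvPolynomial.map (residue R) P ≠ 0 ∧ 
      eval a P ∈ maximalIdeal R * I ^ D := by
  have ha : ∀ i, a i ∈ I := fun i => h.1 (Ideal.subset_span ⟨i, rfl⟩)
  have hni : ¬ Function.Injective (Psi I a ha) := by
    intro hi
    have := dim_ge_of_integral (Psi I a ha) (Psi_integral I a ha h.2) hi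
    rw [dim_mv] at this
    exact hlt this
  rw [injective_iff_map_eq_zero] at hni
  push Not at hni
  obtain ⟨f, hf, hf0⟩ := hni
  obtain ⟨F, rfl⟩ := MvPolynomial.map_surjective (residue R) (residue_surjective) f
  have h1 : ∃ D, homogeneousComponent D (MvPolynomial.map (residue R) F) ≠ 0 := by
    by_contra hc
    push Not at hc
    apply hf0
    rw [← sum_homogeneousComponent (MvPolynomial.map (residue R) F)]
    exact Finset.sum_eq_zero fun i _ => hc i
  obtain ⟨D, hD⟩ := h1
  refine ⟨D, homogeneousComponent D F, homogeneousComponent_isHomogeneous _ _, ?_, ?_⟩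
  · convert hD using 1
    ext s
    rw [coeff_map, coeff_homogeneousComponent, coeff_homogeneousComponent, coeff_map]
    split_ifs <;> simp
  · have h2 : mkF I (Phi I a ha F) = 0 := by
      have := congrArg (fun φ => φ F) (Psi_comp I a ha)
      simp only [RingHom.comp_apply] at this
      rw [hf] at this
      exact this.symm
    rw [mkF_zero] at h2
    have h3 := fiber_coeff I _ h2 D
    rw [Phi_coeff] at h3
    simpa [aeval_eq_eval] using h3

/-- N2 -/
lemma reduction_drop [Infinite (ResidueField R)] (I : Ideal R) {e : ℕ} (a : Fin e → R) 
    (h : IsReduction (Ideal.span (Set.range a)) I) (hlt : ¬ (e : WithBot ℕ∞) ≤ fiberDim I) : 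
    ∃ f : Finset R, f.card < e ∧ Ideal.span (f : Set R) ≤ Ideal.span (Set.range a) ∧ 
      IsReduction (Ideal.span (f : Set R)) I := by
  classical
  have ha : ∀ i, a i ∈ I := fun i => h.1 (Ideal.subset_span ⟨i, rfl⟩)
  obtain ⟨D, P, hP, hP0, hPm⟩ := homog_rel I a h hlt
  obtain ⟨c', hc'⟩ : ∃ c : Fin e → ResidueField R, MvPolynomial.eval c (MvPolynomial.map (residue R) P) ≠ 0 := by
    by_contra hc
    push Not at hc
    exact hP0 (MvPolynomial.funext fun x => by rw [hc x]; simp)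
  choose c hc using fun i => residue_surjective (R := R) (c' i)
  have hPc : IsUnit (MvPolynomial.eval c P) := by
    rw [← residue_ne_zero_iff_isUnit]
    convert hc' using 1
    rw [MvPolynomial.eval_map, MvPolynomial.eval₂_eq, MvPolynomial.eval_eq]
    simp [hc]
  have hex : ∃ i, IsUnit (c i) := by
    by_contra hcn
    push Not at hcn
    by_cases hD : D = 0
    · subst hD
      obtain ⟨q, rfl⟩ : ∃ q, P = MvPolynomial.C q := 
        ⟨_, MvPolynomial.totalDegree_eq_zero_iff_eq_C.1 (Nat.le_zero.1 hP.totalDegree_le)⟩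
      simp only [MvPolynomial.eval_C, pow_zero, Ideal.one_eq_top, Ideal.mul_top] at hPc hPm
      exact (mem_maximalIdeal _).1 hPm hPc
    · apply hc'
      have : c' = 0 := by
        funext i
        rw [← hc i]
        exact (residue_eq_zero_iff _).2 ((mem_maximalIdeal _).2 (hcn i))
      rw [this]
      have h0 : MvPolynomial.coeff 0 (MvPolynomial.map (residue R) P) = 0 := by
        rw [MvPolynomial.coeff_map, hP.coeff_eq_zero, map_zero]
        simpa using fun h => hD h.symm
      rw [MvPolynomial.eval_zero]
      exact h0
  obtain ⟨i, hi⟩ := hex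
  obtain ⟨u, hu⟩ := hi
  set w : R := ↑u⁻¹ * a i with hw
  have hwI : w ∈ I := I.mul_mem_left _ (ha i)
  have hiw : a i = c i * w := by rw [hw, ← hu, Units.mul_inv_cancel_left]
  let f : Finset R := (Finset.univ.erase i).image fun j => a j - c j * w
  set B := Ideal.span (f : Set R) with hB
  have hb : ∀ j, a j - c j * w ∈ B := by
    intro j
    by_cases hj : j = i
    · subst hj; rw [hiw, sub_self]; exact B.zero_mem
    · exact Ideal.subset_span (by simp only [f, Finset.coe_image, Set.mem_image]; exact ⟨j, by simpa using hj, rfl⟩)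
  have hJ : ∀ j, a j ∈ Ideal.span (Set.range a) := fun j => Ideal.subset_span ⟨j, rfl⟩
  have hBJ : B ≤ Ideal.span (Set.range a) := by
    rw [hB, Ideal.span_le]
    intro z hz
    simp only [f, Finset.coe_image, Set.mem_image] at hz
    obtain ⟨j, -, rfl⟩ := hz
    exact Ideal.sub_mem _ (hJ j) (Ideal.mul_mem_left _ _ (Ideal.mul_mem_left _ _ (hJ i)))
  have hBI := hBJ.trans h.1
  refine ⟨f, ?_, hBJ, ?_⟩
  · refine lt_of_le_of_lt Finset.card_image_le ?_
    rw [Finset.card_erase_of_mem (Finset.mem_univ _), Finset.card_univ, Fintype.card_fin]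
    have := i.2; omega
  have hJw : Ideal.span (Set.range a) = B ⊔ Ideal.span {w} := by
    apply le_antisymm
    · rw [Ideal.span_le]
      rintro _ ⟨j, rfl⟩
      have : a j = (a j - c j * w) + c j * w := by ring
      rw [this]
      exact Ideal.add_mem _ (Ideal.mem_sup_left (hb j)) (Ideal.mem_sup_right (Ideal.mul_mem_left _ _ (Ideal.mem_span_singleton_self w)))
    · refine sup_le hBJ ?_
      rw [Ideal.span_singleton_le_iff_mem]
      exact Ideal.mul_mem_left _ _ (hJ i)
  obtain ⟨r, hr⟩ := h.2
  have h1 : Ideal.span {w ^ D} * I ≤ B * I ^ D ⊔ maximalIdeal R * I ^ (D+1) := by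
    rw [Ideal.span_singleton_mul_le_iff]
    intro z hz
    have h2 := poly_diff a c w hwI ha hb P D hP z hz
    obtain ⟨q, hq⟩ := hPc
    have h3 : z * MvPolynomial.eval a P ∈ maximalIdeal R * I ^ (D+1) := by
      rw [pow_succ, ← mul_assoc, mul_comm z]
      exact Ideal.mul_mem_mul hPm hz
    have e : w ^ D * z = ↑q⁻¹ * (z * MvPolynomial.eval a P - z * (MvPolynomial.eval a P - MvPolynomial.eval c P * w ^ D)) := by
      rw [← hq]
      have := q.inv_mul
      linear_combination (- w^D * z) * this
    rw [e]
    exact Ideal.mul_mem_left _ _ (Ideal.sub_mem _ (Ideal.mem_sup_right h3) (Ideal.mem_sup_left h2))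
  have h4 := pow_aux I B w hwI hBI D
  rw [← hJw] at h4
  have h5 : I ^ (r + D + 1) ≤ B * I ^ (r+D) ⊔ maximalIdeal R * I ^ (r + D + 1) := by
    calc I ^ (r + D + 1) = (I * (Ideal.span (Set.range a)) ^ D) * I ^ r := by
          rw [pow_succ, IsReduction.pow hr D]; ring
      _ ≤ (B * I ^ D ⊔ maximalIdeal R * I ^ (D+1)) * I ^ r := 
          Ideal.mul_mono_left (h4.trans (sup_le h1 le_sup_left))
      _ = _ := by
        rw [Ideal.sup_mul]
        congr 1
        · rw [mul_assoc, ← pow_add, add_comm D]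
        · rw [mul_assoc, ← pow_add]; congr 2; omega
  exact IsReduction.of_le hBI (nakayama h5)

lemma GenLE.fin {J : Ideal R} {e : ℕ} (h : GenLE J e) : ∃ a : Fin e → R, Ideal.span (Set.range a) = J := by
  obtain ⟨f, hf, rfl⟩ := h
  refine ⟨fun i => if h : i.1 < f.card then (f.equivFin.symm ⟨i.1, h⟩ : R) else 0, le_antisymm ?_ ?_⟩
  · rw [Ideal.span_le]
    rintro _ ⟨i, rfl⟩
    dsimp only
    split_ifs with h
    · exact Ideal.subset_span (f.equivFin.symm ⟨i.1, h⟩).2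
    · exact Ideal.zero_mem _
  · rw [Ideal.span_le]
    intro x hx
    refine Ideal.subset_span ⟨⟨f.equivFin ⟨x, hx⟩, lt_of_lt_of_le (f.equivFin ⟨x, hx⟩).2 hf⟩, ?_⟩
    simp

lemma GenLE.of_fin {e : ℕ} (a : Fin e → R) : GenLE (Ideal.span (Set.range a)) e := by
  classical
  exact ⟨Finset.univ.image a, Finset.card_image_le.trans (by simp), by simp⟩

lemma GenLE.mono {J : Ideal R} {e e' : ℕ} (h : GenLE J e) (hle : e ≤ e') : GenLE J e' := by
  obtain ⟨f, hf, rfl⟩ := h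
  exact ⟨f, hf.trans hle, rfl⟩

lemma GenLE.exists (J : Ideal R) : ∃ e, GenLE J e := by
  obtain ⟨f, hf⟩ := (IsNoetherian.noetherian J : J.FG)
  exact ⟨f.card, f, le_rfl, hf⟩

/-- analytic spread bound: every reduction needs `≥ ℓ` generators -/
lemma fiber_le_gen {I J : Ideal R} (h : IsReduction J I) {e : ℕ} (he : GenLE J e) : fiberDim I ≤ e := by
  obtain ⟨a, rfl⟩ := he.fin
  exact fiber_le I a h

/-- every reduction contains one with `≤ ℓ` generators -/
lemma exists_small [Infinite (ResidueField R)] {I J : Ideal R} (h : IsReduction J I) {l : ℕ} (hl : fiberDim I ≤ (l : WithBot ℕ∞)) :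
    ∃ J' ≤ J, IsReduction J' I ∧ GenLE J' l := by
  obtain ⟨e, he⟩ := GenLE.exists J
  induction e using Nat.strong_induction_on generalizing J with
  | _ e ih =>
    by_cases hel : e ≤ l
    · exact ⟨J, le_rfl, h, he.mono hel⟩
    · obtain ⟨a, rfl⟩ := he.fin
      obtain ⟨f, hf, hf2, hf3⟩ := reduction_drop I a h (fun hc => hel (by exact_mod_cast hc.trans hl))
      obtain ⟨J', h1, h2, h3⟩ := ih _ hf hf3 ⟨f, le_rfl, rfl⟩
      exact ⟨J', h1.trans hf2, h2, h3⟩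

end A14
end Part14

section Part15
set_option linter.all false

section A15
variable {R : Type u} [CommRing R] [IsLocalRing R] [IsNoetherianRing R]

lemma hyp {A B : Ideal R} {e : ℕ} (hBA : B ≤ A) (hA : GenLE A e) (hne : B ≠ A) : 
    1 ≤ e ∧ ∃ b ≤ A, GenLE b (e-1) ∧ B ≤ b ⊔ maximalIdeal R * A := by
  classical
  obtain ⟨a, rfl⟩ := hA.fin
  set A := Ideal.span (Set.range a)
  have h1 : B ⊔ maximalIdeal R * A ≠ A := fun h => hne (le_antisymm hBA (nakayama h.ge))
  obtain ⟨C, ⟨hC1, hC2, hC3⟩, hC⟩ := set_has_maximal_iff_noetherian.2 (inferInstance : IsNoetherianRing R) 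
    {C : Ideal R | B ⊔ maximalIdeal R * A ≤ C ∧ C ≤ A ∧ C ≠ A} ⟨_, le_rfl, sup_le hBA Ideal.mul_le_right, h1⟩
  have h2 : ∃ i, a i ∉ C := by
    by_contra hc
    push Not at hc
    apply hC3 (le_antisymm hC2 _)
    rw [Ideal.span_le]
    rintro _ ⟨i, rfl⟩; exact hc i
  obtain ⟨i, hi⟩ := h2
  have haA : ∀ j, a j ∈ A := fun j => Ideal.subset_span ⟨j, rfl⟩
  have h3 : C ⊔ Ideal.span {a i} = A := by
    by_contra hc
    apply hC (C ⊔ Ideal.span {a i}) ⟨hC1.trans le_sup_left, sup_le hC2 (by rw [Ideal.span_singleton_le_iff_mem]; exact haA i), hc⟩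
    exact lt_of_le_of_ne le_sup_left fun h => hi (by rw [h]; exact Ideal.mem_sup_right (Ideal.mem_span_singleton_self _))
  have h4 : ∀ j, ∃ c, a j - a i * c ∈ C := fun j => mem_sup_span.1 (h3 ▸ haA j)
  choose c hc using h4
  have hp := i.2
  let f := (Finset.univ.erase i).image fun j => a j - a i * c j
  have hf : ∀ j, j ≠ i → a j - a i * c j ∈ Ideal.span (f : Set R) := fun j hj => 
    Ideal.subset_span (by simp only [f, Finset.coe_image, Set.mem_image]; exact ⟨j, by simpa using hj, rfl⟩)
  have hfC : Ideal.span (f : Set R) ≤ C := by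
    rw [Ideal.span_le]
    intro z hz
    simp only [f, Finset.coe_image, Set.mem_image] at hz
    obtain ⟨j, -, rfl⟩ := hz
    exact hc j
  refine ⟨by omega, Ideal.span (f : Set R), hfC.trans hC2, ⟨f, Finset.card_image_le.trans ?_, rfl⟩, ?_⟩
  · rw [Finset.card_erase_of_mem (Finset.mem_univ _), Finset.card_univ, Fintype.card_fin]
  have h5 : A ≤ Ideal.span (f : Set R) ⊔ Ideal.span {a i} := by
    rw [Ideal.span_le]
    rintro _ ⟨j, rfl⟩
    by_cases hj : j = i
    · subst hj; exact Ideal.mem_sup_right (Ideal.mem_span_singleton_self _)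
    · exact mem_sup_span.2 ⟨c j, hf j hj⟩
  intro z hz
  obtain ⟨ρ, hρ⟩ := mem_sup_span.1 (h5 (hBA hz))
  have h6 : a i * ρ ∈ C := by
    have := C.sub_mem (hC1 (Ideal.mem_sup_left hz)) (hfC hρ)
    simpa using this
  have h7 : ρ ∈ maximalIdeal R := by
    rw [mem_maximalIdeal]
    intro hu
    exact hi ((Ideal.mul_unit_mem_iff_mem _ hu).1 h6)
  have : z = (z - a i * ρ) + ρ * a i := by ring
  rw [this]
  exact Ideal.add_mem _ (Ideal.mem_sup_left hρ) (Ideal.mem_sup_right (Ideal.mul_mem_mul h7 (haA i)))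

/-- a reduction modulo `m I` suffices -/
lemma IsReduction.of_sup {I J b : Ideal R} (h : IsReduction J I) (hb : b ≤ I) (hJ : J ≤ b ⊔ maximalIdeal R * I) : 
    IsReduction b I := by
  obtain ⟨r, hr⟩ := h.2
  refine IsReduction.of_le (r := r) hb (nakayama ?_)
  calc I ^ (r+1) = J * I ^ r := hr
    _ ≤ (b ⊔ maximalIdeal R * I) * I ^ r := Ideal.mul_mono_left hJ
    _ = _ := by rw [Ideal.sup_mul, mul_assoc, ← pow_succ']

lemma min_of_gen {I J J' : Ideal R} {l : ℕ} (hl : (l : WithBot ℕ∞) ≤ fiberDim I) (hJ : IsReduction J I) (hg : GenLE J l) 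
    (hJ' : IsReduction J' I) (hle : J' ≤ J) : J' = J := by
  by_contra hne
  obtain ⟨h1, b, hb, hb1, hb2⟩ := hyp hle hg hne
  have h2 := fiber_le_gen (hJ'.of_sup (hb.trans hJ.1) (hb2.trans (sup_le_sup_left (Ideal.mul_mono_right hJ.1) _))) hb1
  have := hl.trans h2
  have : l ≤ l - 1 := by exact_mod_cast this
  omega

lemma minRed_iff [Infinite (ResidueField R)] {I J : Ideal R} {l : ℕ} (hl : fiberDim I = (l : WithBot ℕ∞)) : 
    IsMinimalReduction J I ↔ IsReduction J I ∧ GenLE J l := by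
  constructor
  · rintro ⟨h1, h2⟩
    obtain ⟨J', h3, h4, h5⟩ := exists_small h1 hl.le
    exact ⟨h1, h2 J' h4 h3 ▸ h5⟩
  · rintro ⟨h1, h2⟩
    exact ⟨h1, fun J' h3 h4 => min_of_gen hl.ge h1 h2 h3 h4⟩

/-- Steinitz: `I = J + (n-ℓ elements)` -/
lemma steinitz {I : Ideal R} {l n : ℕ} (a : Fin l → R) (hl : (l : WithBot ℕ∞) ≤ fiberDim I)
    (hJ : IsReduction (Ideal.span (Set.range a)) I) (hn : GenLE I n) : 
    l ≤ n ∧ ∃ E : Finset R, E.card ≤ n - l ∧ I = Ideal.span (Set.range a) ⊔ Ideal.span (E : Set R) := by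
  classical
  have haI : ∀ i, a i ∈ I := fun i => hJ.1 (Ideal.subset_span ⟨i, rfl⟩)
  have key : ∀ k, k ≤ l → k ≤ n ∧ ∃ E : Finset R, E.card ≤ n - k ∧ I = Ideal.span (a '' {i | i.1 < k}) ⊔ Ideal.span (E : Set R) := by
    intro k
    induction k with
    | zero =>
      intro _
      obtain ⟨E, hE, hE2⟩ := hn
      exact ⟨Nat.zero_le _, E, hE, by simp [hE2]⟩
    | succ k ih =>
      intro hk
      obtain ⟨hkn, E, hE, hE2⟩ := ih (by omega)
      let i : Fin l := ⟨k, by omega⟩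
      set A := Ideal.span (a '' {i | i.1 < k}) with hA
      have hAk : Ideal.span (a '' {i | i.1 < k+1}) = A ⊔ Ideal.span {a i} := by
        rw [hA, ← Ideal.span_union]
        congr 1
        ext x
        simp only [Set.mem_image, Set.mem_setOf_eq, Set.mem_union, Set.mem_singleton_iff]
        constructor
        · rintro ⟨j, hj, rfl⟩
          rcases Nat.lt_succ_iff_lt_or_eq.1 hj with h | h
          · exact Or.inl ⟨j, h, rfl⟩
          · right; congr 1; exact Fin.ext h
        · rintro (⟨j, hj, rfl⟩ | rfl)
          · exact ⟨j, by omega, rfl⟩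
          · exact ⟨i, Nat.lt_succ_self _, rfl⟩
      obtain ⟨y, hy, hyA⟩ : ∃ y ∈ Ideal.span (E : Set R), a i - y ∈ A := mem_sup_left'.1 (hE2 ▸ haI i)
      obtain ⟨s, hs⟩ := Submodule.mem_span_finset'.1 hy
      by_cases hex : ∃ x, IsUnit (s x)
      · obtain ⟨x, hx⟩ := hex
        have hpos : 0 < E.card := Finset.card_pos.2 ⟨x, x.2⟩
        have hq1 : k + 1 ≤ n := by clear * - hE hpos; omega
        have hq2 : E.card - 1 ≤ n - (k+1) := by clear * - hE hpos; omega
        refine ⟨hq1, E.erase x, by rw [Finset.card_erase_of_mem x.2]; exact hq2, ?_⟩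
        have h1 : Ideal.span (E : Set R) = Ideal.span (E.erase x : Set R) ⊔ Ideal.span {(x:R)} := by
          rw [← Ideal.span_union]; congr 1; ext z
          simp only [Finset.coe_erase, Set.mem_union, Set.mem_diff, Set.mem_singleton_iff]
          constructor
          · intro hz; by_cases h : z = x <;> simp [h, hz]
          · rintro (h | h); exacts [h.1, h ▸ x.2]
        have hAI : A ≤ I := hE2 ▸ le_sup_left
        have hEI : Ideal.span (E : Set R) ≤ I := hE2 ▸ le_sup_right
        rw [hAk]
        apply le_antisymm
        · rw [hE2, h1]
          have hxm : (x : R) ∈ A ⊔ Ideal.span {a i} ⊔ Ideal.span (E.erase x : Set R) := by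
            have h2 : s x * (x : R) = a i - (a i - y) - ∑ z ∈ Finset.univ.erase x, s z * (z : R) := by
              rw [← hs, ← Finset.add_sum_erase _ _ (Finset.mem_univ x)]
              simp only [smul_eq_mul]; ring
            rw [← Ideal.unit_mul_mem_iff_mem _ hx, h2]
            refine Ideal.sub_mem _ (Ideal.sub_mem _ ?_ ?_) (Ideal.sum_mem _ fun z hz => ?_)
            · exact Ideal.mem_sup_left (Ideal.mem_sup_right (Ideal.mem_span_singleton_self _))
            · exact Ideal.mem_sup_left (Ideal.mem_sup_left hyA)
            · refine Ideal.mem_sup_right (Ideal.mul_mem_left _ _ (Ideal.subset_span ?_))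
              have := (Finset.mem_erase.1 hz).1
              simp only [Finset.coe_erase, Set.mem_diff, Set.mem_singleton_iff]
              exact ⟨z.2, fun h => this (Subtype.ext h)⟩
          refine sup_le (le_sup_left.trans le_sup_left) (sup_le le_sup_right ?_)
          rwa [Ideal.span_singleton_le_iff_mem]
        · refine sup_le (sup_le hAI ?_) (le_trans ?_ hEI)
          · rw [Ideal.span_singleton_le_iff_mem]; exact haI i
          · exact Ideal.span_mono (by simp)
      · exfalso
        push Not at hex
        let f : Finset R := (Finset.univ.erase i).image a
        have hfJ : Ideal.span (f : Set R) ≤ Ideal.span (Set.range a) := Ideal.span_mono (by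
          intro z hz; simp only [f, Finset.coe_image, Set.mem_image] at hz
          obtain ⟨j, -, rfl⟩ := hz; exact ⟨j, rfl⟩)
        have hAf : A ≤ Ideal.span (f : Set R) := Ideal.span_mono (by
          rintro _ ⟨j, hj, rfl⟩
          simp only [f, Finset.coe_image, Set.mem_image]
          refine ⟨j, ?_, rfl⟩
          have : j ≠ i := by intro h; rw [h] at hj; exact lt_irrefl k hj
          simpa using this)
        have hred : IsReduction (Ideal.span (f : Set R)) I := by
          refine hJ.of_sup (hfJ.trans hJ.1) ?_
          rw [Ideal.span_le]
          rintro _ ⟨j, rfl⟩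
          by_cases hj : j = i
          · subst hj
            have : a i = (a i - y) + y := by ring
            rw [this]
            refine Ideal.add_mem _ (Ideal.mem_sup_left (hAf hyA)) (Ideal.mem_sup_right ?_)
            rw [← hs]
            refine Ideal.sum_mem _ fun z _ => Ideal.mul_mem_mul ((mem_maximalIdeal _).2 (hex z)) ?_
            rw [hE2]; exact Ideal.mem_sup_right (Ideal.subset_span z.2)
          · refine Ideal.mem_sup_left (Ideal.subset_span ?_)
            simp only [f, Finset.coe_image, Set.mem_image]
            exact ⟨j, by simpa using hj, rfl⟩
        have h2 := hl.trans (fiber_le_gen hred ⟨f, Finset.card_image_le, rfl⟩)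
        rw [Finset.card_erase_of_mem (Finset.mem_univ _), Finset.card_univ, Fintype.card_fin] at h2
        have : l ≤ l - 1 := by exact_mod_cast h2
        omega
  obtain ⟨h1, E, hE, hE2⟩ := key l le_rfl
  refine ⟨h1, E, hE, ?_⟩
  rw [hE2]; congr 2
  ext x; simp

end A15
end Part15

section Part16
set_option linter.all false

section A16
variable {R : Type u} [CommRing R] [IsLocalRing R] [IsNoetherianRing R]

/-- degree one part of an ideal of the Rees algebra -/
def deg1 (I : Ideal R) (P : Ideal (reesAlgebra I)) : Ideal R where
  carrier := {y | ∃ z ∈ P, (z : Polynomial R) = Polynomial.monomial 1 y}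
  add_mem' := by
    rintro x y ⟨z, hz, h⟩ ⟨z', hz', h'⟩
    exact ⟨z + z', P.add_mem hz hz', by rw [AddMemClass.coe_add, h, h', map_add]⟩
  zero_mem' := ⟨0, P.zero_mem, by simp⟩
  smul_mem' := by
    rintro c x ⟨z, hz, h⟩
    refine ⟨algebraMap R _ c * z, P.mul_mem_left _ hz, ?_⟩
    have : ((algebraMap R (reesAlgebra I) c : reesAlgebra I) : Polynomial R) = Polynomial.C c := rfl
    rw [MulMemClass.coe_mul, h, this, Polynomial.C_mul_monomial]; rfl

lemma mem_deg1 {I : Ideal R} {P : Ideal (reesAlgebra I)} {y : R} (hy : y ∈ I ^ 1) : y ∈ deg1 I P ↔ tt I hy ∈ P := by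
  constructor
  · rintro ⟨z, hz, h⟩
    have : z = tt I hy := Subtype.ext h
    rwa [← this]
  · intro h
    exact ⟨_, h, rfl⟩

/-- ideal defining `T` -/
noncomputable def TQ (I b : Ideal R) (a : R) (ha : a ∈ I ^ 1) : Ideal (reesAlgebra I) :=
  Ideal.map (algebraMap R ↥(reesAlgebra I)) (maximalIdeal R) ⊔ 
    Ideal.span {z | ∃ y ∈ b, (z : Polynomial R) = Polynomial.monomial 1 y} ⊔ Ideal.span {tt I ha - 1}

lemma TQ_rel {I b : Ideal R} {a : R} (ha : a ∈ I ^ 1) (hb : b ≤ I) {z : reesAlgebra I} (hz : z ∈ TQ I b a ha) :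
    ∃ w : reesAlgebra I, ∀ j, (z : Polynomial R).coeff (j+1) - (a * (w : Polynomial R).coeff j - (w : Polynomial R).coeff (j+1)) ∈ 
      b * I ^ j ⊔ maximalIdeal R * I ^ (j+1) ∧ 
      (z : Polynomial R).coeff 0 + (w : Polynomial R).coeff 0 ∈ maximalIdeal R := by
  obtain ⟨w, hw⟩ := mem_sup_span.1 hz
  refine ⟨w, ?_⟩
  obtain ⟨β, hβ, hμ⟩ : ∃ β ∈ Ideal.span {z : reesAlgebra I | ∃ y ∈ b, (z : Polynomial R) = Polynomial.monomial 1 y}, 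
      z - (tt I ha - 1) * w - β ∈ Ideal.map (algebraMap R ↥(reesAlgebra I)) (maximalIdeal R) := by
    obtain ⟨x, hx, y, hy, hxy⟩ := Submodule.mem_sup.1 hw
    exact ⟨y, hy, by rw [← hxy, add_sub_cancel_right]; exact hx⟩
  have h1 := fiber_coeff I _ hμ
  have h2 : (∀ j, (β : Polynomial R).coeff (j+1) ∈ b * I ^ j) ∧ (β : Polynomial R).coeff 0 = 0 := by
    clear hw hμ h1
    induction hβ using Submodule.span_induction with
    | mem x hx =>
      obtain ⟨y, hy, h⟩ := hx
      rw [h]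
      refine ⟨fun j => ?_, by simp [Polynomial.coeff_monomial]⟩
      rw [Polynomial.coeff_monomial]
      split_ifs with hj
      · obtain rfl : j = 0 := by omega
        simpa using hy
      · exact Ideal.zero_mem _
    | zero => simp
    | add x y _ _ h1 h2 =>
      refine ⟨fun j => ?_, ?_⟩
      · rw [AddMemClass.coe_add, Polynomial.coeff_add]; exact Ideal.add_mem _ (h1.1 j) (h2.1 j)
      · rw [AddMemClass.coe_add, Polynomial.coeff_add, h1.2, h2.2, add_zero]
    | smul q x _ h1 =>
      rw [smul_eq_mul, MulMemClass.coe_mul]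
      refine ⟨fun j => ?_, ?_⟩
      · rw [Polynomial.coeff_mul]
        refine Ideal.sum_mem _ fun ij hij => ?_
        have hij := Finset.HasAntidiagonal.mem_antidiagonal.1 hij
        obtain ⟨i, k⟩ := ij
        dsimp only at hij ⊢
        rcases k with _ | k
        · rw [h1.2, mul_zero]; exact Ideal.zero_mem _
        · obtain rfl : j = i + k := by omega
          rw [pow_add, mul_left_comm]
          exact Ideal.mul_mem_mul ((mem_reesAlgebra_iff I _).1 q.2 _) (h1.1 _)
      · rw [Polynomial.mul_coeff_zero, h1.2, mul_zero]
  have e : (z : Polynomial R) = ((z - (tt I ha - 1) * w - β : reesAlgebra I) : Polynomial R) + (β : Polynomial R) + 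
      (Polynomial.X * (Polynomial.C a * (w : Polynomial R)) - (w : Polynomial R)) := by
    simp only [AddSubgroupClass.coe_sub, MulMemClass.coe_mul, OneMemClass.coe_one, tt]
    rw [← Polynomial.C_mul_X_eq_monomial]; ring
  intro j
  constructor
  · rw [e, Polynomial.coeff_add, Polynomial.coeff_add, Polynomial.coeff_sub, Polynomial.coeff_X_mul, Polynomial.coeff_C_mul]
    rw [add_sub_cancel_right]
    exact Ideal.add_mem _ (Ideal.mem_sup_right (h1 _)) (Ideal.mem_sup_left (h2.1 _))
  · rw [e, Polynomial.coeff_add, Polynomial.coeff_add, Polynomial.coeff_sub, Polynomial.coeff_X_mul_zero, h2.2]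
    have := h1 0
    simp only [pow_zero, Ideal.one_eq_top, Ideal.mul_top] at this
    convert this using 1; ring

def TQt (I b : Ideal R) (a : R) (ha : a ∈ I ^ 1) : Type u := ↥(reesAlgebra I) ⧸ (TQ I b a ha)

noncomputable instance instTQt (I b : Ideal R) (a : R) (ha : a ∈ I ^ 1) : CommRing (TQt I b a ha) := Ideal.Quotient.commRing _

noncomputable def mkT (I b : Ideal R) (a : R) (ha : a ∈ I ^ 1) : reesAlgebra I →+* TQt I b a ha := Ideal.Quotient.mk _

lemma mkT_surj (I b : Ideal R) (a : R) (ha : a ∈ I ^ 1) : Function.Surjective (mkT I b a ha) := Ideal.Quotient.mk_surjective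

lemma mkT_ker (I b : Ideal R) (a : R) (ha : a ∈ I ^ 1) : RingHom.ker (mkT I b a ha) = TQ I b a ha := Ideal.mk_ker

lemma mkT_eq (I b : Ideal R) (a : R) (ha : a ∈ I ^ 1) (x y) : mkT I b a ha x = mkT I b a ha y ↔ x - y ∈ TQ I b a ha := Ideal.Quotient.eq

lemma TQ_finite {I b : Ideal R} {a : R} (ha : a ∈ I ^ 1) (h : IsReduction (b ⊔ Ideal.span {a}) I) :
    {P : Ideal (reesAlgebra I) | P.IsPrime ∧ TQ I b a ha ≤ P}.Finite := by
  have hb : b ≤ I := le_sup_left.trans h.1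
  have haI : a ∈ I := by simpa using ha
  refine (Ideal.finite_minimalPrimes_of_isNoetherianRing (reesAlgebra I) (TQ I b a ha)).subset ?_
  rintro P ⟨hP, hP2⟩
  refine ⟨⟨hP, hP2⟩, ?_⟩
  rintro P' ⟨hP', hP'2⟩ hle
  by_contra hne
  -- generators
  obtain ⟨e, he⟩ := GenLE.exists b
  obtain ⟨bb, hbb⟩ := he.fin
  have hbbb : ∀ i, bb i ∈ b := fun i => hbb ▸ Ideal.subset_span ⟨i, rfl⟩
  let A : Option (Fin e) → R := fun o => o.elim a bb
  let c : Option (Fin e) → R := fun o => o.elim 1 (fun _ => 0)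
  have hA : ∀ i, A i ∈ I := by
    rintro (_ | i)
    · exact haI
    · exact hb (hbbb i)
  have hspan : Ideal.span (Set.range A) = b ⊔ Ideal.span {a} := by
    rw [← hbb, ← Ideal.span_union]; congr 1
    ext x
    simp only [Set.mem_range, Set.mem_union, Set.mem_singleton_iff]
    constructor
    · rintro ⟨_ | i, rfl⟩
      · exact Or.inr rfl
      · exact Or.inl ⟨i, rfl⟩
    · rintro (⟨i, rfl⟩ | rfl)
      · exact ⟨some i, rfl⟩
      · exact ⟨none, rfl⟩
  have hintg := Phi_integral I A hA (hspan ▸ h.2)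
  let mk := mkT I b a ha
  have hcomp : mk.comp (Phi I A hA).toRingHom = (mk.comp (algebraMap R (reesAlgebra I))).comp (MvPolynomial.eval c) := by
    apply MvPolynomial.ringHom_ext
    · intro r
      simp only [RingHom.comp_apply, MvPolynomial.eval_C]
      rw [← MvPolynomial.algebraMap_eq]
      have : (Phi I A hA).toRingHom (algebraMap R _ r) = algebraMap R (reesAlgebra I) r := (Phi I A hA).commutes r
      rw [this]
    · intro i
      simp only [RingHom.comp_apply, MvPolynomial.eval_X]
      have h1 : (Phi I A hA).toRingHom (MvPolynomial.X i) = tt I (n := 1) (x := A i) (by simpa using hA i) := 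
        MvPolynomial.aeval_X (R := R) (fun i => tt I (n := 1) (x := A i) (by simpa using hA i)) i
      rw [h1]
      apply (mkT_eq I b a ha _ _).2
      rcases i with _ | i
      · refine Ideal.mem_sup_right ?_
        simp only [c, A, Option.elim, map_one]
        exact Ideal.mem_span_singleton_self _
      · refine Ideal.mem_sup_left (Ideal.mem_sup_right ?_)
        simp only [c, A, Option.elim, map_zero, sub_zero]
        exact Ideal.subset_span ⟨bb i, hbbb i, rfl⟩
  have hint2 : (mk.comp (algebraMap R (reesAlgebra I))).IsIntegral := by
    refine RingHom.IsIntegral.tower_top (MvPolynomial.eval c) (mk.comp (algebraMap R (reesAlgebra I))) ?_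
    rw [← hcomp]
    exact RingHom.IsIntegral.trans _ _ hintg (RingHom.isIntegral_of_surjective _ (mkT_surj I b a ha))
  letI := (mk.comp (algebraMap R (reesAlgebra I))).toAlgebra
  haveI : Algebra.IsIntegral R (TQt I b a ha) := ⟨hint2⟩
  haveI : (P'.map mk).IsPrime := Ideal.map_isPrime_of_surjective (mkT_surj I b a ha) (by rwa [mkT_ker])
  haveI hPp : (P.map mk).IsPrime := Ideal.map_isPrime_of_surjective (mkT_surj I b a ha) (by rwa [mkT_ker])
  have hlt : P'.map mk < P.map mk := by
    refine lt_of_le_of_ne (Ideal.map_mono hle) fun heq => hne ?_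
    have h1 : (P'.map mk).comap mk = (P.map mk).comap mk := by rw [heq]
    rw [Ideal.comap_map_of_surjective' _ (mkT_surj I b a ha), Ideal.comap_map_of_surjective' _ (mkT_surj I b a ha), mkT_ker,
      sup_eq_left.2 hP2, sup_eq_left.2 hP'2] at h1
    exact h1.ge
  have h2 := Ideal.IsIntegral.comap_lt_comap (R := R) hlt
  have h3 : maximalIdeal R ≤ (P'.map mk).comap (algebraMap R (TQt I b a ha)) := by
    intro x hx
    show mk (algebraMap R _ x) ∈ P'.map mk
    have : mk (algebraMap R _ x) = 0 := by
      rw [← map_zero mk]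
      refine (mkT_eq I b a ha _ _).2 ?_
      rw [sub_zero]
      exact (Ideal.mem_sup_left (Ideal.mem_sup_left (Ideal.mem_map_of_mem _ hx)))
    rw [this]; exact Ideal.zero_mem _
  have h4 : (P.map mk).comap (algebraMap R (TQt I b a ha)) ≤ maximalIdeal R := 
    IsLocalRing.le_maximalIdeal (Ideal.IsPrime.ne_top inferInstance)
  exact absurd (h2.trans_le (h4.trans h3)) (lt_irrefl _)

/-- Lemma X -/
lemma lemX {I b : Ideal R} {a : R} (h : IsReduction (b ⊔ Ideal.span {a}) I) : 
    ∃ YY : Set (Ideal R), YY.Finite ∧ (∀ Y ∈ YY, a ∉ Y ∧ ∀ J', IsReduction J' I → ¬ J' ≤ Y) ∧ 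
      ∀ y ∈ I, (∀ Y ∈ YY, y ∉ Y) → IsReduction (b ⊔ Ideal.span {y}) I := by
  have hb : b ≤ I := le_sup_left.trans h.1
  have haI : a ∈ I := h.1 (Ideal.mem_sup_right (Ideal.mem_span_singleton_self _))
  have ha : a ∈ I ^ 1 := by simpa using haI
  refine ⟨deg1 I '' {P : Ideal (reesAlgebra I) | P.IsPrime ∧ TQ I b a ha ≤ P}, (TQ_finite ha h).image _, ?_, ?_⟩
  · rintro _ ⟨P, ⟨hP, hP2⟩, rfl⟩
    have haP : tt I ha ∉ P := by
      intro hc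
      have h1 : tt I ha - 1 ∈ P := hP2 (Ideal.mem_sup_right (Ideal.mem_span_singleton_self _))
      apply hP.ne_top
      rw [Ideal.eq_top_iff_one]
      have := P.sub_mem hc h1
      simpa using this
    refine ⟨fun hc => haP ((mem_deg1 ha).1 hc), ?_⟩
    intro J' hJ' hle
    obtain ⟨r, hr⟩ := hJ'.2
    have h1 : ∀ c ∈ J' * I ^ r, ∀ z : reesAlgebra I, (z : Polynomial R) = Polynomial.monomial (r+1) c → z ∈ P := by
      intro c hc
      have hmemI : ∀ c ∈ J' * I ^ r, c ∈ I ^ (r+1) := fun c hc => hr ▸ hc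
      induction hc using Submodule.mul_induction_on' with
      | mem_mul_mem m hm n hn =>
        intro z hz
        obtain ⟨w, hw, hw2⟩ := hle hm
        have : z = w * tt I hn := by
          apply Subtype.ext
          rw [hz, MulMemClass.coe_mul, hw2, tt, Polynomial.monomial_mul_monomial, add_comm]
        rw [this]
        exact P.mul_mem_right _ hw
      | add x hx y hy h1 h2 =>
        intro z hz
        have : z = tt I (hmemI x hx) + tt I (hmemI y hy) := by
          apply Subtype.ext
          rw [hz, AddMemClass.coe_add, tt, tt, map_add]
        rw [this]
        exact P.add_mem (h1 _ rfl) (h2 _ rfl)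
    have h2 : tt I ha ^ (r+1) ∈ P := by
      refine h1 (a ^ (r+1)) (hr ▸ Ideal.pow_mem_pow haI _) _ ?_
      rw [SubmonoidClass.coe_pow, tt, Polynomial.monomial_pow]; simp
    exact haP (hP.mem_of_pow_mem _ h2)
  · intro y hy hY
    have hy1 : y ∈ I ^ 1 := by simpa using hy
    -- unit
    have h1 : TQ I b a ha ⊔ Ideal.span {tt I hy1} = ⊤ := by
      by_contra hc
      obtain ⟨P, hP, hP2⟩ := Ideal.exists_le_maximal _ hc
      exact hY _ ⟨P, ⟨hP.isPrime, le_sup_left.trans hP2⟩, rfl⟩ ((mem_deg1 hy1).2 (hP2 (Ideal.mem_sup_right (Ideal.mem_span_singleton_self _))))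
    obtain ⟨z, hz⟩ := mem_sup_span.1 (h1 ▸ (Submodule.mem_top : (1 : reesAlgebra I) ∈ _))
    obtain ⟨w, hw⟩ := TQ_rel ha hb hz
    have hyb : b ⊔ Ideal.span {y} ≤ I := sup_le hb (by rwa [Ideal.span_singleton_le_iff_mem])
    set B := b ⊔ Ideal.span {y} with hB
    have hwm : ∀ j, (w : Polynomial R).coeff j ∈ I ^ j := (mem_reesAlgebra_iff I _).1 w.2
    have hzm : ∀ j, (z : Polynomial R).coeff j ∈ I ^ j := (mem_reesAlgebra_iff I _).1 z.2
    have hco : ∀ j, ((1 - tt I hy1 * z : reesAlgebra I) : Polynomial R).coeff (j+1) = - (y * (z : Polynomial R).coeff j) := by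
      intro j
      simp only [AddSubgroupClass.coe_sub, MulMemClass.coe_mul, OneMemClass.coe_one, tt]
      rw [← Polynomial.C_mul_X_eq_monomial, mul_assoc, Polynomial.coeff_sub, Polynomial.coeff_C_mul, Polynomial.coeff_X_mul, 
        Polynomial.coeff_one]
      simp
    have h0 : 1 + (w : Polynomial R).coeff 0 ∈ maximalIdeal R := by
      have := (hw 0).2
      have e : ((1 - tt I hy1 * z : reesAlgebra I) : Polynomial R).coeff 0 = 1 := by
        simp only [AddSubgroupClass.coe_sub, MulMemClass.coe_mul, OneMemClass.coe_one, tt]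
        rw [← Polynomial.C_mul_X_eq_monomial, mul_assoc, Polynomial.coeff_sub, Polynomial.coeff_C_mul, Polynomial.coeff_X_mul_zero]
        simp
      rwa [e] at this
    have hind : ∀ j, a ^ (j+1) + (w : Polynomial R).coeff (j+1) ∈ B * I ^ j ⊔ maximalIdeal R * I ^ (j+1) := by
      have hstep : ∀ j, a * (w : Polynomial R).coeff j - (w : Polynomial R).coeff (j+1) ∈ B * I ^ j ⊔ maximalIdeal R * I ^ (j+1) := by
        intro j
        have h2 := (hw j).1
        rw [hco] at h2
        have h3 : y * (z : Polynomial R).coeff j ∈ B * I ^ j ⊔ maximalIdeal R * I ^ (j+1) := 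
          Ideal.mem_sup_left (Ideal.mul_mem_mul (Ideal.mem_sup_right (Ideal.mem_span_singleton_self _)) (hzm j))
        have h4 := (sup_le_sup_right (Ideal.mul_mono_left le_sup_left) (maximalIdeal R * I ^ (j+1)) : b * I ^ j ⊔ _ ≤ B * I ^ j ⊔ _) h2
        have := Ideal.add_mem _ h4 h3
        have := Ideal.neg_mem_iff _ |>.2 this
        convert this using 1; ring
      intro j
      induction j with
      | zero =>
        have h5 : a * (1 + (w : Polynomial R).coeff 0) ∈ B * I ^ 0 ⊔ maximalIdeal R * I ^ (0+1) := by
          refine Ideal.mem_sup_right ?_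
          rw [mul_comm a]
          exact Ideal.mul_mem_mul h0 ha
        have := Ideal.sub_mem _ h5 (hstep 0)
        convert this using 1; ring
      | succ j ih =>
        have h5 : a * (a ^ (j+1) + (w : Polynomial R).coeff (j+1)) ∈ B * I ^ (j+1) ⊔ maximalIdeal R * I ^ (j+1+1) := by
          have : I * (B * I ^ j ⊔ maximalIdeal R * I ^ (j+1)) ≤ B * I ^ (j+1) ⊔ maximalIdeal R * I ^ (j+1+1) := by
            rw [Ideal.mul_sup, mul_left_comm, mul_left_comm I, ← pow_succ', ← pow_succ']
          exact this (Ideal.mul_mem_mul haI ih)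
        have := Ideal.sub_mem _ h5 (hstep (j+1))
        convert this using 1; ring
    set N := (w : Polynomial R).natDegree
    have hN : a ^ (N+1) ∈ B * I ^ N ⊔ maximalIdeal R * I ^ (N+1) := by
      have := hind N
      rwa [Polynomial.coeff_eq_zero_of_natDegree_lt (Nat.lt_succ_self _), add_zero] at this
    obtain ⟨r, hr⟩ := h.2
    have h4 := pow_aux I b a haI hb (N+1)
    have h5 : I ^ (r + (N + 1) + 1) ≤ B * I ^ (r+(N+1)) ⊔ maximalIdeal R * I ^ (r + (N+1) + 1) := by
      calc I ^ (r + (N+1) + 1) = (I * (b ⊔ Ideal.span {a}) ^ (N+1)) * I ^ r := by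
            rw [pow_succ, IsReduction.pow hr (N+1)]; ring
        _ ≤ (B * I ^ (N+1) ⊔ maximalIdeal R * I ^ (N+1+1)) * I ^ r := by
            refine Ideal.mul_mono_left (h4.trans (sup_le ?_ (le_sup_of_le_left (Ideal.mul_mono_left le_sup_left))))
            rw [pow_succ I (N+1), ← mul_assoc, pow_succ I N, ← mul_assoc, ← Ideal.sup_mul, ← pow_succ]
            refine Ideal.mul_mono_left ?_
            rwa [Ideal.span_singleton_le_iff_mem]
        _ = _ := by
          rw [Ideal.sup_mul]
          congr 1
          · rw [mul_assoc, ← pow_add, add_comm (N+1)]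
          · rw [mul_assoc, ← pow_add]; congr 2; omega
    exact IsReduction.of_le hyb (nakayama h5)

end A16
end Part16

section Part17
set_option linter.all false

section A17
variable {R : Type u} [CommRing R] [IsLocalRing R] [IsNoetherianRing R]

lemma IsReduction.mp {J I : Ideal R} (h : IsReduction J I) (p : Ideal R) [p.IsPrime] :
    IsReduction (mp p J) (mp p I) := by
  obtain ⟨h1, r, hr⟩ := h
  refine ⟨Ideal.map_mono h1, r, ?_⟩
  rw [← Ideal.map_pow, hr, Ideal.map_mul, Ideal.map_pow]

lemma mp_sup (p : Ideal R) [p.IsPrime] (A B : Ideal R) : CPU.mp p (A ⊔ B) = CPU.mp p A ⊔ CPU.mp p B := Ideal.map_sup _ _ _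

lemma mp_span (p : Ideal R) [p.IsPrime] (A : Set R) : CPU.mp p (Ideal.span A) = Ideal.span (toL p '' A) := Ideal.map_span _ _

open Classical in
lemma lemZ_aux [Infinite (ResidueField R)] {I J : Ideal R} {g l d : ℕ} (H : Amb I g l d) (hJ : IsReduction J I)
    (p : Ideal R) [hp : p.IsPrime] : ∀ (k : ℕ) (B : Finset (Lp p)) (s : ℕ) (b : Ideal R), B.card = k → s + k < l →
      Good I g l s b → b ≤ J → IsReduction (mp p b ⊔ Ideal.span (B : Set (Lp p))) (mp p I) →
      ∃ s b, s < l ∧ Good I g l s b ∧ b ≤ J ∧ IsReduction (mp p b) (mp p I) := by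
  intro k
  induction k with
  | zero =>
    intro B s b hB hs hb hbJ hr
    rw [Finset.card_eq_zero] at hB
    subst hB
    refine ⟨s, b, hs, hb, hbJ, ?_⟩
    simpa using hr
  | succ k ih =>
    intro B s b hB hs hb hbJ hr
    obtain ⟨f, hf⟩ : B.Nonempty := Finset.card_pos.1 (by omega)
    have hr' : IsReduction ((mp p b ⊔ Ideal.span ((B.erase f : Finset (Lp p)) : Set (Lp p))) ⊔ Ideal.span {f}) (mp p I) := by
      rw [sup_assoc, ← Ideal.span_union]
      convert hr using 3
      conv_rhs => rw [← Finset.insert_erase hf]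
      rw [Finset.coe_insert, Set.union_comm]; rfl
    obtain ⟨YY, hYf, hY1, hY2⟩ := lemX hr'
    obtain ⟨XX, hXf, hX1, hX2⟩ := Good.step H hb (by omega)
    obtain ⟨x, hxJ, hx⟩ := avoid_ideals (J := J) (XX := XX ∪ (Ideal.comap (toL p)) '' YY) (hXf.union (hYf.image _)) (by
      rintro X (hX | ⟨Y, hY, rfl⟩)
      · exact hX1 X hX J hJ
      · intro hle
        exact (hY1 Y hY).2 _ (hJ.mp p) (Ideal.map_le_iff_le_comap.2 hle))
    have h1 := hX2 x (hJ.1 hxJ) (fun X hX => hx X (Or.inl hX))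
    have h2 := hY2 (toL p x) (Ideal.mem_map_of_mem _ (hJ.1 hxJ)) (fun Y hY => hx _ (Or.inr ⟨Y, hY, rfl⟩))
    refine ih (B.erase f) (s+1) (b ⊔ Ideal.span {x}) (by rw [Finset.card_erase_of_mem hf]; omega) (by omega) h1 
      (sup_le hbJ (by rwa [Ideal.span_singleton_le_iff_mem])) ?_
    convert h2 using 1
    rw [mp_sup, mp_span, Set.image_singleton, sup_right_comm]

lemma lemZ [Infinite (ResidueField R)] {I J : Ideal R} {g l d : ℕ} (H : Amb I g l d) (hJ : IsReduction J I)
    (p : Ideal R) [hp : p.IsPrime] (hle : col J I ≤ p) {β : Ideal (Lp p)} {e : ℕ} (hβ : GenLE β e) (he : e < l) 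
    (hr : IsReduction β (mp p I)) : False := by
  obtain ⟨B, hB, rfl⟩ := hβ
  obtain ⟨s, b, hs, hb, hbJ, h1⟩ := lemZ_aux H hJ p B.card B 0 ⊥ rfl (by omega) (Good.base H) bot_le (by simpa using hr)
  have hN : col b I ≤ p := (col_mono hbJ).trans hle
  obtain ⟨P, hP, hPp⟩ := Ideal.exists_minimalPrimes_le hN
  have h2 := hb.ass hs (assP_of_minimalPrimes hP)
  haveI := hP.1.1
  have h3 := loc_assP (p := p) (assP_of_minimalPrimes hP) hPp
  have h4 : mp p I ≤ mp p P := h1.le_prime h3.1 (Ideal.map_mono (le_col.trans hP.1.2))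
  apply h2
  intro x hx
  obtain ⟨s, hs, hs2⟩ := loc_le.1 h4 x hx
  exact (hP.1.1.mem_or_mem hs2).resolve_left fun hc => hs (hPp hc)

lemma inf_res_loc [Infinite (ResidueField R)] (p : Ideal R) [hp : p.IsPrime] : Infinite (ResidueField (Lp p)) := by
  obtain ⟨S, hS, hS2⟩ := inf_units (R := R)
  haveI := hS.to_subtype
  refine Infinite.of_injective (fun s : S => residue (Lp p) (toL p s)) ?_
  intro a b hab
  by_contra hne
  have h1 := hS2 a a.2 b b.2 (fun h => hne (Subtype.ext h))
  have h2 : residue (Lp p) (toL p (a - b)) = 0 := by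
    rw [map_sub, map_sub]; exact sub_eq_zero.2 hab
  exact (h1.map ((residue (Lp p)).comp (toL p))).ne_zero h2

open Classical in
lemma fitting_gen {I : Ideal R} {l : ℕ} (p : Ideal R) [hp : p.IsPrime] (h : ¬ fittingIdeal I l ≤ p) : GenLE (mp p I) l := by
  unfold fittingIdeal at h
  simp only [iSup_le_iff, not_forall] at h
  obtain ⟨n, π, hπ, h⟩ := h
  rw [Ideal.span_le, Set.not_subset] at h
  obtain ⟨dd, ⟨v, r, hv, rfl⟩, hd⟩ := h
  have hinj : Function.Injective r := by
    intro i j hij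
    by_contra hne
    apply hd
    rw [Matrix.det_zero_of_row_eq hne (by ext k; simp [hij])]
    exact p.zero_mem
  set M : Matrix (Fin (n-l)) (Fin (n-l)) R := Matrix.of fun i k => v k (r i) with hM
  let e : Fin n → R := fun j => π (Pi.single j 1)
  have hπe : ∀ w, π w = ∑ j, w j * e j := by
    intro w
    conv_lhs => rw [← LinearMap.sum_single_apply (φ := fun _ : Fin n => R) w]
    rw [map_sum]
    refine Finset.sum_congr rfl fun j _ => ?_
    rw [← smul_eq_mul, ← map_smul]
    congr 1
    ext i
    simp [Pi.single_apply]
  let C : Finset (Fin n) := Finset.univ \ Finset.univ.image r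
  have hC : C.card ≤ l := by
    rw [Finset.card_sdiff_of_subset (Finset.subset_univ _), Finset.card_image_of_injective _ hinj]
    simp only [Finset.card_univ, Fintype.card_fin]; omega
  refine ⟨C.image (fun j => toL p (e j)), Finset.card_image_le.trans hC, ?_⟩
  set G := Ideal.span (e '' (C : Set (Fin n))) with hG
  have hGI : Ideal.span ((C.image (fun j => toL p (e j)) : Finset (Lp p)) : Set (Lp p)) = mp p G := by
    rw [hG, mp_span, Finset.coe_image, Set.image_image]
  rw [hGI]
  have he : ∀ j, e j ∈ I := fun j => hπ ▸ ⟨_, rfl⟩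
  refine le_antisymm (Ideal.map_mono ?_) ?_
  · rw [hG, Ideal.span_le]; rintro _ ⟨j, _, rfl⟩; exact he j
  · rw [loc_le]
    intro x hx
    refine ⟨M.det, hd, ?_⟩
    -- each det * e (r i) ∈ G
    have hk : ∀ k, ∑ i, v k (r i) * e (r i) ∈ G := by
      intro k
      have h1 := hv k
      rw [hπe, ← Finset.sum_sdiff (Finset.subset_univ (Finset.univ.image r)), Finset.sum_image (fun a _ b _ h => hinj h)] at h1
      rw [eq_neg_of_add_eq_zero_right h1]
      refine G.neg_mem (G.sum_mem fun j hj => G.mul_mem_left _ (Ideal.subset_span ⟨j, hj, rfl⟩))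
    have hri : ∀ i, M.det * e (r i) ∈ G := by
      intro i0
      have h1 : ∑ k, M.adjugate k i0 * ∑ i, v k (r i) * e (r i) ∈ G := G.sum_mem fun k _ => G.mul_mem_left _ (hk k)
      convert h1 using 1
      have h2 : ∀ i, ∑ k, M i k * M.adjugate k i0 = if i = i0 then M.det else 0 := by
        intro i
        have := congrFun (congrFun (Matrix.mul_adjugate M) i) i0
        rw [Matrix.mul_apply] at this
        rw [this, Matrix.smul_apply, Matrix.one_apply]; simp
      simp_rw [Finset.mul_sum]
      rw [Finset.sum_comm]
      have h3 : ∀ i, ∑ k, M.adjugate k i0 * (v k (r i) * e (r i)) = (if i = i0 then M.det else 0) * e (r i) := by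
        intro i
        rw [← h2, Finset.sum_mul]
        refine Finset.sum_congr rfl fun k _ => ?_
        rw [hM, Matrix.of_apply]; ring
      simp_rw [h3]
      simp
    have hall : ∀ j, M.det * e j ∈ G := by
      intro j
      by_cases hj : j ∈ C
      · exact G.mul_mem_left _ (Ideal.subset_span ⟨j, hj, rfl⟩)
      · have : j ∈ Finset.univ.image r := by
          by_contra hc; exact hj (Finset.mem_sdiff.2 ⟨Finset.mem_univ _, hc⟩)
        obtain ⟨i, _, rfl⟩ := Finset.mem_image.1 this
        exact hri i
    rw [← hπ] at hx
    obtain ⟨w, rfl⟩ := hx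
    rw [hπe, Finset.mul_sum]
    refine G.sum_mem fun j _ => ?_
    rw [mul_left_comm]
    exact G.mul_mem_left _ (hall j)

lemma GenLE.mp {J : Ideal R} {e : ℕ} (h : GenLE J e) (p : Ideal R) [hp : p.IsPrime] : GenLE (mp p J) e := by
  classical
  obtain ⟨f, hf, rfl⟩ := h
  refine ⟨f.image (toL p), Finset.card_image_le.trans hf, ?_⟩
  rw [mp_span, Finset.coe_image]

/-- the associated primes of `I/J` are in `QSet` -/
lemma mem_QSet [Infinite (ResidueField R)] {I J : Ideal R} {g l d : ℕ} (H : Amb I g l d) (hJ : IsReduction J I) 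
    (hl : 1 ≤ l) (hgood : Good I g l l J) (p : Ideal R) (hp : AssP I J p) : 
    (⟨p, hp.1⟩ : PrimeSpectrum R) ∈ QSet I l ∧ p.height = l := by
  haveI := hp.1
  obtain ⟨_, u, hu, hu2⟩ := hp
  have hp : AssP I J p := ⟨‹_›, u, hu, hu2⟩
  have hcol : col J I ≤ p := fun r hr => (hu2 r).2 (mem_col.1 hr u hu)
  have hh : p.height = l := le_antisymm (hgood.pureI p hp) (hgood.hB p hp.1 hcol)
  have hgen : GenLE J l := hgood.gen
  refine ⟨⟨?_, ?_, ?_⟩, hh⟩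
  · by_contra hc
    have h1 := fitting_gen p hc
    have hne : mp p J ≠ mp p I := by
      intro he
      obtain ⟨s, hs, hs2⟩ := loc_mem.1 (he ▸ Ideal.mem_map_of_mem (toL p) hu : toL p u ∈ mp p J)
      exact hs ((hu2 s).2 hs2)
    obtain ⟨_, b, hb, hb2, hb3⟩ := hyp (Ideal.map_mono hJ.1) h1 hne
    exact lemZ H hJ p hcol hb2 (by omega) ((hJ.mp p).of_sup hb hb3)
  · have := rDim_loc (p := p)
    rw [hh] at this
    exact this
  · refine le_antisymm (fiber_le_gen (hJ.mp p) (hgen.mp p)) ?_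
    obtain ⟨k, rfl⟩ : ∃ k, l = k + 1 := ⟨l - 1, by omega⟩
    refine wb_succ fun hc => ?_
    haveI := inf_res_loc p
    obtain ⟨J', _, h1, h2⟩ := exists_small (hJ.mp p) hc
    exact lemZ H hJ p hcol h2 (by omega) h1

end A17
end Part17

section Part18
set_option linter.all false

section A18
variable {R : Type u} [CommRing R] [IsLocalRing R] [IsNoetherianRing R]

/-- all subsets are good -/
def AG (I : Ideal R) (g l : ℕ) (F : Finset R) : Prop := ∀ T ⊆ F, Good I g l T.card (Ideal.span (T : Set R))

structure Win (I : Ideal R) (g l d : ℕ) (F : Finset R) : Prop where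
  amb : Amb I g l d
  red : IsReduction (Ideal.span (F : Set R)) I
  card : F.card = l
  ag : AG I g l F

open Classical in
noncomputable def bb (F : Finset R) (a : R) : Ideal R := Ideal.span ((F.erase a : Finset R) : Set R)

lemma bb_sup {F : Finset R} {a : R} (ha : a ∈ F) : bb F a ⊔ Ideal.span {a} = Ideal.span (F : Set R) := by
  classical
  unfold bb
  rw [← Ideal.span_union]
  conv_rhs => rw [← Finset.insert_erase ha, Finset.coe_insert]
  rw [Set.union_comm]
  congr 2

variable {I : Ideal R} {g l d : ℕ} {F : Finset R}

lemma Win.reg_gen (h : Win I g l d F) {T : Finset R} (hT : T ⊆ F) {c : R} (hc : c ∈ F) (hcT : c ∉ T) :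
    Reg ⊤ (col (Ideal.span (T : Set R)) I) c := by
  classical
  refine reg_of_avoid fun q hq hcq => ?_
  have hlt : T.card < l := by
    rw [← h.card]
    exact Finset.card_lt_card ⟨hT, fun hc' => hcT (hc' hc)⟩
  have h1 := (h.ag T hT).pureI q (assP_col hq)
  have h2 := (h.ag T hT).ass hlt hq
  have hins : insert c T ⊆ F := Finset.insert_subset hc hT
  have h3 := (h.ag _ hins).hB q hq.1 (by
    intro x hx
    obtain ⟨i, hi, hiq⟩ := Set.not_subset.1 h2
    have h4 := mem_col.1 hx i hi
    have h5 : Ideal.span ((insert c T : Finset R) : Set R) ≤ q := by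
      rw [Finset.coe_insert, Ideal.span_insert]
      refine sup_le (by rwa [Ideal.span_singleton_le_iff_mem]) (le_col.trans hq.le)
    exact (hq.1.mem_or_mem (h5 h4)).resolve_right hiq)
  rw [Finset.card_insert_of_notMem hcT] at h3
  have := h3.trans h1
  exact absurd (by exact_mod_cast this : T.card + 1 ≤ T.card) (by omega)

lemma Win.memI (h : Win I g l d F) {a : R} (ha : a ∈ F) : a ∈ I := h.red.1 (Ideal.subset_span ha)

lemma Win.card_erase (h : Win I g l d F) {a : R} (ha : a ∈ F) [DecidableEq R] : (F.erase a).card < l := by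
  rw [Finset.card_erase_of_mem ha, h.card]
  have : 0 < F.card := Finset.card_pos.2 ⟨a, ha⟩
  have := h.card
  omega

lemma Win.bbI (h : Win I g l d F) (a : R) : bb F a ≤ I := by
  classical
  exact (Ideal.span_mono (by simpa using Finset.erase_subset a F)).trans h.red.1

lemma Win.reg (h : Win I g l d F) {a : R} (ha : a ∈ F) : Reg ⊤ (col (bb F a) I) a := by
  classical
  exact h.reg_gen (Finset.erase_subset a F) ha (Finset.notMem_erase a F)

lemma Win.inter (h : Win I g l d F) {a : R} (ha : a ∈ F) : col (bb F a) I ⊓ I ≤ bb F a := by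
  classical
  exact (h.ag _ (Finset.erase_subset a F)).inter (h.card_erase ha)

/-- `((a)+N) ∩ I = J` -/
lemma Win.interJ (h : Win I g l d F) {a : R} (ha : a ∈ F) {z : R} (hz : z ∈ I) (hz2 : z ∈ col (bb F a) I ⊔ Ideal.span {a}) :
    z ∈ Ideal.span (F : Set R) := by
  obtain ⟨r, hr⟩ := mem_sup_span.1 hz2
  have h1 : z - a * r ∈ bb F a := h.inter ha ⟨hr, I.sub_mem hz (I.mul_mem_right _ (h.memI ha))⟩
  rw [← bb_sup ha]
  exact mem_sup_span.2 ⟨r, h1⟩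

/-- data from the statement -/
def HQ (I : Ideal R) (g l : ℕ) : Prop := ∀ p ∈ QSet I l,
      IsGorensteinLocalRing (Localization.AtPrime p.asIdeal) ∧
      ∀ j : ℕ, 1 ≤ j → j ≤ l - g →
        (l : WithBot ℕ∞) + 1 ≤
          (qDepth (Localization.AtPrime p.asIdeal)
            (Ideal.map (algebraMap R (Localization.AtPrime p.asIdeal)) (I ^ j)) : WithBot ℕ∞)
            + (g : WithBot ℕ∞) + (j : WithBot ℕ∞)

lemma depth_arith {q : ℕ∞} {l g j : ℕ} (h : (l : WithBot ℕ∞) + 1 ≤ (q : WithBot ℕ∞) + (g : WithBot ℕ∞) + (j : WithBot ℕ∞)) 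
    (hj : j ≤ l - g) (hgl : g < l) : ((l - g - j + 1 : ℕ) : ℕ∞) ≤ q := by
  have h : (l : ℕ∞) + 1 ≤ q + g + j := by exact_mod_cast h
  cases q with
  | top => exact le_top
  | coe q =>
    have : l + 1 ≤ q + g + j := by exact_mod_cast h
    exact_mod_cast (by omega : l - g - j + 1 ≤ q)

lemma Win.goodL (h : Win I g l d F) : Good I g l l (Ideal.span (F : Set R)) := by
  have := h.ag F (Finset.Subset.refl _)
  rwa [h.card] at this

lemma Win.loc_rad (h : Win I g l d F) {a : R} (ha : a ∈ F) (p : Ideal R) [hp : p.IsPrime] (hh : p.height = l) :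
    ∃ N, maximalIdeal (Lp p) ^ N ≤ mp p I ⊔ mp p (col (bb F a) I) := by
  classical
  have h1 : maximalIdeal (Lp p) ≤ (mp p I ⊔ mp p (col (bb F a) I)).radical := by
    rw [Ideal.radical_eq_sInf]
    refine le_sInf fun Q hQ => ?_
    obtain ⟨hQ1, hQ2⟩ := hQ
    have hQm : Q ≤ maximalIdeal (Lp p) := IsLocalRing.le_maximalIdeal hQ2.ne_top
    haveI : (Q.comap (toL p)).IsPrime := Ideal.IsPrime.comap _
    have hq : Q.comap (toL p) ≤ p := by
      intro x hx
      by_contra hc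
      exact hQ2.ne_top (Ideal.eq_top_of_isUnit_mem _ hx (loc_unit hc))
    have h2 := (h.ag _ (Finset.erase_subset a F)).not_le (h.card_erase ha) (q := Q.comap (toL p)) inferInstance 
      (Ideal.map_le_iff_le_comap.1 (le_sup_left.trans hQ1)) (Ideal.map_le_iff_le_comap.1 (le_sup_right.trans hQ1))
    have h3 : (F.erase a).card + 1 = l := by
      rw [Finset.card_erase_add_one ha, h.card]
    rw [h3, ← hh] at h2
    have h4 : Q.comap (toL p) = p := by
      by_contra hne
      have hlt : Q.comap (toL p) < p := lt_of_le_of_ne hq hne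
      haveI : (Q.comap (toL p)).FiniteHeight := by infer_instance
      have := Ideal.height_strict_mono_of_isPrime hlt
      exact absurd this (not_lt.2 h2)
    rw [← mp_self_max]
    exact Ideal.map_le_iff_le_comap.2 h4.ge
  obtain ⟨N, hN⟩ := Ideal.exists_radical_pow_le_of_fg (mp p I ⊔ mp p (col (bb F a) I)) (IsNoetherian.noetherian _)
  exact ⟨N, (Ideal.pow_right_mono h1 N).trans hN⟩

lemma Win.E [Infinite (ResidueField R)] (h : Win I g l d F) (hQ : HQ I g l) {a : R} (ha : a ∈ F) {z : R} (hz : z ∈ I) 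
    (hE : ∀ i ∈ I ^ (l - g), z * i ∈ col (bb F a) I ⊔ Ideal.span {a} * I ^ (l - g)) : z ∈ Ideal.span (F : Set R) := by
  classical
  by_cases hgl : g < l
  swap
  · have : l - g = 0 := by omega
    rw [this, pow_zero, Ideal.one_eq_top] at hE
    have := hE 1 Submodule.mem_top
    rw [mul_one, Ideal.mul_top] at this
    exact h.interJ ha hz this
  by_contra hzJ
  obtain ⟨p, hp, hp2⟩ := exists_assP hz hzJ
  haveI := hp.1
  obtain ⟨hpQ, hph⟩ := mem_QSet h.amb h.red (by omega) h.goodL p hp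
  obtain ⟨hGor, hdep⟩ := hQ _ hpQ
  have hIp : I ≤ p := h.red.le_prime hp.1 hp.le
  set L : List R := (F.erase a).toList ++ [a] with hL
  have hLlen : L.length = l := by
    rw [hL, List.length_append, Finset.length_toList, List.length_singleton, Finset.card_erase_add_one ha, h.card]
  have hLnd : L.Nodup := by
    rw [hL, List.nodup_append]
    refine ⟨Finset.nodup_toList _, List.nodup_singleton _, ?_⟩
    intro x hx y hy
    rw [List.mem_singleton] at hy
    rw [Finset.mem_toList, Finset.mem_erase] at hx
    rw [hy]; exact hx.1
  have hLF : ∀ x ∈ L, x ∈ F := by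
    intro x hx
    rw [hL, List.mem_append, Finset.mem_toList, List.mem_singleton] at hx
    rcases hx with hx | rfl
    · exact Finset.mem_of_mem_erase hx
    · exact ha
  let T : ℕ → Finset R := fun i => (L.take i).toFinset
  let c : ℕ → R := fun i => L.getD i 0
  have hTF : ∀ i, T i ⊆ F := fun i x hx => hLF x (List.mem_of_mem_take (List.mem_toFinset.1 hx))
  have hTc : ∀ i, i ≤ l → (T i).card = i := by
    intro i hi
    rw [List.toFinset_card_of_nodup (hLnd.sublist (List.take_sublist i L)), List.length_take, hLlen]; omega
  have hc : ∀ i (hi : i < l), c i = L[i]'(by omega) := fun i hi => List.getD_eq_getElem _ _ (by omega)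
  have hcF : ∀ i < l, c i ∈ F := fun i hi => by rw [hc i hi]; exact hLF _ (List.getElem_mem _)
  have hTS : ∀ i < l, T (i+1) = insert (c i) (T i) := by
    intro i hi
    ext x
    rw [Finset.mem_insert, hc i hi]
    simp only [T]
    rw [List.take_succ_eq_append_getElem (by omega), List.mem_toFinset, List.mem_toFinset, List.mem_append, List.mem_singleton, or_comm]
  have hcT : ∀ i < l, c i ∉ T i := by
    intro i hi hmem
    have h1 := hTS i hi
    rw [Finset.insert_eq_of_mem hmem] at h1
    have h2 := hTc (i+1) (by omega)
    rw [h1, hTc i (by omega)] at h2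
    omega
  have hTl : T (l - 1) = F.erase a := by
    simp only [T, hL]
    rw [List.take_left' (by rw [Finset.length_toList, Finset.card_erase_of_mem ha, h.card])]
    simp
  have hcl : c (l - 1) = a := by
    simp only [c, hL]
    rw [List.getD_append_right _ _ _ _ (by rw [Finset.length_toList, Finset.card_erase_of_mem ha, h.card])]
    rw [Finset.length_toList, Finset.card_erase_of_mem ha, h.card]; simp
  let aa : ℕ → Ideal R := fun i => Ideal.span (T i : Set R)
  have haaS : ∀ i, aa (i+1) = aa i ⊔ Ideal.span {c i} := by
    intro i
    by_cases hi : i < l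
    · simp only [aa]
      rw [hTS i hi, Finset.coe_insert, Ideal.span_insert, sup_comm]
    · have h1 : c i = 0 := List.getD_eq_default _ _ (by omega)
      have h2 : T (i+1) = T i := by
        simp only [T]; rw [List.take_of_length_le (by omega), List.take_of_length_le (by omega)]
      simp only [aa]
      rw [h1, h2]; simp
  have hgood : ∀ i, i ≤ l → Good I g l i (aa i) := by
    intro i hi
    have := h.ag (T i) (hTF i)
    rwa [hTc i hi] at this
  have LE : LocE (mp p I) (fun i => toL p (c i)) l g (fun i => mp p (aa i)) (fun i => mp p (col (aa i) I)) := by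
    refine ⟨?_, hgl, ?_, ?_, ?_, ?_, ?_, ?_, ?_, ?_, ?_, ?_⟩
    · rw [← mp_self_max]; exact Ideal.map_mono hIp
    · intro i hi; exact Ideal.mem_map_of_mem _ (h.memI (hcF i hi))
    · simp [aa, T, mp]
    · intro i; rw [haaS, mp_sup, mp_span p {c i}, Set.image_singleton]
    · intro i; exact loc_colon
    · intro i hi
      have h1 := (hgood i hi.le).inter hi
      rintro x ⟨hx1, hx2⟩
      obtain ⟨y, w, hw, rfl⟩ := loc_rep x
      have hx1 := (unit_mul_mem hw).1 hx1
      have hx2 := (unit_mul_mem hw).1 hx2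
      refine (unit_mul_mem hw).2 ?_
      obtain ⟨s, hs, hs2⟩ := loc_mem.1 hx1
      obtain ⟨s', hs', hs2'⟩ := loc_mem.1 hx2
      refine loc_mem.2 ⟨s * s', fun hc => (hp.1.mem_or_mem hc).elim hs hs', h1 ⟨?_, ?_⟩⟩
      · have := (col (aa i) I).mul_mem_left s' hs2
        rwa [show s * s' * y = s' * (s * y) by ring]
      · have := I.mul_mem_left s hs2'
        rwa [show s * s' * y = s * (s' * y) by ring]
    · intro i hi
      have := loc_reg (p := p) (h.reg_gen (hTF i) (hcF i hi) (hcT i hi))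
      rwa [mp, Ideal.map_top] at this
    · have := h.loc_rad ha p hph
      simp only [aa]
      rw [hTl]
      exact this
    · intro i hi
      rw [(hgood i (by omega)).K_eq h.amb hi]
    · intro j hj hj2
      have := DD_of_qDepth (depth_arith (hdep j hj hj2) hj2 hgl)
      rwa [Ideal.map_pow] at this
    · exact Gor.mat hGor (h.amb.cm.loc p hph)
  have hfin := LE.E (z := toL p z) (by
    intro i hi
    obtain ⟨y, w, hw, rfl⟩ := loc_rep i
    rw [← Ideal.map_pow] at hi
    obtain ⟨s, hs, hs2⟩ := loc_mem.1 ((unit_mul_mem hw).1 hi)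
    have h1 := hE _ hs2
    have h2 : toL p (z * (s * y)) ∈ mp p (col (bb F a) I ⊔ Ideal.span {a} * I ^ (l-g)) := Ideal.mem_map_of_mem _ h1
    simp only [aa]
    rw [hTl, hcl]
    have e : toL p z * (w * toL p y) = w * (toL p z * toL p y) := by ring
    rw [e, unit_mul_mem hw, ← unit_mul_mem (loc_unit hs)]
    rw [mp_sup] at h2
    have h3 : mp p (Ideal.span {a} * I ^ (l-g)) = Ideal.span {toL p a} * mp p I ^ (l-g) := by
      rw [mp, Ideal.map_mul, Ideal.map_pow, Ideal.map_span, Set.image_singleton]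
    rw [h3] at h2
    rw [map_mul, map_mul, mul_left_comm] at h2
    exact h2)
  simp only [aa] at hfin
  rw [hTl, hcl] at hfin
  have hfin2 : toL p z ∈ mp p (col (bb F a) I ⊔ Ideal.span {a}) := by
    rw [mp_sup, mp_span, Set.image_singleton]; exact hfin
  obtain ⟨s, hs, hs2⟩ := loc_mem.1 hfin2
  exact hs (hp2 s (h.interJ ha (I.mul_mem_left _ hz) hs2))

end A18
end Part18

section Part19
set_option linter.all false

section A19
variable {R : Type u} [CommRing R] [IsLocalRing R] [IsNoetherianRing R]

lemma mem_mul_span {K : Ideal R} {F : Finset R} {x : R} :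
    x ∈ K * Ideal.span (F : Set R) ↔ ∃ k : R → R, (∀ e ∈ F, k e ∈ K) ∧ x = ∑ e ∈ F, k e * e := by
  classical
  constructor
  · induction F using Finset.induction_on generalizing x with
    | empty => intro h; refine ⟨0, by simp, by simpa using h⟩
    | insert a F ha ih =>
      intro h
      rw [Finset.coe_insert, Ideal.span_insert, sup_comm, Ideal.mul_sup, mul_comm K (Ideal.span {a})] at h
      obtain ⟨c, hc, hc2⟩ := mem_sup_smul.1 h
      obtain ⟨k, hk, hk2⟩ := ih hc2
      refine ⟨fun e => if e = a then c else k e, ?_, ?_⟩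
      · intro e he
        rcases Finset.mem_insert.1 he with rfl | he
        · simpa using hc
        · have : e ≠ a := fun h => ha (h ▸ he)
          simp only [this, if_false]; exact hk e he
      · rw [Finset.sum_insert ha]
        simp only [if_true]
        rw [Finset.sum_congr rfl (g := fun e => k e * e), ← hk2]
        · ring
        · intro e he
          have : e ≠ a := fun h => ha (h ▸ he)
          simp [this]
  · rintro ⟨k, hk, rfl⟩
    exact Ideal.sum_mem _ fun e he => Ideal.mul_mem_mul (hk e he) (Ideal.subset_span he)

lemma mem_span_F {F : Finset R} {x : R} (h : x ∈ Ideal.span (F : Set R)) : ∃ k : R → R, x = ∑ e ∈ F, k e * e := by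
  rw [← Ideal.top_mul (Ideal.span (F : Set R))] at h
  obtain ⟨k, _, hk⟩ := mem_mul_span.1 h
  exact ⟨k, hk⟩

variable {I : Ideal R} {g l d : ℕ} {F : Finset R}

lemma sum_bb {F : Finset R} {a : R} (ha : a ∈ F) (k : R → R) : (∑ e ∈ F, k e * e) - a * k a ∈ bb F a := by
  classical
  rw [← Finset.sum_erase_add _ _ ha, mul_comm a, add_sub_cancel_right]
  exact Ideal.sum_mem _ fun e he => Ideal.mul_mem_left _ _ (Ideal.subset_span he)

lemma bb_le (a : R) : bb F a ≤ Ideal.span (F : Set R) := by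
  classical
  exact Ideal.span_mono (by simpa using Finset.erase_subset a F)

lemma Win.free (h : Win I g l d F) {r : R → R} 
    (hr : ∑ e ∈ F, r e * e ∈ col (Ideal.span (F : Set R)) I * Ideal.span (F : Set R)) :
    ∀ e ∈ F, r e ∈ col (Ideal.span (F : Set R)) I := by
  intro e he
  obtain ⟨k, hk, hk2⟩ := mem_mul_span.1 hr
  have h1 := sum_bb he (fun e => r e - k e)
  have h2 : ∑ e ∈ F, (r e - k e) * e = 0 := by
    simp_rw [sub_mul]; rw [Finset.sum_sub_distrib, hk2, sub_self]
  rw [h2, zero_sub, neg_mem_iff] at h1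
  have h3 := h.reg he _ Submodule.mem_top (le_col h1)
  have h4 := Ideal.add_mem _ (col_mono (bb_le e) h3) (hk e he)
  simpa using h4

lemma col_mul_le {J : Ideal R} : col J I * I ≤ J := by
  rw [Ideal.mul_le]
  intro r hr s hs
  exact mem_col.1 hr s hs

/-- property P -/
def PP (I : Ideal R) (F : Finset R) : Prop := 
  col (Ideal.span (F : Set R)) I * I ≤ col (Ideal.span (F : Set R)) I * Ideal.span (F : Set R)

lemma Win.C [Infinite (ResidueField R)] (h : Win I g l d F) (hQ : HQ I g l) 
    (hr : I ^ (l - g + 2) = Ideal.span (F : Set R) * I ^ (l - g + 1)) : PP I F := by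
  unfold PP
  rw [Ideal.mul_le]
  intro x hx c hc
  obtain ⟨r, hrr⟩ := mem_span_F (mem_col.1 hx c hc)
  rw [mem_mul_span]
  refine ⟨r, ?_, hrr⟩
  intro a ha
  rw [mem_col]
  intro c' hc'
  refine h.E hQ ha (I.mul_mem_left _ hc') ?_
  intro i hi
  have h1 : c * c' * i ∈ I ^ (l - g + 2) := by
    rw [add_comm, pow_add, pow_two]
    exact Ideal.mul_mem_mul (Ideal.mul_mem_mul hc hc') hi
  rw [hr, ← bb_sup ha, Ideal.sup_mul] at h1
  obtain ⟨j, hj, hj2⟩ := mem_sup_smul.1 h1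
  have hj3 : c * c' * i - a * j ∈ bb F a := Ideal.mul_le_left hj2
  have h2 : a * (r a * c' * i - x * j) ∈ bb F a := by
    have h3 := sum_bb ha r
    rw [← hrr] at h3
    have := Ideal.sub_mem _ (Ideal.mul_mem_left _ x hj3) (Ideal.mul_mem_left _ (c' * i) h3)
    convert this using 1; ring
  have h3 := h.reg ha _ Submodule.mem_top (le_col h2)
  have h4 : x * j ∈ col (bb F a) I ⊔ Ideal.span {a} * I ^ (l - g) := by
    have h5 : col (Ideal.span (F : Set R)) I * I ^ (l - g + 1) ≤ col (bb F a) I ⊔ Ideal.span {a} * I ^ (l - g) := by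
      rw [pow_succ', ← mul_assoc]
      refine (Ideal.mul_mono_left col_mul_le).trans ?_
      rw [← bb_sup ha, Ideal.sup_mul]
      exact sup_le_sup_right (Ideal.mul_le_left.trans le_col) _
    exact h5 (Ideal.mul_mem_mul hx hj)
  have := Ideal.add_mem _ (Ideal.mem_sup_left h3) h4
  simpa using this

lemma Reg.pow_mem {N : Ideal R} {a : R} (h : Reg ⊤ N a) (r : ℕ) {z : R} (hz : a ^ r * z ∈ N) : z ∈ N := by
  induction r with
  | zero => simpa using hz
  | succ r ih => exact ih (h _ Submodule.mem_top (by rwa [pow_succ', mul_assoc] at hz))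

lemma Win.exch (h : Win I g l d F) {F' : Finset R} (h' : Win I g l d F') {a x : R} (ha : a ∈ F) (hx : x ∈ F') 
    (hb : bb F a = bb F' x) (hP : PP I F) : 
    col (Ideal.span (F : Set R)) I = col (Ideal.span (F' : Set R)) I ∧ PP I F' := by
  classical
  unfold PP at hP ⊢
  set J := Ideal.span (F : Set R) with hJ
  set J' := Ideal.span (F' : Set R) with hJ'
  set K := col J I with hK
  set b := bb F a with hbdef
  set N := col b I with hN
  have hJb : J = b ⊔ Ideal.span {a} := (bb_sup ha).symm
  have hJb' : J' = b ⊔ Ideal.span {x} := by rw [hb]; exact (bb_sup hx).symm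
  have hregx : Reg ⊤ N x := by rw [hN, hb]; exact h'.reg hx
  have hrega : Reg ⊤ N a := h.reg ha
  have hNK : N ≤ K := col_mono (bb_le a)
  have haI := h.memI ha
  have hxI := h'.memI hx
  have S1 : K * I ≤ N ⊔ Ideal.span {a} * K := by
    refine hP.trans ?_
    rw [hJb, Ideal.mul_sup, mul_comm K (Ideal.span {a})]
    exact sup_le_sup_right (Ideal.mul_le_right.trans le_col) _
  have S1' : ∀ r, K * I ^ r ≤ N ⊔ Ideal.span {a ^ r} * K := by
    intro r
    induction r with
    | zero => simp [Ideal.span_singleton_one]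
    | succ r ih =>
      rw [pow_succ, ← mul_assoc]
      refine (Ideal.mul_mono_left ih).trans ?_
      rw [Ideal.sup_mul, mul_assoc]
      refine sup_le (Ideal.mul_le_left.trans le_sup_left) ?_
      refine (Ideal.mul_mono_right S1).trans ?_
      rw [Ideal.mul_sup, ← mul_assoc, Ideal.span_singleton_mul_span_singleton, ← pow_succ]
      exact sup_le_sup_right Ideal.mul_le_right _
  have S2 : ∀ κ ∈ K, ∃ κ1 ∈ K, a * κ - x * κ1 ∈ N := by
    intro κ hκ
    obtain ⟨r, hr⟩ := h'.red.2
    have h1 : κ * a ^ (r+1) ∈ K * I ^ (r+1) := Ideal.mul_mem_mul hκ (Ideal.pow_mem_pow haI _)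
    have h2 : K * I ^ (r+1) ≤ N ⊔ Ideal.span {x * a ^ r} * K := by
      rw [hr, ← hJ', hJb', Ideal.sup_mul, Ideal.mul_sup]
      refine sup_le (Ideal.mul_le_right.trans (Ideal.mul_le_left.trans (le_col.trans le_sup_left))) ?_
      rw [mul_left_comm]
      refine (Ideal.mul_mono_right (S1' r)).trans ?_
      rw [Ideal.mul_sup, ← mul_assoc, Ideal.span_singleton_mul_span_singleton]
      exact sup_le_sup_right Ideal.mul_le_right _
    obtain ⟨κ1, hκ1, h3⟩ := mem_sup_smul.1 (h2 h1)
    refine ⟨κ1, hκ1, hrega.pow_mem r ?_⟩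
    convert h3 using 1; ring
  have S3 : ∀ κ ∈ K, ∀ i ∈ I, ∃ κ1 ∈ K, κ * i - x * κ1 ∈ b := by
    intro κ hκ i hi
    obtain ⟨κ1, hκ1, h1⟩ := mem_sup_smul.1 (S1 (Ideal.mul_mem_mul hκ hi))
    obtain ⟨κ2, hκ2, h2⟩ := S2 κ1 hκ1
    refine ⟨κ2, hκ2, h.inter ha ⟨?_, I.sub_mem (I.mul_mem_left _ hi) (I.mul_mem_right _ hxI)⟩⟩
    have := Ideal.add_mem _ h1 h2
    rwa [show κ * i - a * κ1 + (a * κ1 - x * κ2) = κ * i - x * κ2 by ring] at this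
  have S4 : K ≤ col J' I := by
    intro κ hκ
    rw [mem_col]
    intro i hi
    obtain ⟨κ1, _, h1⟩ := S3 κ hκ i hi
    rw [hJb']
    exact mem_sup_span.2 ⟨κ1, h1⟩
  have S5 : col J' I ≤ K := by
    intro r hr
    have hr' : ∀ i ∈ I, ∃ k, r * i - x * k ∈ b := by
      intro i hi
      have := mem_col.1 hr i hi
      rw [hJb'] at this
      exact mem_sup_span.1 this
    obtain ⟨k, hk⟩ := hr' a haI
    have hkK : k ∈ K := by
      rw [hK, mem_col]
      intro i hi
      obtain ⟨ki, hki⟩ := hr' i hi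
      refine h.interJ ha (I.mul_mem_left _ hi) (mem_sup_span.2 ⟨ki, ?_⟩)
      refine hregx _ Submodule.mem_top (le_col ?_)
      have := Ideal.sub_mem _ (Ideal.mul_mem_left _ a hki) (Ideal.mul_mem_left _ i hk)
      convert this using 1; ring
    have h1 : x * k ∈ K * I := by rw [mul_comm x k]; exact Ideal.mul_mem_mul hkK hxI
    obtain ⟨κ1, hκ1, h2⟩ := mem_sup_smul.1 (S1 h1)
    have h3 : r - κ1 ∈ N := by
      refine hrega _ Submodule.mem_top ?_
      have := Ideal.add_mem _ (le_col hk) h2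
      convert this using 1; ring
    have := Ideal.add_mem _ (hNK h3) hκ1
    simpa using this
  have S6 : K = col J' I := le_antisymm S4 S5
  refine ⟨S6, ?_⟩
  rw [← S6, Ideal.mul_le]
  intro κ hκ i hi
  obtain ⟨κ1, hκ1, h1⟩ := S3 κ hκ i hi
  have h2 : κ * i - x * κ1 ∈ K * J := hP (Ideal.sub_mem _ (Ideal.mul_mem_mul hκ hi) (by rw [mul_comm x κ1]; exact Ideal.mul_mem_mul hκ1 hxI))
  obtain ⟨r, hr⟩ := mem_span_F (F := F.erase a) h1
  have h3 : ∑ e ∈ F, (if e = a then 0 else r e) * e = κ * i - x * κ1 := by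
    rw [← Finset.sum_erase_add _ _ ha, if_pos rfl, zero_mul, add_zero, hr]
    exact Finset.sum_congr rfl fun e he => by rw [if_neg (Finset.ne_of_mem_erase he)]
  have h4 := h.free (r := fun e => if e = a then 0 else r e) (by rw [h3]; exact h2)
  have h5 : κ * i - x * κ1 ∈ K * b := by
    refine mem_mul_span.2 ⟨r, fun e he => ?_, hr⟩
    have := h4 e (Finset.mem_of_mem_erase he)
    rwa [if_neg (Finset.ne_of_mem_erase he)] at this
  have h6 : κ * i - x * κ1 ∈ K * J' := Ideal.mul_mono_right (by rw [hJb']; exact le_sup_left) h5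
  have h7 : x * κ1 ∈ K * J' := by rw [mul_comm x κ1]; exact Ideal.mul_mem_mul hκ1 (Ideal.subset_span hx)
  have := Ideal.add_mem _ h6 h7
  simpa using this

/-! selection -/

lemma AG.step (H : Amb I g l d) {A : Finset R} (hA : AG I g l A) (hc : A.card < l) [DecidableEq R] :
    ∃ XX : Set (Ideal R), XX.Finite ∧ (∀ X ∈ XX, ∀ J, IsReduction J I → ¬ J ≤ X) ∧ 
      ∀ x ∈ I, (∀ X ∈ XX, x ∉ X) → AG I g l (insert x A) := by
  have h1 : ∀ T : Finset R, ∃ XX : Set (Ideal R), XX.Finite ∧ (∀ X ∈ XX, ∀ J, IsReduction J I → ¬ J ≤ X) ∧ 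
      (T ⊆ A → ∀ x ∈ I, (∀ X ∈ XX, x ∉ X) → Good I g l (T.card + 1) (Ideal.span (T : Set R) ⊔ Ideal.span {x})) := by
    intro T
    by_cases hT : T ⊆ A
    · obtain ⟨XX, a, b, c⟩ := Good.step H (hA T hT) ((Finset.card_le_card hT).trans_lt hc)
      exact ⟨XX, a, b, fun _ => c⟩
    · exact ⟨∅, Set.finite_empty, by simp, fun h => absurd h hT⟩
  choose XX h1 h2 h3 using h1
  refine ⟨⋃ T ∈ A.powerset, XX T, ?_, ?_, ?_⟩
  · exact Set.Finite.biUnion (Finset.finite_toSet A.powerset) fun T _ => h1 T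
  · intro X hX
    simp only [Set.mem_iUnion] at hX
    obtain ⟨T, _, hX⟩ := hX
    exact h2 T X hX
  · intro x hx hX T hT
    by_cases hxT : x ∈ T
    · have hT' : T.erase x ⊆ A := by
        intro y hy
        exact (Finset.mem_insert.1 (hT (Finset.mem_of_mem_erase hy))).resolve_left (Finset.ne_of_mem_erase hy)
      have := h3 (T.erase x) hT' x hx (fun X hX' => hX X (by
        simp only [Set.mem_iUnion]
        exact ⟨_, Finset.mem_powerset.2 hT', hX'⟩))
      rw [Finset.card_erase_add_one hxT] at this
      convert this using 1
      conv_lhs => rw [← Finset.insert_erase hxT, Finset.coe_insert, Ideal.span_insert, sup_comm]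
    · exact hA T ((Finset.subset_insert_iff_of_notMem hxT).1 hT)

lemma sel [Infinite (ResidueField R)] (H : Amb I g l d) {J : Ideal R} (hJ : IsReduction J I) [DecidableEq R] : 
    ∀ (k : ℕ) (A B : Finset R), B.card = k → A.card + k ≤ l → AG I g l A → (A : Set R) ⊆ J → 
      IsReduction (Ideal.span (A : Set R) ⊔ Ideal.span (B : Set R)) I → 
      ∃ A' : Finset R, A'.card ≤ l ∧ AG I g l A' ∧ (A' : Set R) ⊆ J ∧ IsReduction (Ideal.span (A' : Set R)) I := by
  intro k
  induction k with
  | zero =>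
    intro A B hB hc hA hAJ hr
    rw [Finset.card_eq_zero] at hB
    subst hB
    exact ⟨A, by omega, hA, hAJ, by simpa using hr⟩
  | succ k ih =>
    intro A B hB hc hA hAJ hr
    obtain ⟨f, hf⟩ : B.Nonempty := Finset.card_pos.1 (by omega)
    have hr' : IsReduction ((Ideal.span (A : Set R) ⊔ Ideal.span ((B.erase f : Finset R) : Set R)) ⊔ Ideal.span {f}) I := by
      rw [sup_assoc]
      convert hr using 2
      conv_rhs => rw [← Finset.insert_erase hf, Finset.coe_insert, Ideal.span_insert, sup_comm]
    obtain ⟨YY, hYf, hY1, hY2⟩ := lemX hr'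
    obtain ⟨XX, hXf, hX1, hX2⟩ := AG.step H hA (by omega)
    obtain ⟨x, hxJ, hx⟩ := avoid_ideals (J := J) (XX := XX ∪ YY) (hXf.union hYf) (by
      rintro X (hX | hX)
      · exact hX1 X hX J hJ
      · exact (hY1 X hX).2 J hJ)
    refine ih (insert x A) (B.erase f) (by rw [Finset.card_erase_of_mem hf]; omega) ?_ 
      (hX2 x (hJ.1 hxJ) fun X hX => hx X (Or.inl hX)) ?_ ?_
    · have := Finset.card_insert_le x A; omega
    · rw [Finset.coe_insert]
      exact Set.insert_subset hxJ hAJ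
    · have := hY2 x (hJ.1 hxJ) fun X hX => hx X (Or.inr hX)
      convert this using 1
      rw [Finset.coe_insert, Ideal.span_insert]
      ac_rfl

lemma red_card (hl : fiberDim I = (l : WithBot ℕ∞)) {A : Finset R} (hr : IsReduction (Ideal.span (A : Set R)) I) : l ≤ A.card := by
  have := fiber_le_gen hr (e := A.card) ⟨A, le_rfl, rfl⟩
  rw [hl] at this
  exact_mod_cast this

lemma Win.exists [Infinite (ResidueField R)] (H : Amb I g l d) (hl : fiberDim I = (l : WithBot ℕ∞)) {J : Ideal R} 
    (hJ : IsMinimalReduction J I) : ∃ F, Win I g l d F ∧ Ideal.span (F : Set R) = J := by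
  classical
  obtain ⟨B, hB, hBJ⟩ := ((minRed_iff hl).1 hJ).2
  obtain ⟨A, h1, h2, h3, h4⟩ := sel H hJ.1 B.card ∅ B rfl (by simpa using hB) (by
    intro T hT
    rw [Finset.subset_empty.1 hT]
    simpa using Good.base H) (by simp) (by rw [hBJ]; simpa using hJ.1)
  exact ⟨A, ⟨H, h4, le_antisymm h1 (red_card hl h4), h2⟩, hJ.2 _ h4 (Ideal.span_le.2 h3)⟩

lemma AG.mono {A B : Finset R} (h : AG I g l A) (hBA : B ⊆ A) : AG I g l B := fun T hT => h T (hT.trans hBA)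

open Classical in
lemma Win.chain [Infinite (ResidueField R)] (hl : fiberDim I = (l : WithBot ℕ∞)) {J : Ideal R} 
    (hJ : IsMinimalReduction J I) : ∀ (k : ℕ) (F : Finset R), Win I g l d F → PP I F → (F.filter (· ∉ J)).card = k → 
      col J I = col (Ideal.span (F : Set R)) I ∧ col J I * I ≤ col J I * J := by
  classical
  intro k
  induction k with
  | zero =>
    intro F h hP hk
    have h1 : (F : Set R) ⊆ J := by
      intro x hx
      by_contra hc
      have : x ∈ F.filter (· ∉ J) := Finset.mem_filter.2 ⟨hx, hc⟩
      rw [Finset.card_eq_zero.1 hk] at this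
      simp at this
    have h2 := hJ.2 _ h.red (Ideal.span_le.2 h1)
    unfold PP at hP
    rw [h2] at hP ⊢
    exact ⟨rfl, hP⟩
  | succ k ih =>
    intro F h hP hk
    obtain ⟨a, ha⟩ : (F.filter (· ∉ J)).Nonempty := Finset.card_pos.1 (by omega)
    obtain ⟨haF, haJ⟩ := Finset.mem_filter.1 ha
    have hr' : IsReduction (bb F a ⊔ Ideal.span {a}) I := by rw [bb_sup haF]; exact h.red
    obtain ⟨YY, hYf, hY1, hY2⟩ := lemX hr'
    obtain ⟨XX, hXf, hX1, hX2⟩ := AG.step h.amb (h.ag.mono (Finset.erase_subset a F)) (h.card_erase haF)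
    obtain ⟨x, hxJ, hx⟩ := avoid_ideals (J := J) (XX := XX ∪ YY) (hXf.union hYf) (by
      rintro X (hX | hX)
      · exact hX1 X hX J hJ.1
      · exact (hY1 X hX).2 J hJ.1)
    have hxI := hJ.1.1 hxJ
    have hag := hX2 x hxI fun X hX => hx X (Or.inl hX)
    have hred := hY2 x hxI fun X hX => hx X (Or.inr hX)
    have hspan : Ideal.span ((insert x (F.erase a) : Finset R) : Set R) = bb F a ⊔ Ideal.span {x} := by
      rw [Finset.coe_insert, Ideal.span_insert, sup_comm]; rfl
    have hxF : x ∉ F.erase a := by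
      intro hc
      rw [← hspan, Finset.insert_eq_of_mem hc] at hred
      have := red_card hl hred
      have := h.card_erase haF
      omega
    have h' : Win I g l d (insert x (F.erase a)) := by
      refine ⟨h.amb, by rw [hspan]; exact hred, ?_, hag⟩
      rw [Finset.card_insert_of_notMem hxF, Finset.card_erase_add_one haF, h.card]
    obtain ⟨e1, e2⟩ := h.exch h' haF (Finset.mem_insert_self _ _) (by
      unfold bb
      rw [Finset.erase_insert hxF]) hP
    obtain ⟨e3, e4⟩ := ih _ h' e2 (by
      rw [Finset.filter_insert, if_neg (not_not.2 hxJ), Finset.filter_erase, Finset.card_erase_of_mem ha]; omega)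
    exact ⟨e3.trans e1.symm, e4⟩

end A19
end Part19

section Part20
set_option linter.all false

section A20

/-! partial fractions -/
section PF
variable {R : Type u} [CommRing R] {Q : Type v} [CommRing Q] [Algebra R Q]

lemma pf_mul {z : Q} {v : R → Q} {T : Finset R} {ρ : R} (hρ : (z - algebraMap R Q ρ) * v ρ = 1) 
    (hT : ∀ σ ∈ T, (z - algebraMap R Q σ) * v σ = 1) (hu : ∀ σ ∈ T, IsUnit (ρ - σ)) {w : Q} 
    (hw : w ∈ Submodule.span R (v '' (T : Set R))) : 
    v ρ * w ∈ Submodule.span R (v '' (insert ρ (T : Set R))) := by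
  induction hw using Submodule.span_induction with
  | mem x hx =>
    obtain ⟨σ, hσ, rfl⟩ := hx
    obtain ⟨c, hc⟩ := (hu σ hσ).exists_left_inv
    have h1 : v ρ * v σ = c • (v ρ - v σ) := by
      have e1 := hT σ hσ
      have e2 : algebraMap R Q c * (algebraMap R Q ρ - algebraMap R Q σ) = 1 := by
        rw [← map_sub, ← map_mul, hc, map_one]
      rw [Algebra.smul_def]
      linear_combination (-1 : Q) * v ρ * v σ * e2 - algebraMap R Q c * v σ * hρ + algebraMap R Q c * v ρ * e1
    rw [h1]
    refine Submodule.smul_mem _ _ (Submodule.sub_mem _ (Submodule.subset_span ⟨ρ, by simp, rfl⟩) (Submodule.subset_span ⟨σ, Or.inr hσ, rfl⟩))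
  | zero => simp
  | add x y _ _ hx hy => rw [mul_add]; exact Submodule.add_mem _ hx hy
  | smul r x _ hx => rw [mul_smul_comm]; exact Submodule.smul_mem _ _ hx

open Classical in
lemma pf_prod {z : Q} {v : R → Q} {T : Finset R} (hT : ∀ σ ∈ T, (z - algebraMap R Q σ) * v σ = 1)
    (hu : ∀ σ ∈ T, ∀ τ ∈ T, σ ≠ τ → IsUnit (σ - τ)) (hne : T.Nonempty) : 
    ∏ σ ∈ T, v σ ∈ Submodule.span R (v '' (T : Set R)) := by
  induction hne using Finset.Nonempty.cons_induction with
  | singleton a => simpa using Submodule.subset_span (by simp)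
  | cons a s ha hs ih =>
    rw [Finset.prod_cons, Finset.coe_cons]
    refine pf_mul (hT a (Finset.mem_cons_self _ _)) (fun σ hσ => hT σ (Finset.mem_cons_of_mem hσ)) (fun σ hσ => ?_)
      (ih (fun σ hσ => hT σ (Finset.mem_cons_of_mem hσ)) (fun σ hσ τ hτ => hu σ (Finset.mem_cons_of_mem hσ) τ (Finset.mem_cons_of_mem hτ)))
    exact hu a (Finset.mem_cons_self _ _) σ (Finset.mem_cons_of_mem hσ) (fun h => ha (h ▸ hσ))

open Polynomial in
lemma pf_poly [Nontrivial R] {z : Q} {v : R → Q} {T : Finset R} : (∀ σ ∈ T, (z - algebraMap R Q σ) * v σ = 1) →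
    (∀ σ ∈ T, ∀ τ ∈ T, σ ≠ τ → IsUnit (σ - τ)) → ∀ q : R[X], q.degree < (T.card : WithBot ℕ) → 
    aeval z q * ∏ σ ∈ T, v σ ∈ Submodule.span R (v '' (T : Set R)) := by
  classical
  induction T using Finset.cons_induction with
  | empty =>
    intro _ _ q hq
    have : q = 0 := by
      rw [← Polynomial.degree_eq_bot]
      simpa using hq
    simp [this]
  | cons a s ha ih =>
    intro hT hu q hq
    have hd := Polynomial.modByMonic_add_div q (X - C a)
    rw [modByMonic_X_sub_C_eq_C_eval] at hd
    have hz : aeval z q = algebraMap R Q (q.eval a) + (z - algebraMap R Q a) * aeval z (q /ₘ (X - C a)) := by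
      conv_lhs => rw [← hd]
      simp
    have e : aeval z q * ∏ σ ∈ Finset.cons a s ha, v σ = (q.eval a) • ∏ σ ∈ Finset.cons a s ha, v σ + 
        aeval z (q /ₘ (X - C a)) * ∏ σ ∈ s, v σ := by
      rw [hz, Finset.prod_cons, Algebra.smul_def]
      have := hT a (Finset.mem_cons_self _ _)
      linear_combination (aeval z (q /ₘ (X - C a)) * ∏ σ ∈ s, v σ) * this
    rw [e]
    refine Submodule.add_mem _ (Submodule.smul_mem _ _ (pf_prod hT hu (by simp))) ?_
    refine Submodule.span_mono (Set.image_mono (by simp)) (ih (fun σ hσ => hT σ (Finset.mem_cons_of_mem hσ)) (fun σ hσ τ hτ => hu σ (Finset.mem_cons_of_mem hσ) τ (Finset.mem_cons_of_mem hτ)) _ ?_)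
    by_cases h0 : q = 0
    · rw [h0, zero_divByMonic, degree_zero]; exact WithBot.bot_lt_coe _
    · by_cases h1 : q /ₘ (X - C a) = 0
      · rw [h1, degree_zero]; exact WithBot.bot_lt_coe _
      · rw [degree_eq_natDegree h1, natDegree_divByMonic _ (monic_X_sub_C a)]
        rw [degree_eq_natDegree h0, Finset.card_cons] at hq
        have hq' : q.natDegree < s.card + 1 := by exact_mod_cast hq
        have h2 : q.natDegree ≠ 0 := by
          intro h2
          apply h1
          rw [divByMonic_eq_zero_iff (monic_X_sub_C a), degree_X_sub_C, degree_eq_natDegree h0, h2]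
          exact_mod_cast zero_lt_one
        rw [natDegree_X_sub_C]
        have : q.natDegree - 1 < s.card := by omega
        exact_mod_cast this

open Polynomial in
lemma pf_main [Nontrivial R] {z : Q} {v : R → Q} {S : Set R} (hS : S.Infinite) (hz : IsIntegral R z)
    (hT : ∀ σ ∈ S, (z - algebraMap R Q σ) * v σ = 1)
    (hu : ∀ σ ∈ S, ∀ τ ∈ S, σ ≠ τ → IsUnit (σ - τ)) : z ∈ Submodule.span R (v '' S) := by
  obtain ⟨f, hf, hfz⟩ := hz
  obtain ⟨T, hTS, hTc⟩ := hS.exists_subset_card_eq f.natDegree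
  have hfz' : aeval z f = 0 := hfz
  set G : R[X] := ∏ σ ∈ T, (X - C σ) with hG
  have h1 := pf_poly (T := T) (fun σ hσ => hT σ (hTS hσ)) (fun σ hσ τ hτ => hu σ (hTS hσ) τ (hTS hτ)) ((X * G) %ₘ f) (by
    rw [hTc, ← degree_eq_natDegree hf.ne_zero]
    exact degree_modByMonic_lt _ hf)
  rw [aeval_modByMonic_eq_self_of_root hfz', map_mul, aeval_X, hG, map_prod, mul_assoc, ← Finset.prod_mul_distrib,
    Finset.prod_eq_one, mul_one] at h1
  · exact Submodule.span_mono (Set.image_mono hTS) h1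
  · intro σ hσ
    simpa using hT σ (hTS hσ)

end PF

/-! greedy -/
lemma greedy {R : Type u} [CommRing R] [IsLocalRing R] {M : Type v} [AddCommGroup M] [Module R M] {A : Submodule R M}
    (hA : A.FG) {Y : Set R} {V : R → Submodule R M} (hV : ∀ y ∈ Y, V y ≤ A) (hAV : A ≤ ⨆ y ∈ Y, V y) : 
    ∀ (D : ℕ) (M0 : Submodule R M) (E : Finset M), E.card ≤ D → A = M0 ⊔ Submodule.span R (E : Set M) → 
    ∃ s : Finset R, (s : Set R) ⊆ Y ∧ s.card ≤ D ∧ A ≤ M0 ⊔ ⨆ y ∈ s, V y := by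
  classical
  intro D
  induction D with
  | zero =>
    intro M0 E hE hAE
    rw [Finset.card_eq_zero.1 (Nat.le_zero.1 hE)] at hAE
    exact ⟨∅, by simp, by simp, by simpa using hAE.le⟩
  | succ D ih =>
    intro M0 E hE hAE
    by_cases hc : ∀ y ∈ Y, V y ≤ M0 ⊔ maximalIdeal R • A
    · have h1 : A ≤ M0 ⊔ maximalIdeal R • A := hAV.trans (iSup₂_le hc)
      have h2 : A ≤ M0 := Submodule.le_of_le_smul_of_le_jacobson_bot hA (by rw [IsLocalRing.jacobson_eq_maximalIdeal ⊥ bot_ne_top]) h1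
      exact ⟨∅, by simp, by simp, by simpa using h2⟩
    · push Not at hc
      obtain ⟨y, hy, hc⟩ := hc
      obtain ⟨w, hw, hwn⟩ := Set.not_subset.1 hc
      have hwA : w ∈ M0 ⊔ Submodule.span R (E : Set M) := hAE ▸ hV y hy hw
      obtain ⟨m0, hm0, w', hw', hww⟩ := Submodule.mem_sup.1 hwA
      obtain ⟨c, hc⟩ := (Submodule.mem_span_finset').1 hw'
      have hex : ∃ e : E, IsUnit (c e) := by
        by_contra hcon
        push Not at hcon
        apply hwn
        rw [← hww, ← hc]
        refine Submodule.add_mem_sup hm0 (Submodule.sum_mem _ fun e _ => Submodule.smul_mem_smul ((mem_maximalIdeal _).2 (hcon e)) ?_)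
        rw [hAE]
        exact Submodule.mem_sup_right (Submodule.subset_span e.2)
      obtain ⟨e, he⟩ := hex
      obtain ⟨c', hc'⟩ := he.exists_left_inv
      have h3 : (e : M) ∈ (M0 ⊔ V y) ⊔ Submodule.span R ((E.erase e : Finset M) : Set M) := by
        have h4 : c e • (e : M) = w - m0 - ∑ x ∈ Finset.univ.erase e, c x • (x : M) := by
          rw [← hww, ← hc, ← Finset.add_sum_erase _ _ (Finset.mem_univ e)]
          abel
        have h5 : (e : M) = c' • (c e • (e : M)) := by rw [smul_smul, hc', one_smul]
        refine (congrArg (fun x => x ∈ (M0 ⊔ V y) ⊔ Submodule.span R ((E.erase e : Finset M) : Set M)) (h5.trans (congrArg (fun x => c' • x) h4))).mpr ?_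
        refine Submodule.smul_mem _ _ (Submodule.sub_mem _ (Submodule.mem_sup_left (Submodule.sub_mem _ (Submodule.mem_sup_right hw) (Submodule.mem_sup_left hm0))) (Submodule.mem_sup_right (Submodule.sum_mem _ fun x hx => Submodule.smul_mem _ _ (Submodule.subset_span ?_))))
        have := Finset.ne_of_mem_erase hx
        simp only [Finset.coe_erase, Set.mem_diff, Set.mem_singleton_iff]
        exact ⟨x.2, fun h => this (Subtype.ext h)⟩
      obtain ⟨s, hs1, hs2, hs3⟩ := ih (M0 ⊔ V y) (E.erase e) (by rw [Finset.card_erase_of_mem e.2]; omega) (by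
        apply le_antisymm
        · conv_lhs => rw [hAE]
          refine sup_le (le_sup_left.trans le_sup_left) (Submodule.span_le.2 fun x hx => ?_)
          by_cases hxe : x = e
          · rw [hxe]; exact h3
          · exact Submodule.mem_sup_right (Submodule.subset_span (by simpa using ⟨hx, hxe⟩))
        · refine sup_le (sup_le (by rw [hAE]; exact le_sup_left) (hV y hy)) ?_
          rw [hAE]
          exact (Submodule.span_mono (by simp)).trans le_sup_right)
      refine ⟨insert y s, ?_, (Finset.card_insert_le _ _).trans (by omega), ?_⟩
      · rw [Finset.coe_insert]; exact Set.insert_subset hy hs1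
      · rw [Finset.iSup_insert, ← sup_assoc]; exact hs3

end A20
end Part20

section Part21
set_option linter.all false

section A21
variable {R : Type u} [CommRing R]

lemma exists_Q {N : Ideal R} {a : R} (hreg : Reg ⊤ N a) : ∃ (Q : Type u) (_ : CommRing Q) (_ : Algebra R Q),
    (∀ r, algebraMap R Q r = 0 ↔ r ∈ N) ∧ ∃ α : Q, α * algebraMap R Q a = 1 := by
  let a' : R ⧸ N := Ideal.Quotient.mk N a
  let Q := Localization.Away a'
  let f : R →+* Q := (algebraMap (R ⧸ N) Q).comp (Ideal.Quotient.mk N)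
  have hreg' : ∀ (k : ℕ) (u : R), a ^ k * u ∈ N → u ∈ N := by
    intro k
    induction k with
    | zero => intro u hu; simpa using hu
    | succ k ih =>
      intro u hu
      refine hreg u Submodule.mem_top (ih _ ?_)
      rwa [← mul_assoc, ← pow_succ]
  refine ⟨Q, inferInstance, f.toAlgebra, ?_, ?_⟩
  · intro r
    change algebraMap (R ⧸ N) Q (Ideal.Quotient.mk N r) = 0 ↔ _
    rw [IsLocalization.map_eq_zero_iff (Submonoid.powers a') Q]
    constructor
    · rintro ⟨⟨_, k, rfl⟩, hm⟩
      refine hreg' k r ?_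
      rw [← Ideal.Quotient.eq_zero_iff_mem, map_mul, map_pow]
      exact hm
    · intro hr
      exact ⟨1, by rw [Ideal.Quotient.eq_zero_iff_mem.2 hr, mul_zero]⟩
  · obtain ⟨α, hα⟩ := (IsLocalization.Away.algebraMap_isUnit (S := Q) a').exists_left_inv
    exact ⟨α, hα⟩

lemma span_pow_sym (E : Finset R) (k : ℕ) : ∃ E' : Finset R, E'.card ≤ E.card.multichoose k ∧ 
    (Ideal.span (E : Set R)) ^ k = Ideal.span (E' : Set R) := by
  classical
  have h0 : ∀ m : Multiset E, (m.map Subtype.val).prod ∈ (Ideal.span (E : Set R)) ^ (Multiset.card m) := by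
    intro m
    induction m using Multiset.induction_on with
    | empty => simp
    | cons e m ih =>
      rw [Multiset.map_cons, Multiset.prod_cons, Multiset.card_cons, pow_succ']
      exact Ideal.mul_mem_mul (Ideal.subset_span e.2) ih
  have h1 : ∀ k : ℕ, (Ideal.span (E : Set R)) ^ k ≤ Ideal.span (Set.range fun s : Sym E k => ((s : Multiset E).map Subtype.val).prod) := by
    intro k
    induction k with
    | zero =>
      rw [pow_zero, Ideal.one_eq_top, top_le_iff, Ideal.eq_top_iff_one]
      exact Ideal.subset_span ⟨Sym.nil, by simp⟩
    | succ k ih =>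
      rw [pow_succ']
      refine (Ideal.mul_mono_right ih).trans ?_
      rw [Ideal.span_mul_span', Ideal.span_le]
      rintro _ ⟨e, he, _, ⟨s, rfl⟩, rfl⟩
      refine Ideal.subset_span ⟨Sym.cons ⟨e, he⟩ s, ?_⟩
      change (Multiset.map Subtype.val ((⟨e, he⟩ : E) ::ₘ (s : Multiset E))).prod = _
      rw [Multiset.map_cons, Multiset.prod_cons]
  refine ⟨Finset.univ.image fun s : Sym E k => ((s : Multiset E).map Subtype.val).prod, ?_, ?_⟩
  · refine Finset.card_image_le.trans ?_
    rw [Finset.card_univ, Sym.card_sym_eq_multichoose, Fintype.card_coe]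
  · apply le_antisymm
    · simpa using h1 k
    · rw [Ideal.span_le]
      intro x hx
      obtain ⟨s, _, rfl⟩ := Finset.mem_image.1 (Finset.mem_coe.1 hx)
      have := h0 (s : Multiset E)
      have e : Multiset.card (s : Multiset E) = k := s.2
      rw [e] at this
      exact this

lemma pow_le_E {I b E : Ideal R} {a : R} (h : I = b ⊔ Ideal.span {a} ⊔ E) (k : ℕ) : 
    I ^ (k+1) ≤ b ⊔ Ideal.span {a} * I ^ k ⊔ E ^ (k+1) := by
  have hE : E ≤ I := by rw [h]; exact le_sup_right
  induction k with
  | zero => simpa using h.le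
  | succ k ih =>
    rw [pow_succ]
    refine (Ideal.mul_mono_left ih).trans ?_
    rw [Ideal.sup_mul, Ideal.sup_mul, mul_assoc, ← pow_succ]
    refine sup_le (sup_le_sup_right Ideal.mul_le_left _ |>.trans le_sup_left) ?_
    conv_lhs => rw [h]
    rw [Ideal.mul_sup, Ideal.mul_sup, ← pow_succ]
    refine sup_le_sup_right (sup_le_sup Ideal.mul_le_right ?_) _
    rw [mul_comm]
    exact Ideal.mul_mono_right (Ideal.pow_right_mono hE _)

end A21

section A21b
variable {R : Type u} [CommRing R] {Q : Type v} [CommRing Q] [Algebra R Q]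

noncomputable def VV (I : Ideal R) (α : Q) (k : ℕ) : Submodule R Q := 
  Submodule.map (LinearMap.mulLeft R (α ^ k) ∘ₗ Algebra.linearMap R Q) (I ^ k)

lemma mem_VV {I : Ideal R} {α : Q} {k : ℕ} {w : Q} : w ∈ VV I α k ↔ ∃ i ∈ I ^ k, w = α ^ k * algebraMap R Q i := by
  unfold VV
  rw [Submodule.mem_map]
  constructor
  · rintro ⟨i, hi, rfl⟩; exact ⟨i, hi, rfl⟩
  · rintro ⟨i, hi, rfl⟩; exact ⟨i, hi, rfl⟩

lemma VV_mul {I : Ideal R} {α : Q} {k m : ℕ} {w z : Q} (hw : w ∈ VV I α k) (hz : z ∈ VV I α m) : w * z ∈ VV I α (k + m) := by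
  obtain ⟨i, hi, rfl⟩ := mem_VV.1 hw
  obtain ⟨j, hj, rfl⟩ := mem_VV.1 hz
  refine mem_VV.2 ⟨i * j, by rw [pow_add]; exact Ideal.mul_mem_mul hi hj, by rw [map_mul]; ring⟩

lemma VV_mono {I : Ideal R} {α : Q} {a : R} (ha : a ∈ I) (hα : α * algebraMap R Q a = 1) : Monotone (VV I α) := by
  refine monotone_nat_of_le_succ fun k w hw => ?_
  obtain ⟨i, hi, rfl⟩ := mem_VV.1 hw
  refine mem_VV.2 ⟨a * i, by rw [pow_succ']; exact Ideal.mul_mem_mul ha hi, ?_⟩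
  rw [map_mul]
  linear_combination (-α ^ k * algebraMap R Q i) * hα

lemma VV_stab {I b : Ideal R} {α : Q} {a : R} (ha : a ∈ I) (hα : α * algebraMap R Q a = 1) {t : ℕ} 
    (hb : ∀ x ∈ b, algebraMap R Q x = 0) (hr : I ^ (t+1) = (b ⊔ Ideal.span {a}) * I ^ t) (k : ℕ) : VV I α k ≤ VV I α t := by
  have h1 : ∀ k, VV I α (t + k) ≤ VV I α t := by
    intro k
    induction k with
    | zero => exact le_rfl
    | succ k ih =>
      refine le_trans ?_ ih
      intro w hw
      obtain ⟨i, hi, rfl⟩ := mem_VV.1 hw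
      have h2 : i ∈ b ⊔ Ideal.span {a} * I ^ (t + k) := by
        rw [show t + (k + 1) = t + 1 + k by omega, pow_add, hr, mul_assoc, ← pow_add, Ideal.sup_mul] at hi
        exact (sup_le_sup_right Ideal.mul_le_left _ : b * I ^ (t + k) ⊔ _ ≤ _) hi
      obtain ⟨j, hj, h3⟩ := mem_sup_smul.1 h2
      refine mem_VV.2 ⟨j, hj, ?_⟩
      have h4 := hb _ h3
      rw [map_sub, map_mul] at h4
      linear_combination α ^ (t + k + 1) * h4 + α ^ (t + k) * algebraMap R Q j * hα
  exact (VV_mono ha hα (by omega : k ≤ t + k)).trans (h1 k)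

end A21b

section A21c
variable {R : Type u} [CommRing R] [IsLocalRing R] [IsNoetherianRing R] {I : Ideal R} {g l d n : ℕ} {F : Finset R}

lemma Win.gam [Infinite (ResidueField R)] (h : Win I g l d F) (hQ : HQ I g l) (hl : fiberDim I = (l : WithBot ℕ∞)) (hn : GenLE I n)
    (hgl : g ≤ l) (hr : I ^ (l - g + 2) = Ideal.span (F : Set R) * I ^ (l - g + 1)) {a : R} (ha : a ∈ F) :
    ∃ s : Finset R, (∀ y ∈ s, y ∈ I ∧ IsReduction (bb F a ⊔ Ideal.span {y}) I) ∧ s.card ≤ (n - g).choose (l - g + 1) ∧ 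
      ∀ r, (∀ y ∈ s, r * a ∈ bb F a ⊔ Ideal.span {y}) → r ∈ col (Ideal.span (F : Set R)) I := by
  classical
  set b := bb F a with hb
  set N := col b I with hN
  set T := l - g with hT
  have haI : a ∈ I := h.memI ha
  have hbN : b ≤ N := le_col
  obtain ⟨Q, _, _, hker, α, hα⟩ := exists_Q (h.reg ha)
  have hb0 : ∀ x ∈ b, algebraMap R Q x = 0 := fun x hx => (hker x).2 (hbN hx)
  have hr1 : I ^ (T + 1 + 1) = (b ⊔ Ideal.span {a}) * I ^ (T + 1) := by rw [hb, bb_sup ha]; exact hr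
  have hstab := VV_stab haI hα hb0 hr1
  have hmono := VV_mono haI hα
  -- the units
  set Y : Set R := {y | y ∈ I ∧ IsReduction (b ⊔ Ideal.span {y}) I} with hY
  have hv : ∀ y : R, ∃ v : Q, y ∈ Y → α * algebraMap R Q y * v = 1 ∧ v ∈ VV I α (T + 1) := by
    intro y
    by_cases hy : y ∈ Y
    · obtain ⟨r, hr⟩ := hy.2.2
      have h1 : a ^ (r+1) ∈ b ⊔ Ideal.span {y} * I ^ r := by
        have : a ^ (r+1) ∈ I ^ (r+1) := Ideal.pow_mem_pow haI _
        rw [hr, Ideal.sup_mul] at this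
        exact (sup_le_sup_right Ideal.mul_le_left _ : b * I ^ r ⊔ _ ≤ _) this
      obtain ⟨j, hj, h3⟩ := mem_sup_smul.1 h1
      have h4 := hb0 _ h3
      rw [map_sub, map_mul, map_pow] at h4
      refine ⟨α ^ r * algebraMap R Q j, fun _ => ⟨?_, hstab r (mem_VV.2 ⟨j, hj, rfl⟩)⟩⟩
      have h5 : α ^ (r+1) * algebraMap R Q a ^ (r+1) = 1 := by rw [← mul_pow, hα, one_pow]
      linear_combination h5 - α ^ (r+1) * h4
    · exact ⟨0, fun h => absurd h hy⟩
  choose v hv using hv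
  -- integrality
  have hone : (1 : Q) ∈ VV I α (T + 1) := hmono (Nat.zero_le _) (mem_VV.2 ⟨1, by simp, by simp⟩)
  have hFG : ∀ k, (VV I α k).FG := fun k => (IsNoetherian.noetherian (I ^ k)).map _
  let AA : Subalgebra R Q := 
    { carrier := VV I α (T + 1)
      mul_mem' := fun hx hy => hstab _ (VV_mul hx hy)
      one_mem' := hone
      add_mem' := fun hx hy => Submodule.add_mem _ hx hy
      zero_mem' := Submodule.zero_mem _
      algebraMap_mem' := fun r => by
        rw [Algebra.algebraMap_eq_smul_one]
        exact Submodule.smul_mem _ _ hone }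
  have hAA : Subalgebra.toSubmodule AA = VV I α (T+1) := by ext; rfl
  have hintg : ∀ z ∈ VV I α (T+1), IsIntegral R z := fun z hz => 
    IsIntegral.of_mem_of_fg AA (by rw [hAA]; exact hFG _) z hz
  -- partial fractions
  have hpf : ∀ c ∈ I, α * algebraMap R Q c ∈ Submodule.span R (v '' Y) := by
    intro c hc
    obtain ⟨S, hS, hSu⟩ := inf_units (R := R)
    obtain ⟨YY, hYf, hY1, hY2⟩ := lemX (b := b) (a := a) (I := I) (by rw [hb, bb_sup ha]; exact h.red)
    have hfin := line_avoid_fin hSu hYf (x := c) (y := -a) (fun X hX => Or.inr fun hc => (hY1 X hX).1 (by simpa using hc))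
    set S' := S \ {s | s ∈ S ∧ ∃ X ∈ YY, c + s * -a ∈ X} with hS'
    have hS'Y : ∀ s ∈ S', c + s * -a ∈ Y := by
      rintro s ⟨hs, hs'⟩
      have hcI : c + s * -a ∈ I := I.add_mem hc (I.mul_mem_left _ (I.neg_mem haI))
      refine ⟨hcI, hY2 _ hcI fun X hX hcX => hs' ⟨hs, X, hX, hcX⟩⟩
    have := pf_main (Q := Q) (z := α * algebraMap R Q c) (v := fun s => v (c + s * -a)) (hS.diff hfin) 
      (hintg _ (hstab 1 (mem_VV.2 ⟨c, by simpa using hc, by simp⟩))) (by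
        intro σ hσ
        have := (hv _ (hS'Y σ hσ)).1
        rw [map_add, map_mul, map_neg] at this
        linear_combination this + algebraMap R Q σ * v (c + σ * -a) * hα) (fun σ hσ τ hτ => hSu σ hσ.1 τ hτ.1)
    refine Submodule.span_mono ?_ this
    rintro _ ⟨s, hs, rfl⟩
    exact ⟨_, hS'Y s hs, rfl⟩
  set Vy : R → Submodule R Q := fun y => Submodule.map (LinearMap.mulLeft R (v y)) (VV I α T) with hVy
  have hVy1 : ∀ y ∈ Y, Vy y ≤ VV I α (T+1) := by
    rintro y hy _ ⟨w, hw, rfl⟩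
    exact hstab _ (VV_mul (hv y hy).2 hw)
  have hVy2 : VV I α (T+1) ≤ ⨆ y ∈ Y, Vy y := by
    have h1 : ∀ z ∈ Submodule.span R (v '' Y), ∀ w ∈ VV I α T, z * w ∈ ⨆ y ∈ Y, Vy y := by
      intro z hz w hw
      induction hz using Submodule.span_induction with
      | mem x hx =>
        obtain ⟨y, hy, rfl⟩ := hx
        exact (le_iSup₂ (f := fun y (_ : y ∈ Y) => Vy y) y hy) ⟨w, hw, rfl⟩
      | zero => rw [zero_mul]; exact Submodule.zero_mem _
      | add x y _ _ hx hy => rw [add_mul]; exact Submodule.add_mem _ hx hy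
      | smul r x _ hx => rw [smul_mul_assoc]; exact Submodule.smul_mem _ _ hx
    intro w hw
    obtain ⟨i, hi, rfl⟩ := mem_VV.1 hw
    rw [pow_succ'] at hi
    refine Submodule.mul_induction_on hi ?_ ?_
    · intro c hc e he
      have := h1 _ (hpf c hc) (α ^ T * algebraMap R Q e) (mem_VV.2 ⟨e, he, rfl⟩)
      rwa [show α ^ (T+1) * algebraMap R Q (c * e) = α * algebraMap R Q c * (α ^ T * algebraMap R Q e) by rw [map_mul]; ring]
    · intro x y hx hy
      rw [map_add, mul_add]
      exact Submodule.add_mem _ hx hy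
  -- counting
  obtain ⟨hln, E, hE1, hE2⟩ := steinitz (I := I) (l := l) (n := n) (fun i => ((F.equivFinOfCardEq h.card).symm i : R)) hl.ge (by
    convert h.red using 2
    ext x
    constructor
    · rintro ⟨i, rfl⟩; exact ((F.equivFinOfCardEq h.card).symm i).2
    · intro hx; exact ⟨F.equivFinOfCardEq h.card ⟨x, hx⟩, by simp⟩) hn
  have hrange : Set.range (fun i => ((F.equivFinOfCardEq h.card).symm i : R)) = (F : Set R) := by
    ext x
    constructor
    · rintro ⟨i, rfl⟩; exact ((F.equivFinOfCardEq h.card).symm i).2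
    · intro hx; exact ⟨F.equivFinOfCardEq h.card ⟨x, hx⟩, by simp⟩
  rw [hrange, ← bb_sup ha, ← hb] at hE2
  obtain ⟨E', hE'1, hE'2⟩ := span_pow_sym E (T+1)
  have hpow := pow_le_E hE2 T
  have hcard : E'.card ≤ (n - g).choose (T + 1) := by
    refine hE'1.trans ?_
    rw [Nat.multichoose_eq]
    exact Nat.choose_le_choose _ (by omega)
  set E'' : Finset Q := E'.image (fun e => α ^ (T+1) * algebraMap R Q e) with hE''
  -- the sup
  have hA1 : VV I α (T+1) ≤ VV I α T ⊔ Submodule.span R (E'' : Set Q) := by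
    intro w hw
    obtain ⟨i, hi, rfl⟩ := mem_VV.1 hw
    obtain ⟨i1, hi1, i2, hi2, rfl⟩ := Submodule.mem_sup.1 (hpow hi)
    obtain ⟨j, hj, h3⟩ := mem_sup_smul.1 hi1
    have h4 := hb0 _ h3
    rw [map_sub, map_mul] at h4
    have h5 : α ^ (T+1) * algebraMap R Q (i1 + i2) = α ^ T * algebraMap R Q j + α ^ (T+1) * algebraMap R Q i2 := by
      rw [map_add]
      linear_combination α ^ (T+1) * h4 + α ^ T * algebraMap R Q j * hα
    rw [h5]
    refine Submodule.add_mem_sup (mem_VV.2 ⟨j, hj, rfl⟩) ?_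
    have h6 : i2 ∈ Ideal.span (E' : Set R) := hE'2 ▸ hi2
    refine Submodule.span_induction (p := fun x _ => α ^ (T+1) * algebraMap R Q x ∈ Submodule.span R (E'' : Set Q)) ?_ ?_ ?_ ?_ h6
    · intro x hx
      exact Submodule.subset_span (by rw [hE'']; exact Finset.mem_coe.2 (Finset.mem_image_of_mem _ hx))
    · simp
    · intro x y _ _ hx hy
      rw [map_add, mul_add]; exact Submodule.add_mem _ hx hy
    · intro r x _ hx
      rw [smul_eq_mul, map_mul, mul_left_comm, ← Algebra.smul_def]
      exact Submodule.smul_mem _ _ hx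
  have hA2 : Submodule.span R (E'' : Set Q) ≤ VV I α (T+1) := by
    rw [Submodule.span_le, hE'']
    intro x hx
    obtain ⟨e, he, rfl⟩ := Finset.mem_image.1 (Finset.mem_coe.1 hx)
    have h1 : e ∈ Ideal.span (E : Set R) ^ (T+1) := by rw [hE'2]; exact Ideal.subset_span he
    have h2 : Ideal.span (E : Set R) ≤ I := by rw [hE2]; exact le_sup_right
    exact mem_VV.2 ⟨e, Ideal.pow_right_mono h2 _ h1, rfl⟩
  obtain ⟨s, hs1, hs2, hs3⟩ := greedy (hFG (T+1)) hVy1 hVy2 _ (VV I α T) E'' (Finset.card_image_le.trans hcard)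
    (le_antisymm hA1 (sup_le (hmono (Nat.le_succ T)) hA2))
  refine ⟨s, fun y hy => hs1 hy, hs2, ?_⟩
  intro r hry
  have hrV : ∀ w ∈ VV I α (T+1), r • w ∈ VV I α T := by
    have h1 : VV I α (T+1) ≤ Submodule.comap (LinearMap.lsmul R Q r) (VV I α T) := by
      refine hs3.trans (sup_le (fun w hw => Submodule.smul_mem _ _ hw) (iSup₂_le ?_))
      rintro y hy _ ⟨w, hw, rfl⟩
      obtain ⟨k, hk⟩ := mem_sup_span.1 (hry y hy)
      have h2 := hb0 _ hk
      rw [map_sub, map_mul, map_mul] at h2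
      have h3 := (hv y (hs1 hy)).1
      have h4 : r • (v y * w) = k • w := by
        rw [Algebra.smul_def, Algebra.smul_def]
        linear_combination α * v y * w * h2 - algebraMap R Q r * v y * w * hα + algebraMap R Q k * w * h3
      change r • (v y * w) ∈ VV I α T
      rw [h4]
      exact Submodule.smul_mem _ _ hw
    exact fun w hw => h1 hw
  rw [mem_col]
  intro c hc
  refine h.E hQ ha (I.mul_mem_left _ hc) ?_
  intro i hi
  obtain ⟨j, hj, h1⟩ := mem_VV.1 (hrV (α ^ (T+1) * algebraMap R Q (c * i)) (mem_VV.2 ⟨c * i, by rw [pow_succ']; exact Ideal.mul_mem_mul hc hi, rfl⟩))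
  refine mem_sup_smul.2 ⟨j, hj, (hker _).1 ?_⟩
  have h2 : algebraMap R Q a ^ (T+1) * α ^ (T+1) = 1 := by rw [← mul_pow, mul_comm, hα, one_pow]
  have h3 : algebraMap R Q a ^ T * α ^ T = 1 := by rw [← mul_pow, mul_comm, hα, one_pow]
  rw [Algebra.smul_def, map_mul] at h1
  simp only [map_sub, map_mul]
  linear_combination algebraMap R Q a ^ (T+1) * h1 - algebraMap R Q r * algebraMap R Q c * algebraMap R Q i * h2 + algebraMap R Q a * algebraMap R Q j * h3

end A21c
end Part21

section Part22
set_option linter.all false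

section A22
variable {R : Type u} [CommRing R] [IsLocalRing R] [IsNoetherianRing R] {I : Ideal R} {g l d n : ℕ} {F : Finset R}

lemma Win.g_le (h : Win I g l d F) : g ≤ l := by
  have hJm : Ideal.span (F : Set R) ≠ ⊤ := by
    intro hc
    have := (h.red.1).trans h.amb.hI
    rw [hc] at this
    exact (maximalIdeal.isMaximal R).ne_top (top_le_iff.1 this)
  have h1 : (Ideal.span (F : Set R)).height ≤ (l : ℕ∞) := by
    refine (Ideal.height_le_spanFinrank _ hJm).trans ?_
    rw [← h.card]
    have := Submodule.spanFinrank_span_le_ncard_of_finite (R := R) (s := (F : Set R)) F.finite_toSet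
    rw [Set.ncard_coe_finset] at this
    exact_mod_cast this
  have h2 : (g : ℕ∞) ≤ (Ideal.span (F : Set R)).height := by
    rw [Ideal.height_eq_inf_minimalPrimes]
    refine le_iInf₂ fun q hq => ?_
    have hqp : q.IsPrime := hq.1.1
    have := h.amb.hg q hqp (by
      obtain ⟨r, hr⟩ := h.red.2
      have : I ^ (r+1) ≤ q := by rw [hr]; exact Ideal.mul_le_left.trans hq.1.2
      exact Ideal.IsPrime.le_of_pow_le this)
    exact this
  exact_mod_cast h2.trans h1

lemma final [Infinite (ResidueField R)] (H : Amb I g l d) (hl : fiberDim I = (l : WithBot ℕ∞)) (hn : muE I = (n : ℕ∞)) (hQ : HQ I g l)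
    (hr : reductionNumber I ≤ ((l - g + 1 : ℕ) : ℕ∞)) : 
    (∀ J, IsMinimalReduction J I →
      core I = Submodule.colon J I * J ∧ core I = Submodule.colon J I * I) ∧
    gamma I ≤ ((l * Nat.choose (n - g) (l - g + 1) + 1 : ℕ) : ℕ∞) := by
  classical
  set RS := {n : ℕ∞ | ∃ r : ℕ, (r : ℕ∞) = n ∧ ∃ J : Ideal R, IsMinimalReduction J I ∧ I ^ (r + 1) = J * I ^ r} with hRS
  have hne : RS.Nonempty := by
    by_contra hc
    rw [Set.not_nonempty_iff_eq_empty] at hc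
    have : reductionNumber I = ⊤ := by
      change sInf RS = ⊤
      rw [hc, sInf_empty]
    rw [this, top_le_iff] at hr
    exact ENat.coe_ne_top _ hr
  obtain ⟨r, hr0, J0, hJ0, hr1⟩ : reductionNumber I ∈ RS := csInf_mem hne
  rw [← hr0] at hr
  have hr' : r ≤ l - g + 1 := by exact_mod_cast hr
  have hpow : I ^ (l - g + 2) = J0 * I ^ (l - g + 1) := by
    obtain ⟨k, hk⟩ := Nat.exists_eq_add_of_le hr'
    rw [show l - g + 2 = (r + 1) + k by omega, pow_add, hr1, mul_assoc, ← pow_add, hk]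
  obtain ⟨F, h, hFJ⟩ := Win.exists H hl hJ0
  have hgl := h.g_le
  rw [← hFJ] at hpow
  have hP := h.C hQ hpow
  have hchain := fun J (hJ : IsMinimalReduction J I) => Win.chain hl hJ _ F h hP rfl
  set K := col (Ideal.span (F : Set R)) I with hK
  have hKle : ∀ J, IsMinimalReduction J I → K * I ≤ K * J := by
    intro J hJ
    obtain ⟨h1, h2⟩ := hchain J hJ
    rwa [h1] at h2
  have hcoreGe : K * I ≤ core I := le_sInf fun J hJ => (hKle J hJ).trans Ideal.mul_le_right
  have hgen : GenLE I n := by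
    obtain ⟨s, h1, h2⟩ := muE_one hn
    exact ⟨s, h1.le, h2⟩
  have hs := fun a (ha : a ∈ F) => h.gam hQ hl hgen hgl hpow ha
  have hs' : ∀ a, ∃ s : Finset R, a ∈ F → (∀ y ∈ s, y ∈ I ∧ IsReduction (bb F a ⊔ Ideal.span {y}) I) ∧ s.card ≤ (n - g).choose (l - g + 1) ∧ 
      ∀ r, (∀ y ∈ s, r * a ∈ bb F a ⊔ Ideal.span {y}) → r ∈ K := by
    intro a
    by_cases ha : a ∈ F
    · obtain ⟨s, hs⟩ := hs a ha
      exact ⟨s, fun _ => hs⟩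
    · exact ⟨∅, fun h => absurd h ha⟩
  choose s hs using hs'
  set JJ : Finset (Ideal R) := insert (Ideal.span (F : Set R)) (F.biUnion fun a => (s a).image fun y => bb F a ⊔ Ideal.span {y}) with hJJ
  have hcard : JJ.card ≤ l * (n - g).choose (l - g + 1) + 1 := by
    refine (Finset.card_insert_le _ _).trans (Nat.succ_le_succ ?_)
    rw [← h.card]
    exact Finset.card_biUnion_le_card_mul _ _ _ fun a ha => Finset.card_image_le.trans (by rw [h.card]; exact (hs a ha).2.1)
  have hmin : ∀ J ∈ JJ, IsMinimalReduction J I := by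
    intro J hJ
    rw [hJJ, Finset.mem_insert] at hJ
    rcases hJ with rfl | hJ
    · rw [hFJ]; exact hJ0
    · rw [Finset.mem_biUnion] at hJ
      obtain ⟨a, ha, hJ⟩ := hJ
      obtain ⟨y, hy, rfl⟩ := Finset.mem_image.1 hJ
      refine (minRed_iff hl).2 ⟨((hs a ha).1 y hy).2, insert y (F.erase a), ?_, ?_⟩
      · refine (Finset.card_insert_le _ _).trans ?_
        rw [Finset.card_erase_add_one ha, h.card]
      · rw [Finset.coe_insert, Ideal.span_insert, sup_comm]; rfl
  have hinf : (⨅ J ∈ JJ, J) ≤ K * Ideal.span (F : Set R) := by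
    intro x hx
    have hxJ : ∀ J ∈ JJ, x ∈ J := by
      intro J hJ
      exact (iInf₂_le J hJ : (⨅ J ∈ JJ, J) ≤ J) hx
    obtain ⟨k, hk⟩ := mem_span_F (hxJ _ (Finset.mem_insert_self _ _))
    refine mem_mul_span.2 ⟨k, fun a ha => (hs a ha).2.2 _ fun y hy => ?_, hk⟩
    have h1 := hxJ (bb F a ⊔ Ideal.span {y}) (Finset.mem_insert_of_mem (Finset.mem_biUnion.2 ⟨a, ha, Finset.mem_image_of_mem _ hy⟩))
    have h2 := sum_bb (k := k) ha
    rw [← hk] at h2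
    have h3 := Ideal.sub_mem _ h1 (Ideal.mem_sup_left (T := Ideal.span {y}) h2)
    rwa [sub_sub_cancel, mul_comm a] at h3
  have hFI : Ideal.span (F : Set R) ≤ I := h.red.1
  have hcoreLe : core I ≤ ⨅ J ∈ JJ, J := le_iInf₂ fun J hJ => sInf_le (hmin J hJ)
  have e1 : core I = K * I := le_antisymm (hcoreLe.trans (hinf.trans (Ideal.mul_mono_right hFI))) hcoreGe
  have e2 : core I = ⨅ J ∈ JJ, J := le_antisymm hcoreLe (hinf.trans ((Ideal.mul_mono_right hFI).trans hcoreGe))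
  constructor
  · intro J hJ
    have h1 : Submodule.colon J I = K := (hchain J hJ).1
    rw [h1, e1]
    exact ⟨le_antisymm (hKle J hJ) (Ideal.mul_mono_right hJ.1.1), rfl⟩
  · refine le_trans (b := ((JJ.card : ℕ) : ℕ∞)) ?_ (by exact_mod_cast hcard)
    refine sInf_le ⟨JJ.card, rfl, fun i => (JJ.equivFin.symm i : Ideal R), fun i => hmin _ (JJ.equivFin.symm i).2, ?_⟩
    rw [e2]
    apply le_antisymm
    · exact le_iInf fun i => iInf₂_le _ (JJ.equivFin.symm i).2
    · refine le_iInf₂ fun J hJ => (iInf_le _ (JJ.equivFin ⟨J, hJ⟩)).trans (by simp)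

end A22
end Part22

/-- Theorem 2.6(2): under Gorenstein and depth conditions at the primes of `Q(I)`,
if the reduction number of `I` is at most `ℓ - g + 1`, then
`core I = (J:I)J = (J:I)I` for every minimal reduction `J`, and
`γ(I) ≤ ℓ·C(n-g, ℓ-g+1) + 1`. -/
theorem statement6 {R : Type u} [CommRing R] [IsNoetherianRing R] [IsLocalRing R]
    (hCM : IsCMLocalRing R) (hres : Infinite (ResidueField R))
    (I : Ideal R) (g l n : ℕ)
    (hg : ht I = (g : WithBot ℕ∞)) (hl : fiberDim I = (l : WithBot ℕ∞))
    (hn : muE I = (n : ℕ∞))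
    (hG : Gcond I l) (hS2 : UnivWeaklyResS2 I (l - 1))
    (hQ : ∀ p ∈ QSet I l,
      IsGorensteinLocalRing (Localization.AtPrime p.asIdeal) ∧
      ∀ j : ℕ, 1 ≤ j → j ≤ l - g →
        (l : WithBot ℕ∞) + 1 ≤
          (qDepth (Localization.AtPrime p.asIdeal)
            (Ideal.map (algebraMap R (Localization.AtPrime p.asIdeal)) (I ^ j)) : WithBot ℕ∞)
            + (g : WithBot ℕ∞) + (j : WithBot ℕ∞))
    (hr : reductionNumber I ≤ ((l - g + 1 : ℕ) : ℕ∞)) :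
    (∀ J, IsMinimalReduction J I →
      core I = Submodule.colon J I * J ∧ core I = Submodule.colon J I * I) ∧
    gamma I ≤ ((l * Nat.choose (n - g) (l - g + 1) + 1 : ℕ) : ℕ∞) := by
  obtain ⟨d, H⟩ := Amb.of hCM I g l hg hG hS2
  have := hres
  exact final H hl hn hQ hr

end CPU
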